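/- arXiv:2207.04851 — 3 statements merged into one kernel-verified Lean document; each statement's English description precedes it below -/
import Mathlib

section
/- Suppose m₁ = m₂. Then there exists a nonconstant solution (ξ, θ, α) of (*) with θ(t) ∈ (0, π/2) for all t ∈ ℝ, and a number T > 0 such that ξ(t + 2T) = ξ(t) and θ(t + 2T) = θ(t) for all t ∈ ℝ, and such that the planar curve t ↦ (ξ(t), θ(t)) is injective on the interval [0, 2T) (i.e. the closed curve is simple). -/
/-- The constant `m = m₁ + m₂ + 2/g`. -/
noncomputable def mconst (g m₁ m₂ : ℕ) : ℝ := (m₁ : ℝ) + (m₂ : ℝ) + 2 / (g : ℝ)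

/-- The angle `θ* = arctan √(m₁/m₂)`. -/
noncomputable def thetaStar (m₁ m₂ : ℕ) : ℝ :=
  Real.arctan (Real.sqrt ((m₁ : ℝ) / (m₂ : ℝ)))

/-- `l(θ) = m₁ cos² θ - m₂ sin² θ`. -/
noncomputable def lfun (m₁ m₂ : ℕ) (θ : ℝ) : ℝ :=
  (m₁ : ℝ) * Real.cos θ ^ 2 - (m₂ : ℝ) * Real.sin θ ^ 2

/-- `(ξ, θ, α)` is a (globally defined) solution of the ODE system (*):
`ξ' = cos α · sin 2θ`, `θ' = sin α · sin 2θ`,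
`α' = sin α · sin 2θ · (exp((4/g)ξ) - m) + 2 cos α · l(θ)`. -/
def IsSolution (g m₁ m₂ : ℕ) (ξ θ α : ℝ → ℝ) : Prop :=
  ∀ t : ℝ,
    HasDerivAt ξ (Real.cos (α t) * Real.sin (2 * θ t)) t ∧
    HasDerivAt θ (Real.sin (α t) * Real.sin (2 * θ t)) t ∧
    HasDerivAt α
      (Real.sin (α t) * Real.sin (2 * θ t) *
          (Real.exp (4 / (g : ℝ) * ξ t) - mconst g m₁ m₂) +
        2 * Real.cos (α t) * lfun m₁ m₂ (θ t)) t

section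

open Set Filter Topology
open Real (cos sin exp log)
open scoped NNReal Real

/-- A bounded Lipschitz autonomous vector field has global integral curves. -/
theorem exists_global_solution {E : Type*} [NormedAddCommGroup E] [NormedSpace ℝ E]
    [CompleteSpace E] {v : E → E} {K L : ℝ≥0} (hK : LipschitzWith K v)
    (hL : ∀ x, ‖v x‖ ≤ L) (x₀ : E) :
    ∃ f : ℝ → E, f 0 = x₀ ∧ ∀ t, HasDerivAt f (v (f t)) t := by
  have hloc : ∀ n : ℕ, ∃ f : ℝ → E, f 0 = x₀ ∧
      ∀ t ∈ Ioo (-((n : ℝ) + 1)) ((n : ℝ) + 1), HasDerivAt f (v (f t)) t := by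
    intro n
    have hn : (0 : ℝ) ≤ (n : ℝ) + 1 := by positivity
    have h0 : (0 : ℝ) ∈ Icc (-((n : ℝ) + 1)) ((n : ℝ) + 1) := ⟨by linarith, hn⟩
    have hP : IsPicardLindelof (fun _ => v) (tmin := -((n : ℝ) + 1)) (tmax := (n : ℝ) + 1)
        ⟨0, h0⟩ x₀ (L * ⟨(n : ℝ) + 1, hn⟩) 0 L K :=
      { lipschitzOnWith := fun t _ => hK.lipschitzOnWith
        continuousOn := fun x _ => continuousOn_const
        norm_le := fun t _ x _ => hL x
        mul_max_le := by
          simp only [sub_zero, zero_sub, neg_neg, max_self, NNReal.coe_zero]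
          exact (NNReal.coe_mul L ⟨(n : ℝ) + 1, hn⟩).ge }
    obtain ⟨f, hf0, hf⟩ := hP.exists_eq_forall_mem_Icc_hasDerivWithinAt₀
    exact ⟨f, hf0, fun t ht => (hf t (Ioo_subset_Icc_self ht)).hasDerivAt (Icc_mem_nhds ht.1 ht.2)⟩
  choose f hf0 hf using hloc
  have hagree : ∀ n p : ℕ, n ≤ p → EqOn (f n) (f p) (Ioo (-((n : ℝ) + 1)) ((n : ℝ) + 1)) := by
    intro n p hnp
    have hnp' : (n : ℝ) ≤ p := by exact_mod_cast hnp
    refine ODE_solution_unique_of_mem_Ioo (v := fun _ => v) (s := fun _ => univ) (t₀ := 0) (K := K)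
      (fun t _ => hK.lipschitzOnWith) ⟨by linarith [n.cast_nonneg (α := ℝ)], by positivity⟩
      (fun t ht => ⟨hf n t ht, trivial⟩)
      (fun t ht => ⟨hf p t ⟨by linarith [ht.1], by linarith [ht.2]⟩, trivial⟩) ?_
    rw [hf0, hf0]
  refine ⟨fun t => f ⌈|t|⌉₊ t, by simp [hf0], fun t => ?_⟩
  set N := ⌈|t|⌉₊ + 1
  have hNt : |t| + 1 ≤ N := by
    have := Nat.le_ceil |t|
    push_cast [N]; linarith
  have hEq : ∀ s, |s| < |t| + 1 → f ⌈|s|⌉₊ s = f N s := by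
    intro s hs
    refine hagree _ _ (Nat.ceil_le.2 (by linarith)) ?_
    have := Nat.le_ceil |s|
    rw [mem_Ioo, ← abs_lt]; linarith
  have hev : (fun s => f ⌈|s|⌉₊ s) =ᶠ[𝓝 t] f N := by
    filter_upwards [(isOpen_lt continuous_abs continuous_const).mem_nhds
      (show |t| < |t| + 1 by linarith)] with s hs using hEq s hs
  have h := (hf N t (by rw [mem_Ioo, ← abs_lt]; linarith)).congr_of_eventuallyEq hev
  have ht : f ⌈|t|⌉₊ t = f N t := hEq t (by linarith)
  simpa only [ht] using h

/-- Bounded Lipschitz real functions. -/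
def BddLip {E : Type*} [PseudoMetricSpace E] (f : E → ℝ) : Prop :=
  ∃ C, 0 ≤ C ∧ (∀ p, |f p| ≤ C) ∧ ∀ p q, |f p - f q| ≤ C * dist p q

namespace BddLip

variable {E : Type*} [PseudoMetricSpace E] {f g : E → ℝ}

theorem const (c : ℝ) : BddLip (fun _ : E => c) :=
  ⟨|c|, abs_nonneg c, fun _ => le_rfl, fun p q => by simp; positivity⟩

theorem add (hf : BddLip f) (hg : BddLip g) : BddLip (fun p => f p + g p) := by
  obtain ⟨C, hC, hf1, hf2⟩ := hf
  obtain ⟨D, hD, hg1, hg2⟩ := hg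
  refine ⟨C + D, by positivity, fun p => (abs_add_le _ _).trans (add_le_add (hf1 p) (hg1 p)),
    fun p q => ?_⟩
  calc |f p + g p - (f q + g q)| = |(f p - f q) + (g p - g q)| := by ring_nf
    _ ≤ C * dist p q + D * dist p q := (abs_add_le _ _).trans (add_le_add (hf2 p q) (hg2 p q))
    _ = _ := by ring

theorem mul (hf : BddLip f) (hg : BddLip g) : BddLip (fun p => f p * g p) := by
  obtain ⟨C, hC, hf1, hf2⟩ := hf
  obtain ⟨D, hD, hg1, hg2⟩ := hg
  refine ⟨C * D + C * D, by positivity, fun p => ?_, fun p q => ?_⟩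
  · rw [abs_mul]
    nlinarith [mul_le_mul (hf1 p) (hg1 p) (abs_nonneg _) hC, mul_nonneg hC hD]
  · calc |f p * g p - f q * g q| = |f p * (g p - g q) + (f p - f q) * g q| := by ring_nf
      _ ≤ |f p| * |g p - g q| + |f p - f q| * |g q| := by
        rw [← abs_mul, ← abs_mul]; exact abs_add_le _ _
      _ ≤ C * (D * dist p q) + (C * dist p q) * D := by
        gcongr
        · exact hf1 p
        · exact hg2 p q
        · exact hf2 p q
        · exact hg1 q
      _ = _ := by ring

theorem comp {F : Type*} [PseudoMetricSpace F] {φ : F → E} {M : ℝ} (hf : BddLip f)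
    (hφ : ∀ p q, dist (φ p) (φ q) ≤ M * dist p q) (hM : 0 ≤ M) : BddLip (fun p => f (φ p)) := by
  obtain ⟨C, hC, hf1, hf2⟩ := hf
  refine ⟨C + C * M, by positivity, fun p => (hf1 _).trans (by nlinarith), fun p q => ?_⟩
  have h := mul_le_mul_of_nonneg_left (hφ p q) hC
  have h2 := mul_nonneg hC (dist_nonneg (x := p) (y := q))
  nlinarith [hf2 (φ p) (φ q)]

end BddLip

theorem bddLip_sin : BddLip sin :=
  ⟨1, zero_le_one, Real.abs_sin_le_one, fun p q => by
    simpa [Real.dist_eq] using Real.lipschitzWith_sin.dist_le_mul p q⟩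

theorem bddLip_cos : BddLip cos :=
  ⟨1, zero_le_one, Real.abs_cos_le_one, fun p q => by
    simpa [Real.dist_eq] using Real.lipschitzWith_cos.dist_le_mul p q⟩

theorem bddLip_exp_min {c : ℝ} (hc : 0 < c) (R : ℝ) : BddLip (fun x => exp (c * min x R)) := by
  have key : ∀ p q, p ≤ q → |exp (c * min p R) - exp (c * min q R)|
      ≤ exp (c * R) * (c * (q - p)) := by
    intro p q hpq
    have h1 : min p R ≤ min q R := min_le_min_right R hpq
    have h2 : min q R - min p R ≤ q - p := by
      rcases min_cases p R with h | h <;> rcases min_cases q R with h' | h' <;> linarith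
    have h3 : exp (c * min q R) ≤ exp (c * R) :=
      Real.exp_le_exp.2 (mul_le_mul_of_nonneg_left (min_le_right _ _) hc.le)
    have h4 : exp (c * min p R) ≤ exp (c * min q R) :=
      Real.exp_le_exp.2 (mul_le_mul_of_nonneg_left h1 hc.le)
    rw [abs_sub_comm, abs_of_nonneg (by linarith)]
    have h5 : exp (c * min p R) = exp (c * min q R) * exp (c * (min p R - min q R)) := by
      rw [← Real.exp_add]; ring_nf
    have h6 := Real.add_one_le_exp (c * (min p R - min q R))
    calc exp (c * min q R) - exp (c * min p R)
        = exp (c * min q R) * (1 - exp (c * (min p R - min q R))) := by rw [h5]; ring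
      _ ≤ exp (c * min q R) * (c * (q - p)) := by
        gcongr
        nlinarith
      _ ≤ _ := by
        exact mul_le_mul_of_nonneg_right h3 (mul_nonneg hc.le (by linarith))
  refine ⟨exp (c * R) * (1 + c), by positivity, fun p => ?_, fun p q => ?_⟩
  · rw [abs_of_pos (Real.exp_pos _)]
    have h3 : exp (c * min p R) ≤ exp (c * R) :=
      Real.exp_le_exp.2 (mul_le_mul_of_nonneg_left (min_le_right _ _) hc.le)
    nlinarith [mul_pos (Real.exp_pos (c * R)) hc]
  · rw [Real.dist_eq]
    have hpos := mul_nonneg (Real.exp_pos (c * R)).le (abs_nonneg (p - q))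
    rcases le_total p q with h | h
    · have := key p q h
      rw [abs_sub_comm p q, abs_of_nonneg (by linarith : 0 ≤ q - p)] at *
      nlinarith
    · have := key q p h
      rw [abs_sub_comm] at this
      rw [abs_of_nonneg (by linarith : 0 ≤ p - q)] at *
      nlinarith

theorem exists_lipschitzWith_prod {E : Type*} [PseudoMetricSpace E] {F G : Type*}
    [SeminormedAddCommGroup F] [SeminormedAddCommGroup G] {f : E → F} {g : E → G}
    (hf : ∃ K : ℝ≥0, LipschitzWith K f ∧ ∀ p, ‖f p‖ ≤ K)
    (hg : ∃ K : ℝ≥0, LipschitzWith K g ∧ ∀ p, ‖g p‖ ≤ K) :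
    ∃ K : ℝ≥0, LipschitzWith K (fun p => (f p, g p)) ∧ ∀ p, ‖(f p, g p)‖ ≤ K := by
  obtain ⟨K, hK, hK'⟩ := hf
  obtain ⟨M, hM, hM'⟩ := hg
  refine ⟨max K M, hK.prodMk hM, fun p => ?_⟩
  rw [Prod.norm_def, NNReal.coe_max]
  exact max_le_max (hK' p) (hM' p)

theorem BddLip.exists_lipschitzWith {E : Type*} [PseudoMetricSpace E] {f : E → ℝ}
    (hf : BddLip f) : ∃ K : ℝ≥0, LipschitzWith K f ∧ ∀ p, ‖f p‖ ≤ K := by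
  obtain ⟨C, hC, hf1, hf2⟩ := hf
  exact ⟨⟨C, hC⟩, LipschitzWith.of_dist_le_mul hf2, hf1⟩

/-- The vector field of the system in the variable `y = θ - π/4` (when `m₁ = m₂ = k` and
`m = exp (c z)`), with the exponential frozen beyond `x = R`. -/
noncomputable def shootField (c z R : ℝ) (k : ℕ) (p : ℝ × ℝ × ℝ) : ℝ × ℝ × ℝ :=
  (cos p.2.2 * cos (2 * p.2.1), sin p.2.2 * cos (2 * p.2.1),
    sin p.2.2 * cos (2 * p.2.1) * (exp (c * min p.1 R) - exp (c * z)) -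
      2 * k * cos p.2.2 * sin (2 * p.2.1))

theorem exists_lipschitzWith_shootField {c : ℝ} (hc : 0 < c) (z R : ℝ) (k : ℕ) :
    ∃ K : ℝ≥0, LipschitzWith K (shootField c z R k) ∧ ∀ p, ‖shootField c z R k p‖ ≤ K := by
  have hx : ∀ p q : ℝ × ℝ × ℝ, dist p.1 q.1 ≤ 1 * dist p q := fun p q => by
    rw [one_mul]; exact le_max_left _ _
  have ha : ∀ p q : ℝ × ℝ × ℝ, dist p.2.2 q.2.2 ≤ 1 * dist p q := fun p q => by
    rw [one_mul]; exact (le_max_right _ _).trans (le_max_right _ _)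
  have hy : ∀ p q : ℝ × ℝ × ℝ, dist (2 * p.2.1) (2 * q.2.1) ≤ 2 * dist p q := fun p q => by
    have h : dist p.2.1 q.2.1 ≤ dist p q := (le_max_left _ _).trans (le_max_right _ _)
    rw [Real.dist_eq] at *
    rw [← mul_sub, abs_mul, abs_two]; linarith
  have e := (bddLip_exp_min hc R).comp hx zero_le_one
  have sa := bddLip_sin.comp ha zero_le_one
  have ca := bddLip_cos.comp ha zero_le_one
  have sy := bddLip_sin.comp hy zero_le_two
  have cy := bddLip_cos.comp hy zero_le_two
  have h3 := ((sa.mul cy).mul (e.add (BddLip.const (-exp (c * z))))).add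
    (((BddLip.const (-(2 * (k : ℝ)))).mul ca).mul sy)
  have := exists_lipschitzWith_prod (ca.mul cy).exists_lipschitzWith
    (exists_lipschitzWith_prod (sa.mul cy).exists_lipschitzWith h3.exists_lipschitzWith)
  have heq : shootField c z R k = fun p => (cos p.2.2 * cos (2 * p.2.1),
      sin p.2.2 * cos (2 * p.2.1), sin p.2.2 * cos (2 * p.2.1) *
        (exp (c * min p.1 R) + -exp (c * z)) + -(2 * (k : ℝ)) * cos p.2.2 * sin (2 * p.2.1)) := by
    funext p
    refine Prod.ext rfl (Prod.ext rfl ?_)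
    simp only [shootField]
    ring
  rw [heq]
  exact this

/-- A global solution of the modified system, shot vertically from the point `(b, 0)`. -/
structure IsShot (c z R : ℝ) (k : ℕ) (b : ℝ) (x y a : ℝ → ℝ) : Prop where
  dx : ∀ t, HasDerivAt x (cos (a t) * cos (2 * y t)) t
  dy : ∀ t, HasDerivAt y (sin (a t) * cos (2 * y t)) t
  da : ∀ t, HasDerivAt a (sin (a t) * cos (2 * y t) * (exp (c * min (x t) R) - exp (c * z)) -
      2 * k * cos (a t) * sin (2 * y t)) t
  x0 : x 0 = b
  y0 : y 0 = 0
  a0 : a 0 = π / 2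

theorem exists_shot {c : ℝ} (hc : 0 < c) (z R : ℝ) (k : ℕ) :
    ∃ x y a : ℝ → ℝ → ℝ, (∀ b, IsShot c z R k b (x b) (y b) (a b)) ∧
      ∃ K : ℝ, ∀ b b' t, 0 ≤ t →
        |x b t - x b' t| ≤ |b - b'| * exp (K * t) ∧ |y b t - y b' t| ≤ |b - b'| * exp (K * t) ∧
        |a b t - a b' t| ≤ |b - b'| * exp (K * t) := by
  obtain ⟨K, hK, hL⟩ := exists_lipschitzWith_shootField hc z R k
  choose f hf0 hf using fun b : ℝ => exists_global_solution hK hL (b, 0, π / 2)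
  refine ⟨fun b t => (f b t).1, fun b t => (f b t).2.1, fun b t => (f b t).2.2, fun b => ?_, K, ?_⟩
  · exact { dx := fun t => (hf b t).fst
            dy := fun t => (hf b t).snd.fst
            da := fun t => (hf b t).snd.snd
            x0 := by simp [hf0]
            y0 := by simp [hf0]
            a0 := by simp [hf0] }
  · intro b b' t ht
    have h := dist_le_of_trajectories_ODE (v := fun _ => shootField c z R k) (K := K)
      (f := f b) (g := f b') (a := 0) (b := t) (δ := |b - b'|) (fun _ => hK)
      (HasDerivAt.continuousOn fun s _ => hf b s) (fun s _ => (hf b s).hasDerivWithinAt)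
      (HasDerivAt.continuousOn fun s _ => hf b' s) (fun s _ => (hf b' s).hasDerivWithinAt)
      (by simp [hf0, Prod.dist_eq, Real.dist_eq]) t ⟨ht, le_rfl⟩
    rw [sub_zero, Prod.dist_eq, Prod.dist_eq, max_le_iff, max_le_iff] at h
    exact ⟨h.1, h.2.1, h.2.2⟩

theorem monotoneOn_Icc_of_hasDerivAt {f f' : ℝ → ℝ} {p q : ℝ}
    (hf : ∀ t ∈ Icc p q, HasDerivAt f (f' t) t) (h : ∀ t ∈ Icc p q, 0 ≤ f' t) :
    MonotoneOn f (Icc p q) := by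
  refine monotoneOn_of_deriv_nonneg (convex_Icc p q) (HasDerivAt.continuousOn hf)
    (fun t ht => ?_) fun t ht => ?_
  · exact (hf t (interior_subset ht)).differentiableAt.differentiableWithinAt
  · rw [(hf t (interior_subset ht)).deriv]
    exact h t (interior_subset ht)

theorem antitoneOn_Icc_of_hasDerivAt {f f' : ℝ → ℝ} {p q : ℝ}
    (hf : ∀ t ∈ Icc p q, HasDerivAt f (f' t) t) (h : ∀ t ∈ Icc p q, f' t ≤ 0) :
    AntitoneOn f (Icc p q) := by
  have := monotoneOn_Icc_of_hasDerivAt (f := fun t => -f t) (fun t ht => (hf t ht).neg)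
    fun t ht => neg_nonneg.2 (h t ht)
  intro s hs t ht hst
  linarith [this hs ht hst]

namespace IsShot

variable {c z R b : ℝ} {k : ℕ} {x y a : ℝ → ℝ}

theorem continuous_x (h : IsShot c z R k b x y a) : Continuous x :=
  continuous_iff_continuousAt.2 fun t => (h.dx t).continuousAt

theorem continuous_y (h : IsShot c z R k b x y a) : Continuous y :=
  continuous_iff_continuousAt.2 fun t => (h.dy t).continuousAt

theorem continuous_a (h : IsShot c z R k b x y a) : Continuous a :=
  continuous_iff_continuousAt.2 fun t => (h.da t).continuousAt

theorem y_ne_of_cos_eq_zero (h : IsShot c z R k b x y a) {y₀ : ℝ} (h0 : y₀ ≠ 0)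
    (hc : cos (2 * y₀) = 0) (t : ℝ) : y t ≠ y₀ := by
  intro ht
  have key : y = fun _ => y₀ := by
    refine ODE_solution_unique_univ (v := fun t p => sin (a t) * cos (2 * p))
      (s := fun _ => univ) (K := 2) (t₀ := t) (fun s => ?_) (fun s => ⟨h.dy s, trivial⟩)
      (fun s => ⟨by simpa [hc] using hasDerivAt_const s y₀, trivial⟩) ht
    refine (LipschitzWith.of_dist_le_mul fun p q => ?_).lipschitzOnWith
    have h1 := Real.lipschitzWith_cos.dist_le_mul (2 * p) (2 * q)
    rw [Real.dist_eq, Real.dist_eq, ← mul_sub 2, abs_mul 2, abs_two] at h1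
    rw [Real.dist_eq, Real.dist_eq, ← mul_sub, abs_mul]
    simp only [NNReal.coe_one, one_mul, NNReal.coe_ofNat] at h1 ⊢
    nlinarith [Real.abs_sin_le_one (a s), abs_nonneg (sin (a s)),
      abs_nonneg (cos (2 * p) - cos (2 * q))]
  exact h0 (by rw [← h.y0, key])

theorem abs_y_lt (h : IsShot c z R k b x y a) (t : ℝ) : |y t| < π / 4 := by
  have hpi := Real.pi_pos
  rw [abs_lt]
  constructor
  · by_contra! hcon
    obtain ⟨s, hs⟩ := mem_range_of_exists_le_of_exists_ge h.continuous_y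
      ⟨t, hcon⟩ ⟨0, by rw [h.y0]; linarith⟩
    refine h.y_ne_of_cos_eq_zero (by linarith) ?_ s hs
    rw [show 2 * -(π / 4) = -(π / 2) by ring, Real.cos_neg, Real.cos_pi_div_two]
  · by_contra! hcon
    obtain ⟨s, hs⟩ := mem_range_of_exists_le_of_exists_ge h.continuous_y
      ⟨0, by rw [h.y0]; linarith⟩ ⟨t, hcon⟩
    refine h.y_ne_of_cos_eq_zero (by linarith) ?_ s hs
    rw [show 2 * (π / 4) = π / 2 by ring, Real.cos_pi_div_two]

theorem cos_pos (h : IsShot c z R k b x y a) (t : ℝ) : 0 < cos (2 * y t) := by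
  have := abs_lt.1 (h.abs_y_lt t)
  exact Real.cos_pos_of_mem_Ioo ⟨by linarith, by linarith⟩

theorem not_vertical (hc : 0 < c) (hzR : z ≤ R) (hb : z ≠ b) (h : IsShot c z R k b x y a)
    {t : ℝ} (h1 : cos (a t) = 0) (h2 : x t = z) : False := by
  obtain ⟨K, hK, -⟩ := exists_lipschitzWith_shootField hc z R k
  have key : (fun s => (x s, y s, a s)) = fun s => (z, y s, a t) := by
    refine ODE_solution_unique_univ (v := fun s p => ((shootField c z R k p).1,
      sin (a s) * cos (2 * y s), (shootField c z R k (p.1, y s, p.2.2)).2.2))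
      (s := fun s => univ) (K := K) (t₀ := t) (fun s => ?_)
      (fun s => ⟨(h.dx s).prodMk ((h.dy s).prodMk (h.da s)), trivial⟩) (fun s => ⟨?_, trivial⟩)
      (by simp [h2])
    · refine (LipschitzWith.of_dist_le_mul fun p q => ?_).lipschitzOnWith
      have hp := hK.dist_le_mul p q
      have hq := hK.dist_le_mul (p.1, y s, p.2.2) (q.1, y s, q.2.2)
      have hq' : dist (p.1, y s, p.2.2) (q.1, y s, q.2.2) ≤ dist p q := by
        simp only [Prod.dist_eq, dist_self]
        exact max_le_max le_rfl (max_le (dist_nonneg.trans (le_max_left _ _)) (le_max_right _ _))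
      have hq'' := mul_le_mul_of_nonneg_left hq' K.coe_nonneg
      rw [Prod.dist_eq, Prod.dist_eq] at hp hq ⊢
      rw [max_le_iff, max_le_iff] at hp hq ⊢
      refine ⟨hp.1, ?_, hq.2.2.trans hq''⟩
      rw [dist_self]
      positivity
    · refine ((hasDerivAt_const s z).prodMk
        ((h.dy s).prodMk (hasDerivAt_const s (a t)))).congr_deriv ?_
      simp [shootField, h1, min_eq_left hzR]
  have := congrArg Prod.fst (congrFun key 0)
  simp only [h.x0] at this
  exact hb this.symm

theorem not_horizontal (hc : 0 < c) (h : IsShot c z R k b x y a) {t : ℝ}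
    (h1 : y t = 0) (h2 : sin (a t) = 0) : False := by
  obtain ⟨K, hK, -⟩ := exists_lipschitzWith_shootField hc z R k
  have key : (fun s => (x s, y s, a s)) = fun s => (x s, 0, a t) := by
    refine ODE_solution_unique_univ (v := fun s p => (cos (a s) * cos (2 * y s),
      (shootField c z R k (x s, p.2)).2))
      (s := fun s => univ) (K := K) (t₀ := t) (fun s => ?_)
      (fun s => ⟨(h.dx s).prodMk ((h.dy s).prodMk (h.da s)), trivial⟩) (fun s => ⟨?_, trivial⟩)
      (by simp [h1])
    · refine (LipschitzWith.of_dist_le_mul fun p q => ?_).lipschitzOnWith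
      have hq := hK.dist_le_mul (x s, p.2) (x s, q.2)
      have hq' : dist (x s, p.2) (x s, q.2) ≤ dist p q := by
        rw [Prod.dist_eq, Prod.dist_eq, dist_self]
        exact max_le (dist_nonneg.trans (le_max_left _ _)) (le_max_right _ _)
      have hq'' := mul_le_mul_of_nonneg_left hq' K.coe_nonneg
      rw [Prod.dist_eq, max_le_iff] at hq ⊢
      refine ⟨?_, hq.2.trans hq''⟩
      rw [dist_self]
      positivity
    · refine ((h.dx s).prodMk
        ((hasDerivAt_const s (0 : ℝ)).prodMk (hasDerivAt_const s (a t)))).congr_deriv ?_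
      simp [shootField, h2]
  have := congrArg (fun p => sin p.2.2) (congrFun key 0)
  simp [h.a0, h2] at this

theorem reflect (hc : 0 < c) (h : IsShot c z R k b x y a) {τ : ℝ} (h1 : y τ = 0)
    (h2 : cos (a τ) = 0) (t : ℝ) : x (2 * τ - t) = x t ∧ y (2 * τ - t) = -y t := by
  obtain ⟨K, hK, -⟩ := exists_lipschitzWith_shootField hc z R k
  have hd : ∀ t, HasDerivAt (fun t => 2 * τ - t) (-1) t := fun t => by
    simpa using (hasDerivAt_id t).const_sub (2 * τ)
  have hs2 : sin (2 * a τ) = 0 := by rw [Real.sin_two_mul, h2]; ring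
  have hc2 : cos (2 * a τ) = -1 := by rw [Real.cos_two_mul, h2]; ring
  have key : (fun s => (x (2 * τ - s), -y (2 * τ - s), 2 * a τ - a (2 * τ - s))) =
      fun s => (x s, y s, a s) := by
    refine ODE_solution_unique_univ (v := fun _ => shootField c z R k) (s := fun _ => univ)
      (K := K) (t₀ := τ) (fun _ => hK.lipschitzOnWith) (fun s => ⟨?_, trivial⟩)
      (fun s => ⟨(h.dx s).prodMk ((h.dy s).prodMk (h.da s)), trivial⟩) ?_
    · have e1 := (h.dx (2 * τ - s)).comp s (hd s)
      have e2 := ((h.dy (2 * τ - s)).comp s (hd s)).neg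
      have e3 := ((h.da (2 * τ - s)).comp s (hd s)).const_sub (2 * a τ)
      refine (e1.prodMk (e2.prodMk e3)).congr_deriv ?_
      simp only [shootField, Real.cos_sub, Real.sin_sub, hs2, hc2, mul_neg, Real.cos_neg,
        Real.sin_neg]
      refine Prod.ext ?_ (Prod.ext ?_ ?_) <;> simp only <;> ring
    · have : 2 * τ - τ = τ := by ring
      simp only [this, h1, Prod.mk.injEq, true_and]
      exact ⟨neg_zero, by ring⟩
  have := congrFun key t
  simp only [Prod.mk.injEq] at this
  exact ⟨this.1, by linarith [this.2.1]⟩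

end IsShot

theorem add_mul_le_of_hasDerivAt {f f' : ℝ → ℝ} {p q κ : ℝ} (hpq : p ≤ q)
    (hf : ∀ t ∈ Icc p q, HasDerivAt f (f' t) t) (h : ∀ t ∈ Icc p q, κ ≤ f' t) :
    f p + κ * (q - p) ≤ f q := by
  have := monotoneOn_Icc_of_hasDerivAt (f := fun t => f t - κ * t)
    (fun t ht => (hf t ht).sub ((hasDerivAt_id t).const_mul κ)) (fun t ht => by
      have := h t ht
      simp only [mul_one]; linarith) (left_mem_Icc.2 hpq) (right_mem_Icc.2 hpq) hpq
  simp only at this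
  linarith

theorem mul_cos_le_sin {w : ℝ} (h0 : 0 ≤ w) (h1 : w ≤ π / 2) : w * cos w ≤ sin w := by
  rcases h1.lt_or_eq with h1 | h1
  · have hc : 0 < cos w := Real.cos_pos_of_mem_Ioo ⟨by linarith, h1⟩
    have := Real.le_tan h0 h1
    rwa [Real.tan_eq_sin_div_cos, le_div_iff₀ hc] at this
  · rw [h1, Real.cos_pi_div_two, Real.sin_pi_div_two]; norm_num

theorem one_le_sin_add_cos {w : ℝ} (h0 : 0 ≤ w) (h1 : w ≤ π / 2) : 1 ≤ sin w + cos w := by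
  have hs : 0 ≤ sin w := Real.sin_nonneg_of_nonneg_of_le_pi h0 (by linarith [Real.pi_pos])
  have hc : 0 ≤ cos w := Real.cos_nonneg_of_mem_Icc ⟨by linarith, h1⟩
  nlinarith [Real.sin_sq_add_cos_sq w]

theorem mul_cos_two_mul_le_sin {y : ℝ} (h0 : 0 ≤ y) (h1 : y ≤ π / 4) :
    y * cos (2 * y) ≤ sin (2 * y) := by
  have hj := Real.mul_le_sin (x := 2 * y) (by linarith) (by linarith)
  have hp : 2 / π * (2 * y) ≥ y := by
    have := Real.pi_pos
    have h4 := Real.pi_le_four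
    rw [ge_iff_le, div_mul_eq_mul_div, le_div_iff₀ this]
    nlinarith
  nlinarith [Real.cos_le_one (2 * y)]

/-- The arc of the shot over `[0, T]` stays in the upper half plane and moves to the left. -/
def IsLeftArc (y a : ℝ → ℝ) (T : ℝ) : Prop :=
  ∀ t ∈ Icc 0 T, 0 ≤ y t ∧ π / 2 ≤ a t ∧ a t ≤ π + π / 2

theorem IsLeftArc.mono {y a : ℝ → ℝ} {T T' : ℝ} (h : IsLeftArc y a T) (hT : T' ≤ T) :
    IsLeftArc y a T' := fun t ht => h t ⟨ht.1, ht.2.trans hT⟩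

theorem IsLeftArc.cos_nonpos {y a : ℝ → ℝ} {T t : ℝ} (h : IsLeftArc y a T)
    (ht : t ∈ Icc 0 T) : cos (a t) ≤ 0 :=
  Real.cos_nonpos_of_pi_div_two_le_of_le (h t ht).2.1 (h t ht).2.2

namespace IsShot

variable {c z R b : ℝ} {k : ℕ} {x y a : ℝ → ℝ} {T : ℝ}

theorem antitoneOn_x (h : IsShot c z R k b x y a) (hK : IsLeftArc y a T) :
    AntitoneOn x (Icc 0 T) :=
  antitoneOn_Icc_of_hasDerivAt (fun t _ => h.dx t) fun t ht =>
    mul_nonpos_of_nonpos_of_nonneg (hK.cos_nonpos ht) (h.cos_pos t).le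

theorem x_le (h : IsShot c z R k b x y a) (hK : IsLeftArc y a T) {t : ℝ} (ht : t ∈ Icc 0 T) :
    x t ≤ b :=
  h.x0 ▸ h.antitoneOn_x hK ⟨le_rfl, ht.1.trans ht.2⟩ ht ht.1

theorem da_of_isLeftArc (hbR : b ≤ R) (h : IsShot c z R k b x y a) (hK : IsLeftArc y a T) {t : ℝ}
    (ht : t ∈ Icc 0 T) :
    HasDerivAt a (sin (a t) * cos (2 * y t) * (exp (c * x t) - exp (c * z)) -
      2 * k * cos (a t) * sin (2 * y t)) t := by
  have := h.da t
  rwa [min_eq_left ((h.x_le hK ht).trans hbR)] at this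

theorem y_pos (hc : 0 < c) (h : IsShot c z R k b x y a) (hK : IsLeftArc y a T) {t : ℝ}
    (ht : t ∈ Ioo 0 T) : 0 < y t := by
  refine (hK t (Ioo_subset_Icc_self ht)).1.lt_of_ne fun h0 => ?_
  have hmin : IsLocalMin y t := by
    filter_upwards [Ioo_mem_nhds ht.1 ht.2] with s hs
    rw [← h0]; exact (hK s (Ioo_subset_Icc_self hs)).1
  have := hmin.hasDerivAt_eq_zero (h.dy t)
  rcases mul_eq_zero.1 this with h1 | h1
  · exact h.not_horizontal hc h0.symm h1
  · exact (h.cos_pos t).ne' h1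

theorem cos_a_ne_zero (hc : 0 < c) (hzb : z < b) (hbR : b ≤ R) (h : IsShot c z R k b x y a)
    (hK : IsLeftArc y a T) {t : ℝ} (ht : t ∈ Ioo 0 T) : cos (a t) ≠ 0 := by
  intro h0
  have hd := h.da_of_isLeftArc hbR hK (Ioo_subset_Icc_self ht)
  have h2 := hK t (Ioo_subset_Icc_self ht)
  have hzero : sin (a t) * cos (2 * y t) * (exp (c * x t) - exp (c * z)) -
      2 * k * cos (a t) * sin (2 * y t) = 0 := by
    have hcases : a t = π / 2 ∨ a t = π + π / 2 := by
      by_contra! hne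
      have h3 := Real.cos_neg_of_pi_div_two_lt_of_lt (lt_of_le_of_ne h2.2.1 hne.1.symm)
        (lt_of_le_of_ne h2.2.2 hne.2)
      exact h3.ne h0
    rcases hcases with h3 | h3
    · refine IsLocalMin.hasDerivAt_eq_zero (f := a) ?_ hd
      filter_upwards [Ioo_mem_nhds ht.1 ht.2] with s hs
      rw [h3]; exact (hK s (Ioo_subset_Icc_self hs)).2.1
    · refine IsLocalMax.hasDerivAt_eq_zero (f := a) ?_ hd
      filter_upwards [Ioo_mem_nhds ht.1 ht.2] with s hs
      rw [h3]; exact (hK s (Ioo_subset_Icc_self hs)).2.2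
  have hs : sin (a t) ≠ 0 := fun hs => by
    have := Real.sin_sq_add_cos_sq (a t)
    rw [hs, h0] at this; norm_num at this
  rw [h0, mul_zero, zero_mul, sub_zero] at hzero
  have h3 := (mul_eq_zero.1 hzero).resolve_left (mul_ne_zero hs (h.cos_pos t).ne')
  have h4 : x t = z := by
    have := Real.exp_injective (sub_eq_zero.1 h3)
    exact mul_left_cancel₀ hc.ne' this
  exact h.not_vertical hc (hzb.le.trans hbR) hzb.ne h0 h4

theorem sin_two_y_pos (hc : 0 < c) (h : IsShot c z R k b x y a) (hK : IsLeftArc y a T) {t : ℝ}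
    (ht : t ∈ Ioo 0 T) : 0 < sin (2 * y t) := by
  have h1 := h.y_pos hc hK ht
  have h2 := (abs_lt.1 (h.abs_y_lt t)).2
  exact Real.sin_pos_of_pos_of_lt_pi (by linarith) (by linarith [Real.pi_pos])

theorem sin_two_y_nonneg (h : IsShot c z R k b x y a) (hK : IsLeftArc y a T) {t : ℝ}
    (ht : t ∈ Icc 0 T) : 0 ≤ sin (2 * y t) := by
  have h1 := (hK t ht).1
  have h2 := (abs_lt.1 (h.abs_y_lt t)).2
  exact Real.sin_nonneg_of_nonneg_of_le_pi (by linarith) (by linarith [Real.pi_pos])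

theorem hasDerivAt_a_pos (hc : 0 < c) (hk : 0 < k) (h : IsShot c z R k b x y a)
    (hK : IsLeftArc y a T) {t : ℝ} (ht : t ∈ Ioo 0 T) (hat : a t = π) :
    ∃ d > 0, HasDerivAt a d t := by
  refine ⟨_, ?_, h.da t⟩
  have := h.sin_two_y_pos hc hK ht
  have hk' : (0 : ℝ) < k := by exact_mod_cast hk
  rw [hat, Real.sin_pi, Real.cos_pi]
  have := mul_pos hk' this
  linarith

theorem pi_le_a_of_le (hc : 0 < c) (hk : 0 < k) (h : IsShot c z R k b x y a)
    (hK : IsLeftArc y a T) {p q : ℝ} (hp : p ∈ Icc 0 T) (hap : π ≤ a p) (hq : q ∈ Icc p T) :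
    π ≤ a q := by
  have hp0 : 0 < p := hp.1.lt_of_ne fun h0 => by
    rw [← h0, h.a0] at hap; linarith [Real.pi_pos]
  have := image_le_of_deriv_right_lt_deriv_boundary' (f := fun t => -a t) (a := p) (b := T)
    (B := fun _ => -π) (B' := fun _ => 0) h.continuous_a.neg.continuousOn
    (fun t _ => (h.da t).neg.hasDerivWithinAt) (neg_le_neg hap) continuousOn_const
    (fun t _ => hasDerivWithinAt_const _ _ _) (fun t ht hat => ?_) hq
  · exact neg_le_neg_iff.1 this
  · obtain ⟨d, hd, hd'⟩ := h.hasDerivAt_a_pos hc hk hK (t := t) ⟨hp0.trans_le ht.1, ht.2⟩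
      (neg_inj.1 hat)
    rw [(h.da t).unique hd']
    exact neg_lt_zero.2 hd

theorem exists_neck (hc : 0 < c) (hk : 0 < k) (h : IsShot c z R k b x y a)
    (hK : IsLeftArc y a T) {q : ℝ} (hq : q ∈ Icc 0 T) (haq : π ≤ a q) :
    ∃ n ∈ Ioc 0 q, a n = π ∧ (∀ t ∈ Icc 0 n, a t ≤ π) ∧ ∀ t ∈ Icc n T, π ≤ a t := by
  have hcpt : IsCompact {t ∈ Icc 0 q | π ≤ a t} :=
    isCompact_Icc.inter_right (isClosed_le continuous_const h.continuous_a)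
  obtain ⟨n, ⟨hn, han⟩, hmin⟩ := hcpt.exists_isLeast ⟨q, ⟨hq.1, le_rfl⟩, haq⟩
  have hn0 : 0 < n := hn.1.lt_of_ne fun h0 => by
    rw [← h0, h.a0] at han; linarith [Real.pi_pos]
  have hle : ∀ t ∈ Icc 0 n, t < n → a t ≤ π := fun t ht htn => by
    by_contra! hcon
    exact absurd (hmin ⟨⟨ht.1, htn.le.trans hn.2⟩, hcon.le⟩) (not_le.2 htn)
  have hnπ : a n = π := by
    obtain ⟨s, hs, has⟩ := intermediate_value_Icc hn.1 h.continuous_a.continuousOn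
      ⟨by rw [h.a0]; linarith [Real.pi_pos], han⟩
    have := hmin ⟨⟨hs.1, hs.2.trans hn.2⟩, has.ge⟩
    rwa [le_antisymm hs.2 this] at has
  refine ⟨n, ⟨hn0, hn.2⟩, hnπ, fun t ht => ?_, fun t ht =>
    h.pi_le_a_of_le hc hk hK ⟨hn.1, hn.2.trans hq.2⟩ han ht⟩
  rcases ht.2.lt_or_eq with h1 | h1
  · exact hle t ht h1
  · rw [h1, hnπ]

/-- Comparison with the cosine arc `y = -ω tan φ`, where `ω = a - π` and `φ = φ₀ - x`. -/
theorem monotoneOn_comparison (hbR : b ≤ R) (hk : 0 < k) (h : IsShot c z R k b x y a)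
    (hK : IsLeftArc y a T) {p q φ₀ : ℝ} (hp : 0 ≤ p) (hq : q ≤ T)
    (hφ : ∀ t ∈ Icc p q, 0 ≤ φ₀ - x t ∧ φ₀ - x t ≤ π)
    (hω : ∀ t ∈ Icc p q, (a t - π ≤ 0 ∧ 0 ≤ exp (c * x t) - exp (c * z) ∧ 0 ≤ cos (φ₀ - x t)) ∨
      (0 ≤ a t - π ∧ exp (c * x t) - exp (c * z) ≤ 0 ∧ cos (φ₀ - x t) ≤ 0)) :
    MonotoneOn (fun t => (a t - π) * sin (φ₀ - x t) + y t * cos (φ₀ - x t)) (Icc p q) := by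
  have hsub : ∀ t ∈ Icc p q, t ∈ Icc 0 T := fun t ht => ⟨hp.trans ht.1, ht.2.trans hq⟩
  have hd : ∀ t ∈ Icc p q, HasDerivAt
      (fun t => (a t - π) * sin (φ₀ - x t) + y t * cos (φ₀ - x t)) _ t := fun t ht =>
    (((h.da_of_isLeftArc hbR hK (hsub t ht)).sub_const π).mul ((h.dx t).const_sub φ₀).sin).add
      ((h.dy t).mul ((h.dx t).const_sub φ₀).cos)
  refine monotoneOn_Icc_of_hasDerivAt hd fun t ht => ?_
  obtain ⟨hy0, ha1, ha2⟩ := hK t (hsub t ht)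
  have hS := h.cos_pos t
  have hk' : (1 : ℝ) ≤ k := by exact_mod_cast hk
  have hY := mul_cos_two_mul_le_sin hy0 (abs_lt.1 (h.abs_y_lt t)).2.le
  have hY' := h.sin_two_y_nonneg hK (hsub t ht)
  have hsφ := Real.sin_nonneg_of_nonneg_of_le_pi (hφ t ht).1 (hφ t ht).2
  have hcω := hK.cos_nonpos (hsub t ht)
  have ecω : cos (a t - π) = -cos (a t) := Real.cos_sub_pi _
  have esω : sin (a t - π) = -sin (a t) := Real.sin_sub_pi _
  have key1 : 0 ≤ (-cos (a t)) * (2 * k * sin (2 * y t) - y t * cos (2 * y t)) :=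
    mul_nonneg (by linarith) (by nlinarith)
  have key2 : 0 ≤ sin (a t) * (exp (c * x t) - exp (c * z)) ∧
      0 ≤ cos (φ₀ - x t) * ((a t - π) * (-cos (a t)) + sin (a t)) := by
    rcases hω t ht with ⟨h1, h2, h3⟩ | ⟨h1, h2, h3⟩
    · have hsa : 0 ≤ sin (a t) :=
        Real.sin_nonneg_of_nonneg_of_le_pi (by linarith [Real.pi_pos]) (by linarith)
      have := mul_cos_le_sin (w := π - a t) (by linarith) (by linarith)
      rw [Real.cos_pi_sub, Real.sin_pi_sub] at this
      exact ⟨mul_nonneg hsa h2, mul_nonneg h3 (by linarith)⟩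
    · have hsa : sin (a t) ≤ 0 := by
        have := Real.sin_nonneg_of_nonneg_of_le_pi h1 (by linarith [Real.pi_pos])
        linarith
      have := mul_cos_le_sin h1 (by linarith)
      rw [ecω, esω] at this
      exact ⟨mul_nonneg_of_nonpos_of_nonpos hsa h2, mul_nonneg_of_nonpos_of_nonpos h3 (by linarith)⟩
  have e1 := mul_nonneg hsφ key1
  have e2 := mul_nonneg (mul_nonneg hsφ hS.le) key2.1
  have e3 := mul_nonneg hS.le key2.2
  nlinarith

/-- While it rises in the region `z ≤ x`, an arc travels at most `π/2` to the left. -/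
theorem sub_le_x_of_a_le_pi (hc : 0 < c) (hbR : b ≤ R) (hzb : z + π / 2 ≤ b) (hk : 0 < k)
    (h : IsShot c z R k b x y a) (hK : IsLeftArc y a T) (ha : ∀ t ∈ Icc 0 T, a t ≤ π)
    {t : ℝ} (ht : t ∈ Icc 0 T) : b - π / 2 ≤ x t := by
  by_contra! hcon
  obtain ⟨s, hs, hxs⟩ := intermediate_value_Icc' ht.1 h.continuous_x.continuousOn
    ⟨hcon.le, by rw [h.x0]; linarith [Real.pi_pos]⟩
  have hst : s < t := hs.2.lt_of_ne fun h0 => by rw [h0] at hxs; linarith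
  have hs0 : 0 < s := hs.1.lt_of_ne fun h0 => by
    rw [← h0, h.x0] at hxs; linarith [Real.pi_pos]
  have hsT : s ∈ Ioo 0 T := ⟨hs0, hst.trans_le ht.2⟩
  have hrange : ∀ r ∈ Icc 0 s, 0 ≤ b - x r ∧ b - x r ≤ π / 2 := fun r hr => by
    have hrT : r ∈ Icc 0 T := ⟨hr.1, hr.2.trans hsT.2.le⟩
    have h1 := h.x_le hK hrT
    have h2 := h.antitoneOn_x hK hrT (Ioo_subset_Icc_self hsT) hr.2
    exact ⟨by linarith, by linarith⟩
  have hmono := h.monotoneOn_comparison hbR hk hK (p := 0) (q := s) (φ₀ := b) le_rfl hsT.2.le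
    (fun r hr => ⟨(hrange r hr).1, by linarith [(hrange r hr).2, Real.pi_pos]⟩)
    (fun r hr => Or.inl ⟨by linarith [ha r ⟨hr.1, hr.2.trans hsT.2.le⟩],
      sub_nonneg.2 (Real.exp_le_exp.2 (mul_le_mul_of_nonneg_left
        (by linarith [(hrange r hr).2]) hc.le)),
      Real.cos_nonneg_of_mem_Icc ⟨by linarith [(hrange r hr).1, Real.pi_pos], (hrange r hr).2⟩⟩)
    (left_mem_Icc.2 hs0.le) (right_mem_Icc.2 hs0.le) hs0.le
  simp only [h.x0, h.y0, hxs, sub_self, sub_sub_cancel, Real.sin_zero, Real.sin_pi_div_two,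
    Real.cos_pi_div_two] at hmono
  have has : a s = π := le_antisymm (ha s (Ioo_subset_Icc_self hsT)) (by linarith)
  obtain ⟨d, hd, hdπ⟩ := h.hasDerivAt_a_pos hc hk hK hsT has
  have hmax : IsLocalMax a s := by
    filter_upwards [Ioo_mem_nhds hsT.1 hsT.2] with r hr
    rw [has]; exact ha r (Ioo_subset_Icc_self hr)
  exact hd.ne' (hmax.hasDerivAt_eq_zero hdπ)

/-- While it descends in the region `x ≤ z`, an arc travels at most `π/2` to the left. -/
theorem sub_le_x_of_pi_le_a (hc : 0 < c) (hbR : b ≤ R) (hk : 0 < k)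
    (h : IsShot c z R k b x y a) (hK : IsLeftArc y a T) {p : ℝ} (hp : p ∈ Icc 0 T)
    (ha : ∀ t ∈ Icc p T, π ≤ a t) (hxp : x p ≤ z) : x p - π / 2 ≤ x T := by
  by_contra! hcon
  obtain ⟨s, hs, hxs⟩ := intermediate_value_Icc' hp.2 h.continuous_x.continuousOn
    ⟨hcon.le, by linarith [Real.pi_pos]⟩
  have hsT : s < T := hs.2.lt_of_ne fun h0 => by rw [h0] at hxs; linarith
  have hps : p < s := hs.1.lt_of_ne fun h0 => by rw [← h0] at hxs; linarith [Real.pi_pos]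
  have hs' : s ∈ Ioo 0 T := ⟨hp.1.trans_lt hps, hsT⟩
  have hrange : ∀ r ∈ Icc p s, x r ≤ x p ∧ x p - π / 2 ≤ x r := fun r hr => by
    have hrT : r ∈ Icc 0 T := ⟨hp.1.trans hr.1, hr.2.trans hsT.le⟩
    exact ⟨h.antitoneOn_x hK hp hrT hr.1,
      hxs ▸ h.antitoneOn_x hK hrT (Ioo_subset_Icc_self hs') hr.2⟩
  have hmono := h.monotoneOn_comparison hbR hk hK (p := p) (q := s) (φ₀ := x p + π / 2) hp.1 hsT.le
    (fun r hr => ⟨by linarith [hrange r hr, Real.pi_pos], by linarith [(hrange r hr).2]⟩)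
    (fun r hr => Or.inr ⟨by linarith [ha r ⟨hr.1, hr.2.trans hsT.le⟩],
      sub_nonpos.2 (Real.exp_le_exp.2 (mul_le_mul_of_nonneg_left
        (by linarith [(hrange r hr).1]) hc.le)),
      Real.cos_nonpos_of_pi_div_two_le_of_le (by linarith [(hrange r hr).1])
        (by linarith [(hrange r hr).2, Real.pi_pos])⟩)
    (left_mem_Icc.2 hps.le) (right_mem_Icc.2 hps.le) hps.le
  have e : x p + π / 2 - (x p - π / 2) = π := by ring
  simp only [hxs, e, add_sub_cancel_left, Real.sin_pi, Real.cos_pi, Real.sin_pi_div_two,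
    Real.cos_pi_div_two] at hmono
  have := h.y_pos hc hK hs'
  linarith [ha p ⟨le_rfl, hp.2⟩]

theorem not_forall_isLeftArc (hc : 0 < c) (hbR : b ≤ R) (hk : 0 < k)
    (h : IsShot c z R k b x y a) (hK : ∀ T, IsLeftArc y a T) {ym : ℝ} (hym : ym < π / 4)
    (hy : ∀ t, 0 ≤ t → y t ≤ ym) : False := by
  have hy1 : 0 < y 1 := h.y_pos hc (hK 2) ⟨by norm_num, by norm_num⟩
  have hym0 : 0 < ym := hy1.trans_le (hy 1 zero_le_one)
  have hS : ∀ t, 0 ≤ t → cos (2 * ym) ≤ cos (2 * y t) := fun t ht =>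
    Real.cos_le_cos_of_nonneg_of_le_pi (by linarith [(hK t t ⟨ht, le_rfl⟩).1])
      (by linarith [Real.pi_pos]) (by linarith [hy t ht])
  have hS0 : 0 < cos (2 * ym) := Real.cos_pos_of_mem_Ioo ⟨by linarith, by linarith⟩
  have hk' : (1 : ℝ) ≤ k := by exact_mod_cast hk
  have hmem : ∀ {t : ℝ}, 0 ≤ t → t ∈ Icc 0 t := fun ht => ⟨ht, le_rfl⟩
  by_cases hall : ∀ t, 0 ≤ t → a t ≤ π
  · have hs0 : 0 < sin (2 * y 1) :=
      h.sin_two_y_pos hc (hK 2) ⟨by norm_num, by norm_num⟩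
    have hsa : ∀ t, 0 ≤ t → 0 ≤ sin (a t) := fun t ht =>
      Real.sin_nonneg_of_nonneg_of_le_pi (by linarith [(hK t t (hmem ht)).2.1, Real.pi_pos])
        (hall t ht)
    have hsy : ∀ t, 1 ≤ t → sin (2 * y 1) ≤ sin (2 * y t) := fun t ht => by
      have := monotoneOn_Icc_of_hasDerivAt (p := 1) (q := t) (fun s _ => h.dy s)
        (fun s hs => mul_nonneg (hsa s (by linarith [hs.1])) (h.cos_pos s).le)
        (left_mem_Icc.2 ht) (right_mem_Icc.2 ht) ht
      exact Real.sin_le_sin_of_le_of_le_pi_div_two (by linarith [Real.pi_pos])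
        (by linarith [hy t (by linarith)]) (by linarith)
    set κ := min (cos (2 * ym)) (sin (2 * y 1))
    have hκ0 : 0 < κ := lt_min hS0 hs0
    set m := exp (c * z)
    have hm : 0 < m := Real.exp_pos _
    have grow : ∀ t, 1 ≤ t → a 1 + (m + 1) * y 1 + κ * (t - 1) ≤ a t + (m + 1) * y t := by
      intro t ht
      refine add_mul_le_of_hasDerivAt (f := fun t => a t + (m + 1) * y t) ht
        (fun s hs => (h.da_of_isLeftArc hbR (hK s) (hmem (by linarith [hs.1]))).add
          ((h.dy s).const_mul (m + 1))) fun s hs => ?_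
      have hs0' : 0 ≤ s := by linarith [hs.1]
      have h1 : κ ≤ cos (2 * y s) := (min_le_left _ _).trans (hS s hs0')
      have h2 : κ ≤ sin (2 * y s) := (min_le_right _ _).trans (hsy s hs.1)
      have h3 := hsa s hs0'
      have h4 := (hK s).cos_nonpos (hmem hs0')
      have h5 := one_le_sin_add_cos (w := a s - π / 2) (by linarith [(hK s s (hmem hs0')).2.1])
        (by linarith [hall s hs0'])
      rw [Real.sin_sub_pi_div_two, Real.cos_sub_pi_div_two] at h5
      have h6 : 0 ≤ sin (a s) * cos (2 * y s) * exp (c * x s) :=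
        mul_nonneg (mul_nonneg h3 (h.cos_pos s).le) (Real.exp_pos _).le
      have h7 : (-cos (a s)) * κ ≤ 2 * k * (-cos (a s)) * sin (2 * y s) := by
        have : (-cos (a s)) * κ ≤ (-cos (a s)) * sin (2 * y s) :=
          mul_le_mul_of_nonneg_left h2 (by linarith)
        have h8 : 0 ≤ (-cos (a s)) * sin (2 * y s) := mul_nonneg (by linarith) (by linarith)
        nlinarith
      have h9 : sin (a s) * κ ≤ sin (a s) * cos (2 * y s) := mul_le_mul_of_nonneg_left h1 h3
      nlinarith
    have h1 := grow (1 + (π + (m + 1) * ym) / κ) (by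
      have : 0 ≤ (π + (m + 1) * ym) / κ := by positivity
      linarith)
    have hpos : 0 ≤ (π + (m + 1) * ym) / κ := by positivity
    rw [add_sub_cancel_left, mul_div_cancel₀ _ hκ0.ne'] at h1
    have h2 := hall _ (by linarith : 0 ≤ 1 + (π + (m + 1) * ym) / κ)
    have h3 := mul_le_mul_of_nonneg_left (hy _ (by linarith : 0 ≤ 1 + (π + (m + 1) * ym) / κ))
      (by linarith : 0 ≤ m + 1)
    have h4 := (hK 1 1 ⟨by norm_num, le_rfl⟩).2.1
    have h5 : 0 < (m + 1) * y 1 := by positivity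
    linarith [Real.pi_pos]
  · push Not at hall
    obtain ⟨q, hq, haq⟩ := hall
    have haq' : ∀ t, q ≤ t → π ≤ a t := fun t ht =>
      h.pi_le_a_of_le hc hk (hK t) ⟨hq, ht⟩ haq.le ⟨ht, le_rfl⟩
    have grow : ∀ t, q ≤ t → -x q - y q + cos (2 * ym) * (t - q) ≤ -x t - y t := by
      intro t ht
      refine add_mul_le_of_hasDerivAt (f := fun t => -x t - y t) ht
        (fun s hs => (h.dx s).neg.sub (h.dy s)) fun s hs => ?_
      have hs0 := hq.trans hs.1
      have h1 := one_le_sin_add_cos (w := a s - π) (by linarith [haq' s hs.1])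
        (by linarith [(hK s s (hmem hs0)).2.2])
      rw [Real.sin_sub_pi, Real.cos_sub_pi] at h1
      have := h.cos_pos s
      nlinarith [hS s hs0]
    have hunb : ∀ M, ∃ t, q ≤ t ∧ x t < M := fun M => by
      have h0 : 0 ≤ (|x q| + y q + |M| + 1) / cos (2 * ym) := by
        have := (hK q q (hmem hq)).1
        positivity
      refine ⟨q + (|x q| + y q + |M| + 1) / cos (2 * ym), by linarith, ?_⟩
      have h1 := grow (q + (|x q| + y q + |M| + 1) / cos (2 * ym)) (by linarith)
      rw [add_sub_cancel_left, mul_div_cancel₀ _ hS0.ne'] at h1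
      have h2 := (hK _ (q + (|x q| + y q + |M| + 1) / cos (2 * ym)) (hmem (by linarith))).1
      linarith [neg_abs_le M, le_abs_self (x q), neg_abs_le (x q)]
    obtain ⟨p, hp, hxp⟩ := hunb z
    obtain ⟨T, hT, hxT⟩ := hunb (x p - π / 2)
    have hp0 := hq.trans hp
    have hpT : p ≤ T := by
      by_contra! hcon
      have := h.antitoneOn_x (hK p) ⟨hq.trans hT, hcon.le⟩ (hmem hp0) hcon.le
      linarith [Real.pi_pos]
    have := h.sub_le_x_of_pi_le_a hc hbR hk (hK T) ⟨hp0, hpT⟩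
      (fun t ht => haq' t (hp.trans ht.1)) hxp.le
    linarith

end IsShot

theorem HasDerivAt.nonpos_of_le_left {f : ℝ → ℝ} {d t p : ℝ} (hf : HasDerivAt f d t) (hp : p < t)
    (h : ∀ s ∈ Ioo p t, f t ≤ f s) : d ≤ 0 := by
  have := (hasDerivWithinAt_iff_tendsto_slope' self_notMem_Iio).1
    (hf.hasDerivWithinAt (s := Iio t))
  refine le_of_tendsto this ?_
  filter_upwards [Ioo_mem_nhdsLT hp] with s hs
  rw [slope_def_field]
  exact div_nonpos_of_nonneg_of_nonpos (sub_nonneg.2 (h s hs)) (by linarith [hs.2])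

theorem HasDerivAt.eventually_lt_right {f : ℝ → ℝ} {d t : ℝ} (hf : HasDerivAt f d t) (hd : 0 < d) :
    ∀ᶠ s in 𝓝[>] t, f t < f s := by
  have := (hasDerivWithinAt_iff_tendsto_slope' self_notMem_Ioi).1
    (hf.hasDerivWithinAt (s := Ioi t))
  filter_upwards [this.eventually (lt_mem_nhds hd), self_mem_nhdsWithin] with s hs hts
  rw [slope_def_field, lt_div_iff₀ (sub_pos.2 hts), zero_mul] at hs
  linarith

/-- The arc of the shot over `[0, T]` returns to the horizontal axis at time `T`. -/
structure IsArch (y a : ℝ → ℝ) (T : ℝ) : Prop where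
  pos : 0 < T
  arc : IsLeftArc y a T
  return_eq : y T = 0

namespace IsShot

variable {c z R b : ℝ} {k : ℕ} {x y a : ℝ → ℝ} {T : ℝ}

theorem pi_lt_a_of_isArch (hc : 0 < c) (h : IsShot c z R k b x y a) (hA : IsArch y a T) :
    π < a T := by
  by_contra! hcon
  have hT : T ∈ Icc 0 T := ⟨hA.pos.le, le_rfl⟩
  have h1 : 0 ≤ sin (a T) := Real.sin_nonneg_of_nonneg_of_le_pi
    (by linarith [(hA.arc T hT).2.1, Real.pi_pos]) hcon
  have h2 := (h.dy T).nonpos_of_le_left hA.pos fun s hs => by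
    rw [hA.return_eq]; exact (hA.arc s (Ioo_subset_Icc_self hs)).1
  have h3 := h.cos_pos T
  exact h.not_horizontal hc hA.return_eq (by nlinarith)

theorem a_mem_Ioo (hc : 0 < c) (hzb : z < b) (hbR : b ≤ R) (h : IsShot c z R k b x y a)
    (hK : IsLeftArc y a T) {t : ℝ} (ht : t ∈ Ioo 0 T) : a t ∈ Ioo (π / 2) (π + π / 2) := by
  have h1 := h.cos_a_ne_zero hc hzb hbR hK ht
  have h2 := hK t (Ioo_subset_Icc_self ht)
  refine ⟨h2.2.1.lt_of_ne fun h3 => h1 ?_, h2.2.2.lt_of_ne fun h3 => h1 ?_⟩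
  · rw [← h3, Real.cos_pi_div_two]
  · rw [h3, add_comm, Real.cos_add_pi, Real.cos_pi_div_two, neg_zero]

theorem strictAntiOn_x (hc : 0 < c) (hzb : z < b) (hbR : b ≤ R) (h : IsShot c z R k b x y a)
    (hK : IsLeftArc y a T) : StrictAntiOn x (Icc 0 T) := by
  refine strictAntiOn_of_deriv_neg (convex_Icc 0 T) h.continuous_x.continuousOn fun t ht => ?_
  rw [interior_Icc] at ht
  rw [(h.dx t).deriv]
  exact mul_neg_of_neg_of_pos (lt_of_le_of_ne (hK.cos_nonpos (Ioo_subset_Icc_self ht))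
    (h.cos_a_ne_zero hc hzb hbR hK ht)) (h.cos_pos t)

theorem exists_isLeftArc_pos (hc : 0 < c) (hzb : z < b) (hbR : b ≤ R)
    (h : IsShot c z R k b x y a) : ∃ T > 0, IsLeftArc y a T := by
  have h1 := (h.dy 0).eventually_lt_right (by simp [h.y0, h.a0])
  have h2 := (h.da 0).eventually_lt_right (by
    simp only [h.y0, h.a0, h.x0, min_eq_left hbR]
    simpa using (mul_lt_mul_iff_right₀ hc).2 hzb)
  have h3 : ∀ᶠ s in 𝓝[>] 0, a s < π + π / 2 :=
    (h.continuous_a.continuousAt.eventually_lt continuousAt_const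
      (by rw [h.a0]; linarith [Real.pi_pos])).filter_mono nhdsWithin_le_nhds
  obtain ⟨u, hu, hsub⟩ := (mem_nhdsGT_iff_exists_Ioo_subset).1 (h1.and (h2.and h3))
  have hu : 0 < u := hu
  refine ⟨u / 2, by positivity, fun t ht => ?_⟩
  rcases ht.1.eq_or_lt with h0 | h0
  · rw [← h0, h.y0, h.a0]
    exact ⟨le_rfl, le_rfl, by linarith [Real.pi_pos]⟩
  · obtain ⟨e1, e2, e3⟩ := hsub ⟨h0, by linarith [ht.2]⟩
    rw [h.y0] at e1
    rw [h.a0] at e2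
    exact ⟨e1.le, e2.le, e3.le⟩

theorem exists_isLeftArc_exit (hc : 0 < c) (hzb : z < b) (hbR : b ≤ R)
    (h : IsShot c z R k b x y a) (hne : ¬ ∀ T, IsLeftArc y a T) :
    ∃ T > 0, IsLeftArc y a T ∧ (y T = 0 ∨ a T = π + π / 2 ∨ (a T = π / 2 ∧ x T < z)) := by
  push Not at hne
  obtain ⟨T₁, hT₁⟩ := hne
  have hbdd : BddAbove {T | IsLeftArc y a T} :=
    ⟨T₁, fun T hT => by
      by_contra! hcon
      exact hT₁ (hT.mono hcon.le)⟩
  obtain ⟨T₀, hT₀, harc₀⟩ := h.exists_isLeftArc_pos hc hzb hbR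
  set T := sSup {T | IsLeftArc y a T} with hT
  have hTpos : 0 < T := hT₀.trans_le (le_csSup hbdd harc₀)
  have hlt : ∀ t ∈ Ico 0 T, 0 ≤ y t ∧ π / 2 ≤ a t ∧ a t ≤ π + π / 2 := fun t ht => by
    obtain ⟨T', hT', htT'⟩ := exists_lt_of_lt_csSup ⟨T₀, harc₀⟩ ht.2
    exact hT' t ⟨ht.1, htT'.le⟩
  have harc : IsLeftArc y a T := by
    have hclosed : IsClosed {t | 0 ≤ y t ∧ π / 2 ≤ a t ∧ a t ≤ π + π / 2} :=
      (isClosed_le continuous_const h.continuous_y).inter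
        ((isClosed_le continuous_const h.continuous_a).inter
          (isClosed_le h.continuous_a continuous_const))
    have := closure_minimal hlt hclosed
    rw [closure_Ico hTpos.ne] at this
    exact this
  have hTT : T ∈ Icc 0 T := ⟨hTpos.le, le_rfl⟩
  refine ⟨T, hTpos, harc, ?_⟩
  by_contra! hcon
  obtain ⟨hy, ha, hx⟩ := hcon
  obtain ⟨hy0, ha1, ha2⟩ := harc T hTT
  have ha1' : π / 2 < a T := by
    refine ha1.lt_of_ne fun h0 => ?_
    have hd := (h.da_of_isLeftArc hbR harc hTT).nonpos_of_le_left hTpos fun s hs => by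
      rw [← h0]; exact (harc s (Ioo_subset_Icc_self hs)).2.1
    rw [← h0, Real.cos_pi_div_two, Real.sin_pi_div_two] at hd
    have hzx := hx h0.symm
    rcases hzx.eq_or_lt with h1 | h1
    · exact h.not_vertical hc (hzb.le.trans hbR) hzb.ne
        (by rw [← h0, Real.cos_pi_div_two]) h1.symm
    · have := Real.exp_lt_exp.2 ((mul_lt_mul_iff_right₀ hc).2 h1)
      have := h.cos_pos T
      nlinarith
  have hev : ∀ᶠ s in 𝓝 T, 0 < y s ∧ π / 2 < a s ∧ a s < π + π / 2 :=
    (continuousAt_const.eventually_lt h.continuous_y.continuousAt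
      (hy0.lt_of_ne hy.symm)).and
      ((continuousAt_const.eventually_lt h.continuous_a.continuousAt ha1').and
        (h.continuous_a.continuousAt.eventually_lt continuousAt_const (ha2.lt_of_ne ha)))
  obtain ⟨ε, hε, hball⟩ := Metric.eventually_nhds_iff.1 hev
  have : IsLeftArc y a (T + ε / 2) := fun t ht => by
    rcases le_total t T with h1 | h1
    · exact harc t ⟨ht.1, h1⟩
    · obtain ⟨e1, e2, e3⟩ := hball (y := t)
        (by rw [Real.dist_eq, abs_of_nonneg (by linarith)]; linarith [ht.2])
      exact ⟨e1.le, e2.le, e3.le⟩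
  have := le_csSup hbdd this
  rw [← hT] at this
  linarith

/-- An open condition on the shot equivalent to having an arch which lands at an angle less than
`3π/2`. -/
theorem exists_isArch_iff (hc : 0 < c) (hzb : z < b) (hbR : b ≤ R)
    (h : IsShot c z R k b x y a) :
    (∃ T, IsArch y a T ∧ a T < π + π / 2) ↔ ∃ t, 0 ≤ t ∧ y t < 0 ∧
      ∀ s ∈ Icc 0 t, a s < π + π / 2 ∧ (π / 2 < a s ∨ z < x s) := by
  constructor
  · rintro ⟨T, hA, haT⟩
    have hpi := h.pi_lt_a_of_isArch hc hA
    have hs : sin (a T) < 0 := by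
      have := Real.sin_pos_of_pos_of_lt_pi (x := a T - π) (by linarith)
        (by linarith [Real.pi_pos])
      rw [Real.sin_sub_pi] at this
      linarith
    have h1 := (h.dy T).neg.eventually_lt_right
      (neg_pos.2 (mul_neg_of_neg_of_pos hs (h.cos_pos T)))
    have h2 : ∀ᶠ s in 𝓝 T, π / 2 < a s ∧ a s < π + π / 2 :=
      (continuousAt_const.eventually_lt h.continuous_a.continuousAt
          (by linarith [Real.pi_pos])).and
        (h.continuous_a.continuousAt.eventually_lt continuousAt_const haT)
    obtain ⟨ε, hε, hball⟩ := Metric.eventually_nhds_iff.1 h2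
    obtain ⟨t, ht1, ht2⟩ := (h1.and (Ioo_mem_nhdsGT (show T < T + ε by linarith))).exists
    have ht1' : -y T < -y t := ht1
    refine ⟨t, (hA.pos.trans ht2.1).le, by linarith [hA.return_eq], fun s hs => ?_⟩
    rcases lt_or_ge s T with h3 | h3
    · rcases hs.1.eq_or_lt with h0 | h0
      · rw [← h0, h.a0, h.x0]
        exact ⟨by linarith [Real.pi_pos], Or.inr hzb⟩
      · have := h.a_mem_Ioo hc hzb hbR hA.arc ⟨h0, h3⟩
        exact ⟨this.2, Or.inl this.1⟩
    · obtain ⟨e1, e2⟩ := hball (y := s)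
        (by rw [Real.dist_eq, abs_of_nonneg (by linarith)]; linarith [ht2.2, hs.2])
      exact ⟨e2, Or.inl e1⟩
  · rintro ⟨t, ht, hyt, hcond⟩
    obtain ⟨T, hT, harc, hexit⟩ := h.exists_isLeftArc_exit hc hzb hbR
      (fun hall => absurd (hall t t ⟨ht, le_rfl⟩).1 (not_le.2 hyt))
    have hTt : T ∈ Icc 0 t := by
      refine ⟨hT.le, ?_⟩
      by_contra! hcon
      exact absurd (harc t ⟨ht, hcon.le⟩).1 (not_le.2 hyt)
    have h1 := hcond T hTt
    rcases hexit with h2 | h2 | h2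
    · exact ⟨T, ⟨hT, harc, h2⟩, h1.1⟩
    · exact absurd h2 h1.1.ne
    · rcases h1.2 with h3 | h3
      · exact absurd h2.1 h3.ne'
      · exact absurd h2.2 h3.not_gt

end IsShot

theorem mul_sub_exp_div_le {c μ : ℝ} (hc : 0 < c) (hμ : 0 < μ) (x : ℝ) :
    μ * x - exp (c * x) / c ≤ μ * (log μ - 1) / c := by
  have h1 := Real.add_one_le_exp (c * x - log μ)
  rw [Real.exp_sub, Real.exp_log hμ, le_div_iff₀ hμ] at h1
  rw [sub_le_iff_le_add, ← add_div, le_div_iff₀ hc]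
  linarith

namespace IsShot

variable {c z R b : ℝ} {k : ℕ} {x y a : ℝ → ℝ} {T : ℝ}

theorem a_le_pi_or (hc : 0 < c) (hk : 0 < k) (h : IsShot c z R k b x y a)
    (hK : IsLeftArc y a T) : (∀ t ∈ Icc 0 T, a t ≤ π) ∨
      ∃ n ∈ Ioc 0 T, a n = π ∧ (∀ t ∈ Icc 0 n, a t ≤ π) ∧ ∀ t ∈ Icc n T, π ≤ a t := by
  by_cases hall : ∀ t ∈ Icc 0 T, a t ≤ π
  · exact Or.inl hall
  · push Not at hall
    obtain ⟨q, hq, haq⟩ := hall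
    obtain ⟨n, hn, h1⟩ := h.exists_neck hc hk hK hq haq.le
    exact Or.inr ⟨n, ⟨hn.1, hn.2.trans hq.2⟩, h1⟩

theorem antitoneOn_y_of_pi_le (h : IsShot c z R k b x y a) (hK : IsLeftArc y a T) {n : ℝ}
    (hn : 0 ≤ n) (ha : ∀ t ∈ Icc n T, π ≤ a t) : AntitoneOn y (Icc n T) := by
  refine antitoneOn_Icc_of_hasDerivAt (fun t _ => h.dy t) fun t ht => ?_
  refine mul_nonpos_of_nonpos_of_nonneg ?_ (h.cos_pos t).le
  have := Real.sin_nonneg_of_nonneg_of_le_pi (x := a t - π) (by linarith [ha t ht])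
    (by linarith [(hK t ⟨hn.trans ht.1, ht.2⟩).2.2, Real.pi_pos])
  rw [Real.sin_sub_pi] at this
  linarith

theorem monotoneOn_y_of_le_pi (h : IsShot c z R k b x y a) (hK : IsLeftArc y a T) {n : ℝ}
    (hn : n ≤ T) (ha : ∀ t ∈ Icc 0 n, a t ≤ π) : MonotoneOn y (Icc 0 n) := by
  refine monotoneOn_Icc_of_hasDerivAt (fun t _ => h.dy t) fun t ht => ?_
  refine mul_nonneg ?_ (h.cos_pos t).le
  exact Real.sin_nonneg_of_nonneg_of_le_pi
    (by linarith [(hK t ⟨ht.1, ht.2.trans hn⟩).2.1, Real.pi_pos]) (ha t ht)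

/-- If the shot starts far to the right, then all its arcs are thin. -/
theorem mul_y_le (hc : 0 < c) (hbR : b ≤ R) (hk : 0 < k) {N : ℝ} (hN : 0 ≤ N)
    (hb : exp (c * z) + N ≤ exp (c * (b - π / 2))) (h : IsShot c z R k b x y a)
    (hK : IsLeftArc y a T) (hT : 0 ≤ T) : N * y T ≤ π / 2 := by
  have hzb : z + π / 2 ≤ b := by
    have := Real.exp_le_exp.1 ((le_add_of_nonneg_right hN).trans hb)
    linarith [le_of_mul_le_mul_left this hc]
  have up : ∀ n, 0 ≤ n → n ≤ T → (∀ t ∈ Icc 0 n, a t ≤ π) → N * y n ≤ π / 2 := by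
    intro n hn hnT ha
    have hKn := hK.mono hnT
    have hmono := monotoneOn_Icc_of_hasDerivAt (f := fun t => a t - N * y t) (p := 0) (q := n)
      (fun t ht => (h.da_of_isLeftArc hbR hKn ht).sub ((h.dy t).const_mul N)) (fun t ht => by
        have hx := h.sub_le_x_of_a_le_pi hc hbR hzb hk hKn ha ht
        have hX := hb.trans (Real.exp_le_exp.2 (mul_le_mul_of_nonneg_left hx hc.le))
        have h1 := Real.sin_nonneg_of_nonneg_of_le_pi
          (by linarith [(hKn t ht).2.1, Real.pi_pos]) (ha t ht)
        have h2 := mul_nonneg (mul_nonneg h1 (h.cos_pos t).le) (sub_nonneg.2 hX)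
        have h3 := hKn.cos_nonpos ht
        have h4 := mul_nonneg (mul_nonneg (Nat.cast_nonneg (α := ℝ) k) (neg_nonneg.2 h3))
          (h.sin_two_y_nonneg hKn ht)
        nlinarith) (left_mem_Icc.2 hn) (right_mem_Icc.2 hn) hn
    simp only [h.a0, h.y0] at hmono
    linarith [ha n ⟨hn, le_rfl⟩]
  rcases h.a_le_pi_or hc hk hK with hall | ⟨n, hn, -, h1, h2⟩
  · exact up T hT le_rfl hall
  · have := h.antitoneOn_y_of_pi_le hK hn.1.le h2 ⟨le_rfl, hn.2⟩ ⟨hn.2, le_rfl⟩ hn.2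
    exact (mul_le_mul_of_nonneg_left this hN).trans (up n hn.1.le hn.2 h1)

theorem exp_le_of_a_eq (hc : 0 < c) (hbR : b ≤ R) (hk : 0 < k) {ym : ℝ} (hym : ym ≤ π / 6)
    (h : IsShot c z R k b x y a) (hK : IsLeftArc y a T) (hT : 0 ≤ T)
    (hy : ∀ t ∈ Icc 0 T, y t ≤ ym) (haT : a T = π + π / 2) :
    exp ((exp (c * z) + 1) * x T - exp (c * x T) / c) ≤
      8 * k * exp ((exp (c * z) + 1) * (log (exp (c * z) + 1) - 1) / c) * ym := by
  set m := exp (c * z)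
  have hm : 0 < m := Real.exp_pos _
  set C := exp ((m + 1) * (log (m + 1) - 1) / c)
  have hC : 0 < C := Real.exp_pos _
  have hym0 : 0 ≤ ym := by
    have := hy 0 ⟨le_rfl, hT⟩
    rwa [h.y0] at this
  set K := 8 * k * C * ym
  have hw : ∀ t, HasDerivAt (fun t => exp (m * x t - exp (c * x t) / c))
      (exp (m * x t - exp (c * x t) / c) *
        (m * (cos (a t) * cos (2 * y t)) - exp (c * x t) * (cos (a t) * cos (2 * y t)))) t := by
    intro t
    refine (((h.dx t).const_mul m).sub ((((h.dx t).const_mul c).exp).div_const c)).exp.congr_deriv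
      ?_
    simp only [Pi.sub_apply]
    field_simp
  have hmono := monotoneOn_Icc_of_hasDerivAt (p := 0) (q := T)
    (f := fun t => exp (m * x t - exp (c * x t) / c) * sin (a t) + K * exp (-x t))
    (fun t ht => ((hw t).mul (h.da_of_isLeftArc hbR hK ht).sin).add
      (((h.dx t).neg.exp).const_mul K)) (fun t ht => by
      have h0 : exp (m * x t - exp (c * x t) / c) ≤ C * exp (-x t) := by
        rw [← Real.exp_add]
        refine Real.exp_le_exp.2 ?_
        linarith [mul_sub_exp_div_le hc (by linarith : 0 < m + 1) (x t)]
      have hS : 1 / 2 ≤ cos (2 * y t) := by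
        rw [← Real.cos_pi_div_three]
        exact Real.cos_le_cos_of_nonneg_of_le_pi (by linarith [(hK t ht).1])
          (by linarith [Real.pi_pos]) (by linarith [hy t ht])
      have hs : sin (2 * y t) ≤ 2 * ym :=
        (Real.sin_le (by linarith [(hK t ht).1])).trans (by linarith [hy t ht])
      have hs0 := h.sin_two_y_nonneg hK ht
      have hca := hK.cos_nonpos ht
      have hk0 : (0 : ℝ) ≤ k := k.cast_nonneg
      set w := exp (m * x t - exp (c * x t) / c)
      have hw0 : 0 < w := Real.exp_pos _
      set E := exp (-x t)
      have hE : 0 < E := Real.exp_pos _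
      have e1 : w * (-cos (a t)) * sin (2 * y t) ≤ C * E * 1 * (2 * ym) := by
        have : -cos (a t) ≤ 1 := by linarith [Real.neg_one_le_cos (a t)]
        gcongr
        linarith
      have e2 : 4 * k * C * ym * E ≤ K * E * cos (2 * y t) := by
        have : 0 ≤ K * E := by positivity
        have : K * E * (1 / 2) ≤ K * E * cos (2 * y t) := mul_le_mul_of_nonneg_left hS this
        calc 4 * k * C * ym * E = K * E * (1 / 2) := by simp only [K]; ring
          _ ≤ _ := this
      have e3 := mul_le_mul_of_nonneg_left e1 (by linarith : (0 : ℝ) ≤ 2 * k)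
      have e4 : 0 ≤ (-cos (a t)) *
          (K * E * cos (2 * y t) - 2 * k * (w * (-cos (a t)) * sin (2 * y t))) :=
        mul_nonneg (by linarith) (by linarith)
      refine e4.trans_eq ?_
      simp only [Pi.neg_apply, m, E]
      ring) (left_mem_Icc.2 hT) (right_mem_Icc.2 hT) hT
  simp only [h.a0, haT, Real.sin_pi_div_two] at hmono
  rw [add_comm π (π / 2), Real.sin_add_pi, Real.sin_pi_div_two] at hmono
  have e1 := Real.exp_pos (m * x 0 - exp (c * x 0) / c)
  have e2 : 0 ≤ K * exp (-x 0) := by positivity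
  have e3 : exp (m * x T - exp (c * x T) / c) ≤ K * exp (-x T) := by linarith
  have e4 := mul_le_mul_of_nonneg_right e3 (Real.exp_pos (x T)).le
  rw [mul_assoc, ← Real.exp_add, ← Real.exp_add, neg_add_cancel, Real.exp_zero, mul_one] at e4
  refine le_trans (le_of_eq ?_) e4
  ring_nf

theorem x_mem_Icc_of_a_eq (hc : 0 < c) (hbR : b ≤ R) (hzb : z + π / 2 ≤ b) (hk : 0 < k)
    (h : IsShot c z R k b x y a) (hK : IsLeftArc y a T) (hT : 0 ≤ T) (haT : a T = π + π / 2) :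
    x T ∈ Icc (z - π / 2) z := by
  have hTT : T ∈ Icc 0 T := ⟨hT, le_rfl⟩
  have hT' : 0 < T := hT.lt_of_ne fun h0 => by
    rw [← h0, h.a0] at haT; linarith [Real.pi_pos]
  have hxz : x T ≤ z := by
    have hd := ((h.da_of_isLeftArc hbR hK hTT).neg).nonpos_of_le_left hT' fun s hs => by
      rw [Pi.neg_apply, Pi.neg_apply, haT]
      exact neg_le_neg (hK s (Ioo_subset_Icc_self hs)).2.2
    rw [haT, add_comm π (π / 2), Real.sin_add_pi, Real.cos_add_pi, Real.cos_pi_div_two,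
      Real.sin_pi_div_two] at hd
    by_contra! hcon
    have := Real.exp_lt_exp.2 ((mul_lt_mul_iff_right₀ hc).2 hcon)
    nlinarith [h.cos_pos T]
  refine ⟨?_, hxz⟩
  obtain ⟨n, hn, -, h1, h2⟩ := h.exists_neck hc hk hK hTT (by linarith [Real.pi_pos])
  have hxn := h.sub_le_x_of_a_le_pi hc hbR hzb hk (hK.mono hn.2) h1 ⟨hn.1.le, le_rfl⟩
  obtain ⟨p, hp, hxp⟩ := intermediate_value_Icc' hn.2 h.continuous_x.continuousOn
    ⟨hxz, by linarith⟩
  have := h.sub_le_x_of_pi_le_a hc hbR hk hK ⟨hn.1.le.trans hp.1, hp.2⟩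
    (fun t ht => h2 t ⟨hp.1.trans ht.1, ht.2⟩) hxp.le
  linarith

end IsShot

theorem exists_isArch_of_large {c : ℝ} (hc : 0 < c) (z : ℝ) {k : ℕ} (hk : 0 < k) :
    ∃ b, z < b ∧ ∀ x y a, IsShot c z b k b x y a → ∃ T, IsArch y a T ∧ a T < π + π / 2 := by
  set m := exp (c * z) with hm_def
  have hm : 0 < m := Real.exp_pos _
  set C := exp ((m + 1) * (log (m + 1) - 1) / c)
  have hC : 0 < C := Real.exp_pos _
  set L := exp ((m + 1) * (z - π / 2) - m / c)
  have hL : 0 < L := Real.exp_pos _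
  have hpi := Real.pi_pos
  set N := 3 + 4 * k * C * π / L with hN_def
  have hN3 : 3 ≤ N := le_add_of_nonneg_right (by positivity)
  have hN : 0 < N := by linarith
  set b := π / 2 + log (m + N) / c
  have hb : m + N ≤ exp (c * (b - π / 2)) := by
    rw [show c * (b - π / 2) = log (m + N) by simp only [b]; field_simp; ring,
      Real.exp_log (by linarith)]
  have hzb : z + π / 2 < b := by
    have := Real.exp_lt_exp.1 ((lt_add_of_pos_right m hN).trans_le hb)
    linarith [lt_of_mul_lt_mul_left this hc.le]
  refine ⟨b, by linarith, fun x y a h => ?_⟩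
  have hzb' : z < b := by linarith
  have hyle : ∀ T, 0 ≤ T → IsLeftArc y a T → y T ≤ π / 2 / N := fun T hT hK => by
    rw [le_div_iff₀' hN]
    exact h.mul_y_le hc le_rfl hk hN.le hb hK hT
  have hym : π / 2 / N ≤ π / 6 := by
    rw [div_le_iff₀ hN]; nlinarith
  have hne : ∀ T, 0 ≤ T → IsLeftArc y a T → a T ≠ π + π / 2 := fun T hT hK haT => by
    have h1 := h.exp_le_of_a_eq hc le_rfl hk hym hK hT
      (fun t ht => hyle t ht.1 (hK.mono ht.2)) haT
    have h2 := h.x_mem_Icc_of_a_eq hc le_rfl hzb.le hk hK hT haT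
    have h3 : L ≤ exp ((m + 1) * x T - exp (c * x T) / c) := by
      refine Real.exp_le_exp.2 (sub_le_sub ?_ ?_)
      · exact mul_le_mul_of_nonneg_left h2.1 (by linarith)
      · exact div_le_div_of_nonneg_right
          (Real.exp_le_exp.2 (mul_le_mul_of_nonneg_left h2.2 hc.le)) hc.le
    have h4 : 8 * k * C * (π / 2 / N) < L := by
      rw [show 8 * k * C * (π / 2 / N) = 4 * k * C * π / N by ring, div_lt_iff₀ hN, hN_def, mul_add,
        mul_div_cancel₀ _ hL.ne']
      linarith
    exact absurd (h3.trans h1) (not_le.2 h4)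
  obtain ⟨T, hT, hK, hexit⟩ := h.exists_isLeftArc_exit hc hzb' le_rfl fun hall =>
    h.not_forall_isLeftArc hc le_rfl hk hall (by linarith : π / 2 / N < π / 4)
      fun t ht => hyle t ht (hall t)
  have haT := hne T hT.le hK
  rcases hexit with h1 | h1 | ⟨h1, h2⟩
  · exact ⟨T, ⟨hT, hK, h1⟩, (hK T ⟨hT.le, le_rfl⟩).2.2.lt_of_ne haT⟩
  · exact absurd h1 haT
  · rcases h.a_le_pi_or hc hk hK with hall | ⟨n, hn, -, -, h3⟩
    · have := h.sub_le_x_of_a_le_pi hc le_rfl hzb.le hk hK hall ⟨hT.le, le_rfl⟩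
      linarith
    · linarith [h3 T ⟨hn.2, le_rfl⟩]

theorem cos_two_mul_pi_div_five_pos : 0 < cos (2 * (π / 5)) :=
  Real.cos_pos_of_mem_Ioo ⟨by linarith [Real.pi_pos], by linarith [Real.pi_pos]⟩

/-- Quantitative estimates along a descending branch starting horizontally at a height `y 0` where
`δ = cos (2 * y 0)` is small. -/
theorem exists_descent_estimate {y a Z ζ : ℝ → ℝ} {L : ℝ} {k : ℕ} (hk : 0 < k) (hL : 0 ≤ L)
    (hy : ∀ t ∈ Icc 0 L, HasDerivAt y (sin (a t) * cos (2 * y t)) t)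
    (hu : ∀ t ∈ Icc 0 L, HasDerivAt (fun t => -(cos (2 * y t) ^ k * cos (a t)))
      (-(cos (2 * y t) ^ (k + 1) * Z t * sin (a t) ^ 2)) t)
    (hζ : ∀ t ∈ Icc 0 L, HasDerivAt ζ (-(cos (a t) * cos (2 * y t))) t)
    (ha : ∀ t ∈ Icc 0 L, π ≤ a t ∧ a t ≤ π + π / 2) (ha0 : a 0 = π) (hyL : y L = 0)
    (hy0 : ∀ t ∈ Icc 0 L, 0 ≤ y t ∧ y t < π / 4)
    (hZ : MonotoneOn Z (Icc 0 L)) (hZ0 : 0 ≤ Z 0)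
    (hδ : 2 * cos (2 * y 0) ^ k ≤ cos (2 * (π / 5)) ^ k) :
    ∃ t ∈ Icc 0 L, Z t ≤ 4 / (3 * cos (2 * (π / 5)) ^ k * (π / 5)) * cos (2 * y 0) ^ k ∧
      cos (2 * y 0) ^ k * log (cos (2 * (π / 5)) / cos (2 * y 0)) / 4 ≤ ζ t - ζ 0 := by
  have hpi := Real.pi_pos
  set y₁ := π / 5 with hy₁
  set S₁ := cos (2 * y₁)
  have hS₁ : 0 < S₁ := cos_two_mul_pi_div_five_pos
  set δ := cos (2 * y 0)
  have h0L : (0 : ℝ) ∈ Icc 0 L := ⟨le_rfl, hL⟩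
  have hLL : L ∈ Icc 0 L := ⟨hL, le_rfl⟩
  have hS : ∀ t ∈ Icc 0 L, 0 < cos (2 * y t) := fun t ht =>
    Real.cos_pos_of_mem_Ioo ⟨by linarith [hy0 t ht], by linarith [hy0 t ht]⟩
  have hδ0 : 0 < δ := hS 0 h0L
  have hcos : ∀ t ∈ Icc 0 L, cos (a t) ≤ 0 := fun t ht =>
    Real.cos_nonpos_of_pi_div_two_le_of_le (by linarith [ha t ht]) (ha t ht).2
  have hsin : ∀ t ∈ Icc 0 L, sin (a t) ≤ 0 := fun t ht => by
    have := Real.sin_nonneg_of_nonneg_of_le_pi (x := a t - π) (by linarith [ha t ht])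
      (by linarith [ha t ht])
    rw [Real.sin_sub_pi] at this
    linarith
  have hZnn : ∀ t ∈ Icc 0 L, 0 ≤ Z t := fun t ht => hZ0.trans (hZ h0L ht ht.1)
  have hyanti : AntitoneOn y (Icc 0 L) := antitoneOn_Icc_of_hasDerivAt hy fun t ht =>
    mul_nonpos_of_nonpos_of_nonneg (hsin t ht) (hS t ht).le
  have huanti := antitoneOn_Icc_of_hasDerivAt hu fun t ht =>
    neg_nonpos.2 (mul_nonneg (mul_nonneg (pow_nonneg (hS t ht).le _) (hZnn t ht)) (sq_nonneg _))
  have hu0 : ∀ t ∈ Icc 0 L, -(cos (2 * y t) ^ k * cos (a t)) ≤ δ ^ k := fun t ht => by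
    have := huanti h0L ht ht.1
    simpa [ha0] using this
  have hyy : y₁ ≤ y 0 := by
    by_contra! hcon
    have : S₁ ≤ δ := Real.cos_le_cos_of_nonneg_of_le_pi (by linarith [hy0 0 h0L])
      (by linarith) (by linarith)
    have h1 := pow_le_pow_left₀ hS₁.le this k
    linarith [pow_pos hδ0 k]
  have hycont : ContinuousOn y (Icc 0 L) := HasDerivAt.continuousOn hy
  obtain ⟨t₂, ht₂, hyt₂⟩ := intermediate_value_Icc' hL hycont (show y₁ ∈ Icc (y L) (y 0) from
    ⟨by rw [hyL]; positivity, hyy⟩)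
  have hsub1 : ∀ t ∈ Icc 0 t₂, t ∈ Icc 0 L := fun t ht => ⟨ht.1, ht.2.trans ht₂.2⟩
  have hsub2 : ∀ t ∈ Icc t₂ L, t ∈ Icc 0 L := fun t ht => ⟨ht₂.1.trans ht.1, ht.2⟩
  have hZ2 : Z t₂ * (3 * S₁ ^ k * y₁) ≤ 4 * δ ^ k := by
    have := antitoneOn_Icc_of_hasDerivAt (p := t₂) (q := L)
      (fun t ht => (hu t (hsub2 t ht)).sub ((hy t (hsub2 t ht)).const_mul (3 / 4 * S₁ ^ k * Z t₂)))
      (fun t ht => by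
        have ht' := hsub2 t ht
        have hSt : S₁ ≤ cos (2 * y t) := Real.cos_le_cos_of_nonneg_of_le_pi
          (by linarith [hy0 t ht']) (by linarith)
          (by linarith [hyanti ht₂ ht' ht.1])
        have hSk := pow_le_pow_left₀ hS₁.le hSt k
        have hS1k := pow_pos hS₁ k
        have hc2 : -cos (a t) ≤ 1 / 2 := by
          have h1 := hu0 t ht'
          have h2 : S₁ ^ k * (-cos (a t)) ≤ cos (2 * y t) ^ k * (-cos (a t)) :=
            mul_le_mul_of_nonneg_right hSk (by linarith [hcos t ht'])
          nlinarith
        have hs2 : 3 / 4 ≤ -sin (a t) := by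
          nlinarith [Real.sin_sq_add_cos_sq (a t), hcos t ht', hsin t ht']
        have hZt := hZ ht₂ ht' ht.1
        have hZt2 := hZnn t₂ ht₂
        have hSt0 := hS t ht'
        have e1 : S₁ ^ k * Z t₂ * (3 / 4) ≤ cos (2 * y t) ^ k * Z t * (-sin (a t)) := by
          gcongr
          exact mul_nonneg (pow_nonneg hSt0.le _) (hZt2.trans hZt)
        have e2 := mul_le_mul_of_nonneg_right e1
          (mul_nonneg hSt0.le (by linarith : 0 ≤ -sin (a t)))
        rw [pow_succ]
        nlinarith)
      ⟨le_rfl, ht₂.2⟩ ⟨ht₂.2, le_rfl⟩ ht₂.2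
    change -(cos (2 * y L) ^ k * cos (a L)) - 3 / 4 * S₁ ^ k * Z t₂ * y L ≤
      -(cos (2 * y t₂) ^ k * cos (a t₂)) - 3 / 4 * S₁ ^ k * Z t₂ * y t₂ at this
    have h3 : 3 / 4 * S₁ ^ k * Z t₂ * y L = 0 := by rw [hyL, mul_zero]
    have h4 : 3 / 4 * S₁ ^ k * Z t₂ * y t₂ = 3 / 4 * S₁ ^ k * Z t₂ * y₁ := by rw [hyt₂]
    have h1 := hu0 t₂ ht₂
    have h2 : 0 ≤ -(cos (2 * y L) ^ k * cos (a L)) := neg_nonneg.2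
      (mul_nonpos_of_nonneg_of_nonpos (pow_nonneg (hS L hLL).le _) (hcos L hLL))
    linarith
  have hulow : ∀ t ∈ Icc 0 t₂, δ ^ k / 2 ≤ -(cos (2 * y t) ^ k * cos (a t)) := by
    intro t ht
    have := monotoneOn_Icc_of_hasDerivAt (p := 0) (q := t₂)
      (fun t ht => (hu t (hsub1 t ht)).sub ((hy t (hsub1 t ht)).const_mul (S₁ ^ k * Z t₂)))
      (fun t ht => by
        have ht' := hsub1 t ht
        have hSt : cos (2 * y t) ≤ S₁ := Real.cos_le_cos_of_nonneg_of_le_pi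
          (by linarith) (by linarith [hy0 t ht'])
          (by linarith [hyanti ht' ht₂ ht.2])
        have hSt0 := hS t ht'
        have hSk := pow_le_pow_left₀ hSt0.le hSt k
        have hZt := hZ ht' ht₂ ht.2
        have hZt2 := hZnn t ht'
        have hs0 := hsin t ht'
        have hs1 : -sin (a t) ≤ 1 := by linarith [Real.neg_one_le_sin (a t)]
        have e1 : cos (2 * y t) ^ k * Z t * (-sin (a t)) ≤ S₁ ^ k * Z t₂ * 1 := by
          gcongr
          · linarith
          · exact mul_nonneg (pow_nonneg hS₁.le _) (hZt2.trans hZt)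
        have e2 := mul_le_mul_of_nonneg_right e1
          (mul_nonneg hSt0.le (by linarith : 0 ≤ -sin (a t)))
        rw [pow_succ]
        nlinarith)
      ⟨le_rfl, ht₂.1⟩ ht ht.1
    simp only [Pi.sub_apply, ha0, Real.cos_pi] at this
    have h1 : y 0 - y t ≤ y₁ / 4 := by
      have := hyanti (hsub1 t ht) ht₂ ht.2
      have := hy0 0 h0L
      linarith
    have h2 : 0 ≤ S₁ ^ k * Z t₂ := mul_nonneg (pow_nonneg hS₁.le _) (hZnn t₂ ht₂)
    have h3 := mul_le_mul_of_nonneg_left h1 h2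
    have h4 := pow_pos hδ0 k
    change -(δ ^ k * -1) - S₁ ^ k * Z t₂ * y 0 ≤ _ at this
    linarith
  refine ⟨t₂, ht₂, ?_, ?_⟩
  · rw [div_mul_eq_mul_div, le_div_iff₀ (by positivity)]
    exact hZ2
  · have h1 := add_mul_le_of_hasDerivAt (κ := δ ^ k / 2) ht₂.1 (fun t ht => hζ t (hsub1 t ht))
      (fun t ht => by
        have hSt0 := hS t (hsub1 t ht)
        have hp : cos (2 * y t) ^ k ≤ cos (2 * y t) :=
          pow_le_of_le_one hSt0.le (Real.cos_le_one _) hk.ne'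
        nlinarith [hulow t ht, mul_le_mul_of_nonneg_right hp
          (neg_nonneg.2 (hcos t (hsub1 t ht)))])
    have h2 := add_mul_le_of_hasDerivAt (κ := -2) ht₂.1
      (fun t ht => ((((hy t (hsub1 t ht)).const_mul 2).cos).log (hS t (hsub1 t ht)).ne').neg)
      (fun t ht => by
        have hSt0 := hS t (hsub1 t ht)
        rw [neg_le_neg_iff, div_le_iff₀ hSt0]
        have hab : -1 ≤ sin (2 * y t) * sin (a t) := by
          have := abs_le.1 ((abs_mul _ _).trans_le (mul_le_one₀ (Real.abs_sin_le_one (2 * y t))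
            (abs_nonneg _) (Real.abs_sin_le_one (a t))))
          exact this.1
        nlinarith)
    simp only [Pi.neg_apply, hyt₂] at h2
    have h3 : log (S₁ / δ) ≤ 2 * t₂ := by
      rw [Real.log_div hS₁.ne' hδ0.ne']
      change -log δ + -2 * (t₂ - 0) ≤ -log S₁ at h2
      linarith
    have h4 := mul_le_mul_of_nonneg_left h3 (pow_nonneg hδ0.le k)
    linarith

namespace IsShot

variable {c z R b : ℝ} {k : ℕ} {x y a : ℝ → ℝ} {T : ℝ}

theorem hasDerivAt_pow_mul_cos (hbR : b ≤ R) (hk : 0 < k) (h : IsShot c z R k b x y a)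
    (hK : IsLeftArc y a T) {t : ℝ} (ht : t ∈ Icc 0 T) :
    HasDerivAt (fun t => -(cos (2 * y t) ^ k * cos (a t)))
      (cos (2 * y t) ^ (k + 1) * (exp (c * x t) - exp (c * z)) * sin (a t) ^ 2) t := by
  obtain ⟨j, rfl⟩ : ∃ j, k = j + 1 := ⟨k - 1, by omega⟩
  refine (((((h.dy t).const_mul 2).cos.pow (j + 1)).mul
    (h.da_of_isLeftArc hbR hK ht).cos).neg).congr_deriv ?_
  simp only [Nat.add_sub_cancel, Pi.pow_apply]
  push_cast
  ring

end IsShot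

/-- Arches starting at `b > z` stay away from the line `y = π/4`, uniformly in `b`. -/
theorem exists_le_cos_neck {c : ℝ} (hc : 0 < c) (z : ℝ) {k : ℕ} (hk : 0 < k) :
    ∃ δ > 0, ∀ R b x y a T n, b ≤ R → IsShot c z R k b x y a → IsArch y a T → n ∈ Icc 0 T →
      a n = π → (∀ t ∈ Icc 0 n, a t ≤ π) → (∀ t ∈ Icc n T, π ≤ a t) → δ ≤ cos (2 * y n) := by
  have hpi := Real.pi_pos
  set S₁ := cos (2 * (π / 5))
  have hS₁ : 0 < S₁ := cos_two_mul_pi_div_five_pos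
  set m := exp (c * z)
  have hm : 0 < m := Real.exp_pos _
  set C := 4 / (3 * S₁ ^ k * (π / 5))
  have hC : 0 < C := by positivity
  refine ⟨min (min (S₁ ^ k / 2) (m / (2 * C))) (S₁ * exp (-(8 * C / (c * m)))), by positivity,
    fun R b x y a T n hbR h hA hn han hup hdown => ?_⟩
  set δ := cos (2 * y n)
  have hδ : 0 < δ := h.cos_pos n
  have hδk : δ ^ k ≤ δ := pow_le_of_le_one hδ.le (Real.cos_le_one _) hk.ne'
  have hδk0 : 0 < δ ^ k := pow_pos hδ k
  by_contra! hcon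
  rw [lt_min_iff, lt_min_iff, lt_div_iff₀ (by positivity)] at hcon
  obtain ⟨⟨hδ1, hδ2⟩, hδ3⟩ := hcon
  have hlog : 8 * C / (c * m) < log (S₁ / δ) := by
    rw [Real.lt_log_iff_exp_lt (by positivity), lt_div_iff₀' hδ]
    rwa [Real.exp_neg, ← div_eq_mul_inv, lt_div_iff₀ (Real.exp_pos _)] at hδ3
  rw [div_lt_iff₀ (by positivity)] at hlog
  have hCδ : C * δ ^ k ≤ m / 2 := by
    rw [lt_div_iff₀ (by positivity)] at hδ2
    nlinarith [mul_le_mul_of_nonneg_left hδk hC.le]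
  have hy4 : ∀ t ∈ Icc 0 T, 0 ≤ y t ∧ y t < π / 4 := fun t ht =>
    ⟨(hA.arc t ht).1, (abs_lt.1 (h.abs_y_lt t)).2⟩
  have hkey : ∀ s, δ ^ k * log (S₁ / δ) / 4 ≤ s → C * δ ^ k < c * s * (m / 2) := fun s hs => by
    have h1 := mul_lt_mul_of_pos_left hlog hδk0
    have h2 := mul_le_mul_of_nonneg_left hs (by positivity : 0 ≤ c * (m / 2))
    linarith
  rcases le_total (x n) z with hxz | hxz
  · have hmem : ∀ t ∈ Icc 0 (T - n), n + t ∈ Icc 0 T := fun t ht =>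
      ⟨by linarith [hn.1, ht.1], by linarith [ht.2]⟩
    obtain ⟨t, ht, hZ, hζ⟩ := exists_descent_estimate (y := fun t => y (n + t))
      (a := fun t => a (n + t)) (Z := fun t => m - exp (c * x (n + t)))
      (ζ := fun t => -x (n + t)) (L := T - n) hk (by linarith [hn.2])
      (fun t _ => (h.dy (n + t)).comp_const_add n t)
      (fun t ht => ((h.hasDerivAt_pow_mul_cos hbR hk hA.arc (hmem t ht)).comp_const_add n
        t).congr_deriv (by ring))
      (fun t _ => ((h.dx (n + t)).comp_const_add n t).neg)
      (fun t ht => ⟨hdown _ ⟨by linarith [ht.1], (hmem t ht).2⟩, (hA.arc _ (hmem t ht)).2.2⟩)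
      (by simpa using han) (by simpa using hA.return_eq) (fun t ht => hy4 _ (hmem t ht))
      (fun s hs t ht hst => sub_le_sub_left (Real.exp_le_exp.2 (mul_le_mul_of_nonneg_left
        (h.antitoneOn_x hA.arc (hmem s hs) (hmem t ht) (by linarith)) hc.le)) m)
      (by
        have := Real.exp_le_exp.2 (mul_le_mul_of_nonneg_left hxz hc.le)
        simpa only [add_zero, sub_zero] using sub_nonneg.2 this)
      (by simp only [add_zero]; linarith)
    simp only [add_zero] at hZ hζ
    change _ ≤ C * δ ^ k at hZ
    change δ ^ k * log (S₁ / δ) / 4 ≤ _ at hζ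
    set s := -x (n + t) - -x n with hs
    have h1 := hkey s hζ
    have hcs : 0 < c * s := by
      by_contra! h0
      nlinarith [mul_pos hC hδk0]
    have h2 : exp (c * x (n + t)) * (1 + c * s) ≤ m := by
      have e1 : exp (c * x (n + t)) * exp (c * s) ≤ m := by
        rw [← Real.exp_add]
        refine Real.exp_le_exp.2 ?_
        have := mul_le_mul_of_nonneg_left hxz hc.le
        simp only [hs]
        linarith
      have e2 := Real.add_one_le_exp (c * s)
      have e3 := mul_le_mul_of_nonneg_left e2 (Real.exp_pos (c * x (n + t))).le
      linarith
    nlinarith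
  · have hmem : ∀ t ∈ Icc 0 n, n - t ∈ Icc 0 T := fun t ht =>
      ⟨by linarith [ht.2], by linarith [hn.2, ht.1]⟩
    have hcos : ∀ θ, cos (2 * π - θ) = cos θ := Real.cos_two_pi_sub
    have hsin : ∀ θ, sin (2 * π - θ) = -sin θ := Real.sin_two_pi_sub
    obtain ⟨t, ht, hZ, hζ⟩ := exists_descent_estimate (y := fun t => y (n - t))
      (a := fun t => 2 * π - a (n - t)) (Z := fun t => exp (c * x (n - t)) - m)
      (ζ := fun t => x (n - t)) (L := n) hk hn.1
      (fun t _ => ((h.dy (n - t)).comp_const_sub n t).congr_deriv (by rw [hsin]; ring))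
      (fun t ht => by
        simp only [hcos]
        exact ((h.hasDerivAt_pow_mul_cos hbR hk hA.arc (hmem t ht)).comp_const_sub n
          t).congr_deriv (by rw [hsin]; ring))
      (fun t _ => ((h.dx (n - t)).comp_const_sub n t).congr_deriv (by rw [hcos]))
      (fun t ht => ⟨by linarith [hup (n - t) ⟨(hmem t ht).1, by linarith [ht.1]⟩],
        by linarith [(hA.arc _ (hmem t ht)).2.1]⟩)
      (by simp only [sub_zero, han]; ring) (by simpa using h.y0) (fun t ht => hy4 _ (hmem t ht))
      (fun s hs t ht hst => sub_le_sub_right (Real.exp_le_exp.2 (mul_le_mul_of_nonneg_left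
        (h.antitoneOn_x hA.arc (hmem t ht) (hmem s hs) (by linarith)) hc.le)) m)
      (by
        have := Real.exp_le_exp.2 (mul_le_mul_of_nonneg_left hxz hc.le)
        simpa only [add_zero, sub_zero] using sub_nonneg.2 this)
      (by simp only [sub_zero]; linarith)
    simp only [sub_zero] at hZ hζ
    change _ ≤ C * δ ^ k at hZ
    change δ ^ k * log (S₁ / δ) / 4 ≤ _ at hζ
    set s := x (n - t) - x n with hs
    have h1 := hkey s hζ
    have hcs : 0 < c * s := by
      by_contra! h0
      nlinarith [mul_pos hC hδk0]
    have h2 : m * (1 + c * s) ≤ exp (c * x (n - t)) := by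
      have e1 : m * exp (c * s) ≤ exp (c * x (n - t)) := by
        rw [← Real.exp_add]
        refine Real.exp_le_exp.2 ?_
        have := mul_le_mul_of_nonneg_left hxz hc.le
        simp only [hs]
        linarith
      have e2 := Real.add_one_le_exp (c * s)
      nlinarith
    nlinarith

namespace IsShot

variable {c z R b : ℝ} {k : ℕ} {x y a : ℝ → ℝ} {T : ℝ}

theorem cos_pow_le_mul_y (hc : 0 < c) (hzb : z < b) (hbR : b ≤ R) (hk : 0 < k)
    (h : IsShot c z R k b x y a) (hK : IsLeftArc y a T) {n : ℝ} (hn : n ∈ Icc 0 T) (han : a n = π)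
    (hup : ∀ t ∈ Icc 0 n, a t ≤ π) :
    cos (2 * y n) ^ k ≤ (exp (c * b) - exp (c * z)) * y n := by
  have hX : 0 ≤ exp (c * b) - exp (c * z) :=
    sub_nonneg.2 (Real.exp_le_exp.2 (mul_le_mul_of_nonneg_left hzb.le hc.le))
  have hsub : ∀ t ∈ Icc 0 n, t ∈ Icc 0 T := fun t ht => ⟨ht.1, ht.2.trans hn.2⟩
  have := antitoneOn_Icc_of_hasDerivAt
    (fun t ht => (h.hasDerivAt_pow_mul_cos hbR hk hK (hsub t ht)).sub
      ((h.dy t).const_mul (exp (c * b) - exp (c * z))))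
    (fun t ht => by
      have hS := h.cos_pos t
      have hs : 0 ≤ sin (a t) := Real.sin_nonneg_of_nonneg_of_le_pi
        (by linarith [(hK t (hsub t ht)).2.1, Real.pi_pos]) (hup t ht)
      have hx : exp (c * x t) - exp (c * z) ≤ exp (c * b) - exp (c * z) :=
        sub_le_sub_right (Real.exp_le_exp.2 (mul_le_mul_of_nonneg_left
          (h.x_le hK (hsub t ht)) hc.le)) _
      have hp : cos (2 * y t) ^ k * sin (a t) ≤ 1 :=
        mul_le_one₀ (pow_le_one₀ hS.le (Real.cos_le_one _)) hs (Real.sin_le_one _)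
      have h0 : 0 ≤ cos (2 * y t) * sin (a t) := mul_nonneg hS.le hs
      have h1 := mul_le_mul_of_nonneg_left hx
        (mul_nonneg (mul_nonneg (pow_nonneg hS.le k) hs) h0)
      have h2 := mul_le_mul_of_nonneg_right hp (mul_nonneg hX h0)
      rw [pow_succ]
      linarith)
    ⟨le_rfl, hn.1⟩ ⟨hn.1, le_rfl⟩ hn.1
  simp only [Pi.sub_apply, h.y0, h.a0, han, Real.cos_pi, Real.cos_pi_div_two] at this
  linarith

end IsShot

/-- Arches starting at `b > z` have uniformly bounded height, and `b` stays away from `z`. -/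
theorem exists_arch_bounds {c : ℝ} (hc : 0 < c) (z : ℝ) {k : ℕ} (hk : 0 < k) :
    ∃ ym < π / 4, ∃ b₀ > z, ∀ R b x y a T, z < b → b ≤ R → IsShot c z R k b x y a →
      IsArch y a T → b₀ ≤ b ∧ ∀ t ∈ Icc 0 T, y t ≤ ym := by
  obtain ⟨δ, hδ, H⟩ := exists_le_cos_neck hc z hk
  have hpi := Real.pi_pos
  have hm : 0 < exp (c * z) := Real.exp_pos _
  have hδk : 0 < δ ^ k := pow_pos hδ k
  refine ⟨Real.arccos δ / 2, by linarith [Real.arccos_lt_pi_div_two.2 hδ],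
    log (exp (c * z) + δ ^ k / (π / 4)) / c, ?_, fun R b x y a T hzb hbR h hA => ?_⟩
  · rw [gt_iff_lt, lt_div_iff₀ hc, mul_comm, Real.lt_log_iff_exp_lt (by positivity)]
    linarith [div_pos hδk (by linarith : 0 < π / 4)]
  · obtain ⟨n, hn, han, hup, hdown⟩ := h.exists_neck hc hk hA.arc ⟨hA.pos.le, le_rfl⟩
      (h.pi_lt_a_of_isArch hc hA).le
    have hn' : n ∈ Icc 0 T := Ioc_subset_Icc_self hn
    have hcos := H R b x y a T n hbR h hA hn' han hup hdown
    have hyn := hA.arc n hn'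
    have hyn4 := (abs_lt.1 (h.abs_y_lt n)).2
    constructor
    · have h1 := h.cos_pow_le_mul_y hc hzb hbR hk hA.arc hn' han hup
      have h2 := pow_le_pow_left₀ hδ.le hcos k
      have hX : 0 ≤ exp (c * b) - exp (c * z) :=
        sub_nonneg.2 (Real.exp_le_exp.2 (mul_le_mul_of_nonneg_left hzb.le hc.le))
      have h3 := mul_le_mul_of_nonneg_left hyn4.le hX
      rw [div_le_iff₀ hc, Real.log_le_iff_le_exp (by positivity), mul_comm b,
        ← le_sub_iff_add_le', div_le_iff₀ (by positivity)]
      linarith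
    · have h1 : y n ≤ Real.arccos δ / 2 := by
        have := Real.arccos_le_arccos hcos
        rw [Real.arccos_cos (by linarith) (by linarith)] at this
        linarith
      intro t ht
      rcases le_total t n with htn | htn
      · exact (h.monotoneOn_y_of_le_pi hA.arc hn.2 hup ⟨ht.1, htn⟩ ⟨hn.1.le, le_rfl⟩ htn).trans h1
      · exact (h.antitoneOn_y_of_pi_le hA.arc hn.1.le hdown ⟨le_rfl, hn.2⟩ ⟨htn, ht.2⟩
          htn).trans h1

theorem continuous_uncurry_max {f : ℝ → ℝ → ℝ} (hf : ∀ b, Continuous (f b)) {K : ℝ}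
    (hK : ∀ b b' t, 0 ≤ t → |f b t - f b' t| ≤ |b - b'| * exp (K * t)) :
    Continuous fun p : ℝ × ℝ => f p.1 (max p.2 0) := by
  refine continuous_iff_continuousAt.2 fun q => ?_
  have h1 : Tendsto (fun p : ℝ × ℝ => f q.1 (max p.2 0)) (𝓝 q) (𝓝 (f q.1 (max q.2 0))) :=
    ((hf q.1).comp (by fun_prop : Continuous fun p : ℝ × ℝ => max p.2 0)).tendsto q
  have h2 : Tendsto (fun p : ℝ × ℝ => |p.1 - q.1| * exp (K * max p.2 0)) (𝓝 q) (𝓝 0) := by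
    have : Continuous fun p : ℝ × ℝ => |p.1 - q.1| * exp (K * max p.2 0) := by fun_prop
    simpa using this.tendsto q
  have h3 : Tendsto (fun p : ℝ × ℝ => f p.1 (max p.2 0) - f q.1 (max p.2 0)) (𝓝 q) (𝓝 0) :=
    squeeze_zero_norm (fun p => hK _ _ _ (le_max_right _ _)) h2
  simpa [ContinuousAt] using h3.add h1

/-- A shot which returns to the axis `y = 0` orthogonally. -/
theorem exists_orthogonal_arch {c : ℝ} (hc : 0 < c) (z : ℝ) {k : ℕ} (hk : 0 < k) :
    ∃ R b x y a T, z < b ∧ b ≤ R ∧ IsShot c z R k b x y a ∧ IsArch y a T ∧ a T = π + π / 2 := by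
  obtain ⟨R, hzR, hR⟩ := exists_isArch_of_large hc z hk
  obtain ⟨ym, hym, b₀, hb₀, hbd⟩ := exists_arch_bounds hc z hk
  obtain ⟨x, y, a, h, K, hK⟩ := exists_shot hc z R k
  have hx := continuous_uncurry_max (fun b => (h b).continuous_x) fun b b' t ht => (hK b b' t ht).1
  have hy := continuous_uncurry_max (fun b => (h b).continuous_y)
    fun b b' t ht => (hK b b' t ht).2.1
  have ha := continuous_uncurry_max (fun b => (h b).continuous_a)
    fun b b' t ht => (hK b b' t ht).2.2
  set A : Set ℝ := {b | z < b ∧ b ≤ R ∧ ∃ T, IsArch (y b) (a b) T ∧ a b T < π + π / 2}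
  have hRA : R ∈ A := ⟨hzR, le_rfl, hR _ _ _ (h R)⟩
  have hlb : b₀ ∈ lowerBounds A := fun b ⟨hzb, hbR, T, hA, _⟩ =>
    (hbd R b _ _ _ T hzb hbR (h b) hA).1
  obtain ⟨u, -, hu, huA⟩ := exists_seq_tendsto_sInf ⟨R, hRA⟩ ⟨b₀, hlb⟩
  have hb₀' : b₀ ≤ sInf A := le_csInf ⟨R, hRA⟩ hlb
  have hbR' : sInf A ≤ R := csInf_le ⟨b₀, hlb⟩ hRA
  set β := sInf A
  have hzβ : z < β := hb₀.trans_le hb₀'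
  have hβ : β ∉ A := by
    rintro ⟨-, -, hT⟩
    obtain ⟨t, ht, hyt, hs⟩ := ((h β).exists_isArch_iff hc hzβ hbR').1 hT
    have e1 : ∀ᶠ b in 𝓝 β, y b t < 0 := by
      have : Continuous fun b => y b t := by
        simpa [Function.comp_def, max_eq_left ht] using hy.comp (by fun_prop : Continuous fun b : ℝ => (b, t))
      exact this.continuousAt.eventually_lt_const hyt
    have e2 : ∀ᶠ b in 𝓝 β, ∀ s ∈ Icc 0 t, a b (max s 0) < π + π / 2 ∧
        (π / 2 < a b (max s 0) ∨ z < x b (max s 0)) := by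
      refine isCompact_Icc.eventually_forall_of_forall_eventually fun s hs' => ?_
      refine IsOpen.mem_nhds ((isOpen_lt ha continuous_const).inter
        ((isOpen_lt continuous_const ha).union (isOpen_lt continuous_const hx))) ?_
      have := hs s hs'
      simpa [max_eq_left hs'.1] using this
    have e3 : ∀ᶠ b in 𝓝[<] β, b ∈ A := by
      filter_upwards [nhdsWithin_le_nhds (e1.and (e2.and (lt_mem_nhds hzβ))),
        self_mem_nhdsWithin] with b hb hb'
      refine ⟨hb.2.2, (le_of_lt hb').trans hbR',
        ((h b).exists_isArch_iff hc hb.2.2 ((le_of_lt hb').trans hbR')).2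
          ⟨t, ht, hb.1, fun s hs => ?_⟩⟩
      have := hb.2.1 s hs
      rwa [max_eq_left hs.1] at this
    obtain ⟨b, hb, hb'⟩ := (e3.and self_mem_nhdsWithin).exists
    exact not_lt_of_ge (csInf_le ⟨b₀, hlb⟩ hb) hb'
  choose hzu huR T hTA haT using huA
  have hlim : ∀ {f : ℝ → ℝ → ℝ}, (Continuous fun p : ℝ × ℝ => f p.1 (max p.2 0)) →
      ∀ {φ : ℕ → ℕ}, Tendsto φ atTop atTop → ∀ {s : ℕ → ℝ} {s₀ : ℝ}, (∀ n, 0 ≤ s n) →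
      Tendsto s atTop (𝓝 s₀) → Tendsto (fun n => f (u (φ n)) (s n)) atTop (𝓝 (f β s₀)) := by
    intro f hf φ hφ s s₀ hs hss
    have hs₀ : 0 ≤ s₀ := ge_of_tendsto' hss hs
    have := (hf.tendsto (β, s₀)).comp ((hu.comp hφ).prodMk_nhds hss)
    simpa [Function.comp_def, max_eq_left hs₀, max_eq_left (hs _)] using this
  have harc : ∀ {φ : ℕ → ℕ}, Tendsto φ atTop atTop → ∀ {s : ℕ → ℝ} {s₀ : ℝ}, (∀ n, 0 ≤ s n) →
      (∀ᶠ n in atTop, s n ≤ T (φ n)) → Tendsto s atTop (𝓝 s₀) →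
      (0 ≤ y β s₀ ∧ π / 2 ≤ a β s₀ ∧ a β s₀ ≤ π + π / 2) ∧ y β s₀ ≤ ym := by
    intro φ hφ s s₀ hs hsT hss
    have hy' := hlim hy hφ hs hss
    have ha' := hlim ha hφ hs hss
    have key : ∀ᶠ n in atTop, (0 ≤ y (u (φ n)) (s n) ∧ π / 2 ≤ a (u (φ n)) (s n) ∧
        a (u (φ n)) (s n) ≤ π + π / 2) ∧ y (u (φ n)) (s n) ≤ ym := hsT.mono fun n hn =>
      ⟨(hTA _).arc _ ⟨hs n, hn⟩,
        (hbd R _ _ _ _ _ (hzu _) (huR _) (h _) (hTA _)).2 _ ⟨hs n, hn⟩⟩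
    exact ⟨⟨ge_of_tendsto hy' (key.mono fun n hn => hn.1.1),
      ge_of_tendsto ha' (key.mono fun n hn => hn.1.2.1),
      le_of_tendsto ha' (key.mono fun n hn => hn.1.2.2)⟩,
      le_of_tendsto hy' (key.mono fun n hn => hn.2)⟩
  by_cases hbdd : ∃ C, ∃ᶠ n in atTop, T n ≤ C
  · obtain ⟨C, hC⟩ := hbdd
    obtain ⟨T₀, -, φ, hφ, hT₀⟩ := tendsto_subseq_of_frequently_bounded
      (Metric.isBounded_Icc (0 : ℝ) C) (hC.mono fun n hn => ⟨(hTA n).pos.le, hn⟩)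
    have hφ' := hφ.tendsto_atTop
    have hT0 : ∀ n, 0 ≤ T (φ n) := fun n => (hTA _).pos.le
    have hnn : 0 ≤ T₀ := ge_of_tendsto' hT₀ hT0
    have haT₀ : π ≤ a β T₀ := ge_of_tendsto' (hlim ha hφ' hT0 hT₀) fun n =>
      ((h _).pi_lt_a_of_isArch hc (hTA _)).le
    have hpos : 0 < T₀ := hnn.lt_of_ne fun h0 => by
      rw [← h0, (h β).a0] at haT₀
      linarith [Real.pi_pos]
    have hyT₀ : y β T₀ = 0 := tendsto_nhds_unique (hlim hy hφ' hT0 hT₀)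
      (tendsto_const_nhds.congr fun n => (hTA _).return_eq.symm)
    have hK₀ : IsLeftArc (y β) (a β) T₀ := fun t ht => by
      refine (harc hφ' (s := fun n => min t (T (φ n))) (fun n => le_min ht.1 (hT0 n))
        (Eventually.of_forall fun n => min_le_right _ _) ?_).1
      simpa [min_eq_left ht.2] using (tendsto_const_nhds (x := t)).min hT₀
    have hA : IsArch (y β) (a β) T₀ := ⟨hpos, hK₀, hyT₀⟩
    refine ⟨R, β, x β, y β, a β, T₀, hzβ, hbR', h β, hA, ?_⟩
    exact (hK₀ T₀ ⟨hnn, le_rfl⟩).2.2.eq_of_not_lt fun hlt => hβ ⟨hzβ, hbR', T₀, hA, hlt⟩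
  · push Not at hbdd
    have hev : ∀ t, ∀ᶠ n in atTop, t ≤ T n := fun t =>
      (hbdd t).mono fun n hn => hn.le
    have key := fun t (ht : 0 ≤ t) => harc tendsto_id (s := fun _ => t) (fun _ => ht) (hev t)
      tendsto_const_nhds
    exact ((h β).not_forall_isLeftArc hc hbR' hk (fun T t ht => (key t ht.1).1) hym
      fun t ht => (key t ht).2).elim

/-- A closed simple orbit of the untruncated system, in the coordinate `y = θ - π/4`. -/
theorem exists_closed_orbit {c : ℝ} (hc : 0 < c) (z : ℝ) {k : ℕ} (hk : 0 < k) :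
    ∃ x y a : ℝ → ℝ, (∀ t, HasDerivAt x (cos (a t) * cos (2 * y t)) t) ∧
      (∀ t, HasDerivAt y (sin (a t) * cos (2 * y t)) t) ∧
      (∀ t, HasDerivAt a (sin (a t) * cos (2 * y t) * (exp (c * x t) - exp (c * z)) -
        2 * k * cos (a t) * sin (2 * y t)) t) ∧
      (∀ t, |y t| < π / 4) ∧ ∃ T > 0, x 0 ≠ x T ∧ (∀ t, x (t + 2 * T) = x t ∧ y (t + 2 * T) = y t) ∧
        InjOn (fun t => (x t, y t)) (Ico 0 (2 * T)) := by
  obtain ⟨R, b, x, y, a, T, hzb, hbR, h, hA, haT⟩ := exists_orthogonal_arch hc z hk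
  have hT := hA.pos
  have hr0 := h.reflect hc (τ := 0) h.y0 (by rw [h.a0, Real.cos_pi_div_two])
  have hrT := h.reflect hc (τ := T) hA.return_eq
    (by rw [haT, add_comm, Real.cos_add_pi, Real.cos_pi_div_two, neg_zero])
  have hper : ∀ t, x (t + 2 * T) = x t ∧ y (t + 2 * T) = y t := fun t => by
    have h1 := hrT (-t)
    have h2 := hr0 t
    rw [mul_zero, zero_sub] at h2
    rw [sub_neg_eq_add, add_comm, h2.1, h2.2, neg_neg] at h1
    exact h1
  have hanti := h.strictAntiOn_x hc hzb hbR hA.arc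
  have hxR : ∀ t, x t ≤ R := fun t => by
    obtain ⟨s, hs, hst⟩ : ∃ s ∈ Ico 0 (2 * T), x t = x s := by
      have hp : Function.Periodic x (2 * T) := fun t => (hper t).1
      exact hp.exists_mem_Ico₀ (by positivity) t
    rw [hst]
    rcases le_total s T with hsT | hsT
    · exact (h.x_le hA.arc ⟨hs.1, hsT⟩).trans hbR
    · rw [← (hrT s).1]
      exact (h.x_le hA.arc ⟨by linarith [hs.2], by linarith⟩).trans hbR
  refine ⟨x, y, a, h.dx, h.dy, fun t => by simpa [min_eq_left (hxR t)] using h.da t,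
    h.abs_y_lt, T, hT, ?_, hper, ?_⟩
  · exact (hanti ⟨le_rfl, hT.le⟩ ⟨hT.le, le_rfl⟩ hT).ne'
  · have hinj : InjOn x (Icc 0 T) := hanti.injOn
    have hneg : ∀ t ∈ Ioo T (2 * T), y t < 0 := fun t ht => by
      have := h.y_pos hc hA.arc (t := 2 * T - t) ⟨by linarith [ht.2], by linarith [ht.1]⟩
      rw [(hrT t).2] at this
      linarith
    have hmixed : ∀ s ∈ Icc 0 T, ∀ t ∈ Ioo T (2 * T), y s ≠ y t := fun s hs t ht =>
      ((hneg t ht).trans_le (hA.arc s hs).1).ne'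
    intro s hs t ht hst
    obtain ⟨hxst, hyst⟩ := Prod.mk.inj hst
    rcases le_or_gt s T with h1 | h1 <;> rcases le_or_gt t T with h2 | h2
    · exact hinj ⟨hs.1, h1⟩ ⟨ht.1, h2⟩ hxst
    · exact absurd hyst (hmixed s ⟨hs.1, h1⟩ t ⟨h2, ht.2⟩)
    · exact absurd hyst.symm (hmixed t ⟨ht.1, h2⟩ s ⟨h1, hs.2⟩)
    · rw [← (hrT s).1, ← (hrT t).1] at hxst
      have := hinj ⟨by linarith [hs.2], by linarith⟩ ⟨by linarith [ht.2], by linarith⟩ hxst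
      linarith

end

/-- If `m₁ = m₂`, there is a nonconstant solution of (*) staying in `𝒟`,
whose `(ξ, θ)` components are periodic with some period `2T > 0` and trace a
simple closed curve in the plane. -/
theorem stmt13 (g m₁ m₂ : ℕ) (hg : g = 1 ∨ g = 2 ∨ g = 3 ∨ g = 4 ∨ g = 6)
    (hm₁ : 0 < m₁) (hm₂ : 0 < m₂)
    (hm : m₁ = m₂) :
    ∃ ξ θ α : ℝ → ℝ,
      IsSolution g m₁ m₂ ξ θ α ∧
      (∀ t : ℝ, θ t ∈ Set.Ioo 0 (Real.pi / 2)) ∧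
      (∃ t₁ t₂ : ℝ, (ξ t₁, θ t₁, α t₁) ≠ (ξ t₂, θ t₂, α t₂)) ∧
      ∃ T > (0 : ℝ),
        (∀ t : ℝ, ξ (t + 2 * T) = ξ t ∧ θ (t + 2 * T) = θ t) ∧
        Set.InjOn (fun t => (ξ t, θ t)) (Set.Ico 0 (2 * T)) := by
  subst hm
  have hg₀ : (0 : ℝ) < g := by
    rcases hg with rfl | rfl | rfl | rfl | rfl <;> norm_num
  have hc : 0 < 4 / (g : ℝ) := by positivity
  have hm : 0 < mconst g m₁ m₁ := by unfold mconst; positivity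
  obtain ⟨x, y, a, hx, hy, ha, hy4, T, hT, hxT, hper, hinj⟩ :=
    exists_closed_orbit hc (Real.log (mconst g m₁ m₁) / (4 / (g : ℝ))) hm₁
  rw [mul_div_cancel₀ _ hc.ne', Real.exp_log hm] at ha
  have h2 : ∀ t, 2 * (y t + Real.pi / 4) = 2 * y t + Real.pi / 2 := fun t => by ring
  refine ⟨x, fun t => y t + Real.pi / 4, a, fun t => ⟨?_, ?_, ?_⟩, fun t => ?_,
    ⟨0, T, fun h => hxT (Prod.mk.inj h).1⟩, T, hT, fun t => ?_, fun s hs t ht hst => ?_⟩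
  · rw [h2, Real.sin_add_pi_div_two]
    exact hx t
  · rw [h2, Real.sin_add_pi_div_two]
    exact (hy t).add_const _
  · refine (ha t).congr_deriv ?_
    have hl : lfun m₁ m₁ (y t + Real.pi / 4) = -(m₁ * Real.sin (2 * y t)) := by
      rw [lfun, ← mul_sub, ← Real.cos_two_mul', h2, Real.cos_add_pi_div_two, mul_neg]
    rw [hl, h2, Real.sin_add_pi_div_two]
    ring
  · constructor <;> linarith [abs_lt.1 (hy4 t)]
  · simp only [hper t, and_self]
  · obtain ⟨h₁, h₂⟩ := Prod.mk.inj hst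
    exact hinj hs ht (Prod.ext h₁ (add_right_cancel h₂))
end

section
/- There exist constants c₁, c₂, c₃ > 0 and a threshold Ξ ∈ ℝ such that for every ξ₀ > Ξ and every time T₁ > 0 with ξ'_{ξ₀}(T₁)/θ'_{ξ₀}(T₁) = −1 and θ'_{ξ₀}(t) > 0, ξ'_{ξ₀}(t) < 0 for all t ∈ (0, T₁], one has c₁·exp(−(4/g)·ξ₀) ≤ θ_{ξ₀}(T₁) − θ* ≤ c₂·exp(−(4/g)·ξ₀) and ξ₀ − ξ_{ξ₀}(T₁) ≤ c₃·exp(−(4/g)·ξ₀). -/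
/-- `Ξ Θ A` is the family of solutions of (*) indexed by the initial value `ξ₀`,
with initial condition `(ξ, θ, α)(0) = (ξ₀, θ*, π/2)`. -/
def IsShootingFamily (g m₁ m₂ : ℕ) (Ξ Θ A : ℝ → ℝ → ℝ) : Prop :=
  ∀ ξ₀ : ℝ, IsSolution g m₁ m₂ (Ξ ξ₀) (Θ ξ₀) (A ξ₀) ∧
    Ξ ξ₀ 0 = ξ₀ ∧ Θ ξ₀ 0 = thetaStar m₁ m₂ ∧ A ξ₀ 0 = Real.pi / 2

/-- `ξ₀` is of type 1: there is `T > 0` with `θ_{ξ₀}(T) = θ*` and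
`ξ'_{ξ₀}(t) ≠ 0` for all `t ∈ (0, T)`. -/
def Type1 (m₁ m₂ : ℕ) (Ξ Θ A : ℝ → ℝ → ℝ) (ξ₀ : ℝ) : Prop :=
  ∃ T > (0 : ℝ), Θ ξ₀ T = thetaStar m₁ m₂ ∧
    ∀ t ∈ Set.Ioo (0 : ℝ) T, Real.cos (A ξ₀ t) * Real.sin (2 * Θ ξ₀ t) ≠ 0

theorem le_of_hasDerivAt_nonneg {f f' : ℝ → ℝ} {a b : ℝ} (hab : a ≤ b)
    (hf : ∀ t, HasDerivAt f (f' t) t) (hf' : ∀ t ∈ Set.Ioo a b, 0 ≤ f' t) : f a ≤ f b := by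
  have hmono : MonotoneOn f (Set.Icc a b) := by
    refine monotoneOn_of_deriv_nonneg (convex_Icc a b)
      (fun t _ => (hf t).continuousAt.continuousWithinAt)
      (fun t _ => (hf t).differentiableAt.differentiableWithinAt) ?_
    intro t ht
    rw [interior_Icc] at ht
    rw [(hf t).deriv]
    exact hf' t ht
  exact hmono (Set.left_mem_Icc.2 hab) (Set.right_mem_Icc.2 hab) hab

theorem lt_of_hasDerivAt_pos {f f' : ℝ → ℝ} {a b : ℝ} (hab : a < b)
    (hf : ∀ t, HasDerivAt f (f' t) t) (hf' : ∀ t ∈ Set.Ioo a b, 0 < f' t) : f a < f b := by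
  have hmono : StrictMonoOn f (Set.Icc a b) := by
    refine strictMonoOn_of_deriv_pos (convex_Icc a b)
      (fun t _ => (hf t).continuousAt.continuousWithinAt) ?_
    intro t ht
    rw [interior_Icc] at ht
    rw [(hf t).deriv]
    exact hf' t ht
  exact hmono (Set.left_mem_Icc.2 hab.le) (Set.right_mem_Icc.2 hab.le) hab

theorem lt_of_forall_ne {f : ℝ → ℝ} {c a b : ℝ} (hf : Continuous f) (ha : f a < c)
    (hne : ∀ t ∈ Set.Icc a b, f t ≠ c) {t : ℝ} (ht : t ∈ Set.Icc a b) : f t < c := by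
  by_contra! hc
  obtain ⟨u, hu, hfu⟩ := intermediate_value_Icc ht.1 hf.continuousOn ⟨ha.le, hc⟩
  exact hne u ⟨hu.1, hu.2.trans ht.2⟩ hfu

theorem thetaStar_pos {m₁ m₂ : ℕ} (hm₁ : 0 < m₁) (hm₂ : 0 < m₂) : 0 < thetaStar m₁ m₂ := by
  unfold thetaStar
  rw [Real.arctan_pos]
  positivity

theorem thetaStar_lt (m₁ m₂ : ℕ) : thetaStar m₁ m₂ < Real.pi / 2 := Real.arctan_lt_pi_div_two _

theorem lfun_eq {m₁ m₂ : ℕ} (hm₂ : 0 < m₂) (θ : ℝ) :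
    lfun m₁ m₂ θ =
      ((m₁ : ℝ) + m₂) / 2 * (Real.cos (2 * θ) - Real.cos (2 * thetaStar m₁ m₂)) := by
  have h : Real.cos (thetaStar m₁ m₂) ^ 2 = 1 / (1 + (m₁ : ℝ) / m₂) := by
    unfold thetaStar
    rw [Real.cos_sq_arctan, Real.sq_sqrt (by positivity)]
  have h2 : (0 : ℝ) < m₂ := by exact_mod_cast hm₂
  unfold lfun
  rw [Real.cos_two_mul, Real.cos_two_mul, h, Real.sin_sq]
  have : (m₂ : ℝ) + m₁ ≠ 0 := by positivity
  field_simp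
  ring

theorem lfun_nonpos {m₁ m₂ : ℕ} (hm₁ : 0 < m₁) (hm₂ : 0 < m₂) {θ : ℝ}
    (h1 : thetaStar m₁ m₂ ≤ θ) (h2 : θ ≤ Real.pi / 2) : lfun m₁ m₂ θ ≤ 0 := by
  rw [lfun_eq hm₂]
  have h0 := thetaStar_pos hm₁ hm₂
  have : Real.cos (2 * θ) ≤ Real.cos (2 * thetaStar m₁ m₂) :=
    Real.cos_le_cos_of_nonneg_of_le_pi (by linarith) (by linarith) (by linarith)
  exact mul_nonpos_of_nonneg_of_nonpos (by positivity) (by linarith)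

theorem lfun_antitone {m₁ m₂ : ℕ} (hm₂ : 0 < m₂) {θ φ : ℝ} (h0 : 0 ≤ θ)
    (h1 : θ ≤ φ) (h2 : φ ≤ Real.pi / 2) : lfun m₁ m₂ φ ≤ lfun m₁ m₂ θ := by
  rw [lfun_eq hm₂, lfun_eq hm₂]
  have : Real.cos (2 * φ) ≤ Real.cos (2 * θ) :=
    Real.cos_le_cos_of_nonneg_of_le_pi (by linarith) (by linarith) (by linarith)
  gcongr

theorem neg_le_lfun (m₁ m₂ : ℕ) (θ : ℝ) : -(m₂ : ℝ) ≤ lfun m₁ m₂ θ := by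
  unfold lfun
  have h1 : (0 : ℝ) ≤ m₁ * Real.cos θ ^ 2 := by positivity
  have h2 : (m₂ : ℝ) * Real.sin θ ^ 2 ≤ m₂ * 1 :=
    mul_le_mul_of_nonneg_left (Real.sin_sq_le_one θ) (by positivity)
  linarith

/-- Near `θ*`, the function `l` decreases at least linearly. -/
theorem lfun_le_neg_mul_sub {m₁ m₂ : ℕ} (hm₂ : 0 < m₂) {θ : ℝ}
    (h1 : thetaStar m₁ m₂ ≤ θ)
    (h2 : θ - thetaStar m₁ m₂ ≤ Real.sin (2 * thetaStar m₁ m₂) / 4) :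
    lfun m₁ m₂ θ ≤ -(((m₁ : ℝ) + m₂) * Real.sin (2 * thetaStar m₁ m₂) / Real.pi
      * (θ - thetaStar m₁ m₂)) := by
  set τ := thetaStar m₁ m₂
  set s := Real.sin (2 * τ)
  have hs1 : s ≤ 1 := Real.sin_le_one _
  have hpi := Real.pi_gt_three
  have hcos : Real.cos (2 * θ) - Real.cos (2 * τ)
      = -(2 * Real.sin (θ + τ) * Real.sin (θ - τ)) := by
    rw [Real.cos_sub_cos]
    ring_nf
  have hsin : 2 / Real.pi * (θ - τ) ≤ Real.sin (θ - τ) :=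
    Real.mul_le_sin (by linarith) (by linarith)
  have hlip : s / 2 ≤ Real.sin (θ + τ) := by
    have := Real.abs_sin_sub_sin_le (θ + τ) (2 * τ)
    have h3 := (abs_le.1 (this.trans_eq (abs_of_nonneg (by linarith)))).1
    change -(θ + τ - 2 * τ) ≤ Real.sin (θ + τ) - s at h3
    linarith
  have hs0 : 0 ≤ s := by linarith
  rw [lfun_eq hm₂, hcos]
  have hprod : s / 2 * (2 / Real.pi * (θ - τ)) ≤ Real.sin (θ + τ) * Real.sin (θ - τ) :=
    mul_le_mul hlip hsin (mul_nonneg (by positivity) (by linarith)) (by linarith)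
  have := mul_le_mul_of_nonneg_left hprod (show (0 : ℝ) ≤ (m₁ : ℝ) + m₂ by positivity)
  have e : ((m₁ : ℝ) + m₂) * (s / 2 * (2 / Real.pi * (θ - τ)))
      = ((m₁ : ℝ) + m₂) * s / Real.pi * (θ - τ) := by
    field_simp
  rw [e] at this
  linarith

section Arc

variable {g m₁ m₂ : ℕ} {ξ θ α : ℝ → ℝ} {T : ℝ}

theorem IsSolution.continuous_theta (h : IsSolution g m₁ m₂ ξ θ α) : Continuous θ :=
  continuous_iff_continuousAt.2 fun t => (h t).2.1.continuousAt

theorem IsSolution.continuous_alpha (h : IsSolution g m₁ m₂ ξ θ α) : Continuous α :=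
  continuous_iff_continuousAt.2 fun t => (h t).2.2.continuousAt

theorem IsSolution.continuous_xi (h : IsSolution g m₁ m₂ ξ θ α) : Continuous ξ :=
  continuous_iff_continuousAt.2 fun t => (h t).1.continuousAt

theorem theta_mem_Ioo (h : IsSolution g m₁ m₂ ξ θ α) (h0 : 0 < θ 0) (h1 : θ 0 < Real.pi / 2)
    (hpos : ∀ t ∈ Set.Ioc 0 T, 0 < Real.sin (α t) * Real.sin (2 * θ t)) :
    ∀ t ∈ Set.Icc 0 T, θ t ∈ Set.Ioo 0 (Real.pi / 2) := by
  have hc := h.continuous_theta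
  have key : ∀ t ∈ Set.Icc 0 T, Real.sin (2 * θ t) ≠ 0 := by
    intro t ht hz
    rcases ht.1.eq_or_lt with rfl | ht0
    · exact (Real.sin_pos_of_pos_of_lt_pi (x := 2 * θ 0) (by linarith) (by linarith)).ne' hz
    · have := hpos t ⟨ht0, ht.2⟩
      simp [hz] at this
  intro t ht
  constructor
  · have := lt_of_forall_ne (f := fun t => - θ t) (c := 0) (a := 0) (b := T) hc.neg
      (by simpa using h0) (fun u hu hz => key u hu (by
        have : θ u = 0 := by linarith [show - θ u = 0 from hz]
        simp [this])) ht
    linarith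
  · exact lt_of_forall_ne hc h1 (fun u hu hz => key u hu (by
        rw [hz, mul_div_cancel₀ _ two_ne_zero, Real.sin_pi])) ht

theorem alpha_mem_Ioo (h : IsSolution g m₁ m₂ ξ θ α) (h0 : α 0 = Real.pi / 2)
    (hsin : ∀ t ∈ Set.Ioc 0 T, 0 < Real.sin (α t))
    (hcos : ∀ t ∈ Set.Ioc 0 T, Real.cos (α t) < 0) :
    ∀ t ∈ Set.Ioc 0 T, α t ∈ Set.Ioo (Real.pi / 2) Real.pi := by
  have hc := h.continuous_alpha
  have hpi := Real.pi_pos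
  intro t ht
  have hlt : ∀ u ∈ Set.Icc 0 T, α u < Real.pi := by
    intro u hu
    refine lt_of_forall_ne hc (a := 0) (by linarith) (fun v hv hz => ?_) hu
    rcases hv.1.eq_or_lt with rfl | hv0
    · linarith
    · simpa [hz] using hsin v ⟨hv0, hv.2⟩
  have hgt : 0 < α t := by
    have := lt_of_forall_ne (f := fun t => - α t) (c := 0) hc.neg (a := 0) (b := T) (by linarith)
      (fun v hv hz => ?_) (Set.Ioc_subset_Icc_self ht)
    · linarith
    have hz' : α v = 0 := by linarith [show - α v = 0 from hz]
    rcases hv.1.eq_or_lt with rfl | hv0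
    · linarith
    · simpa [hz'] using hsin v ⟨hv0, hv.2⟩
  refine ⟨?_, hlt t (Set.Ioc_subset_Icc_self ht)⟩
  by_contra! hle
  exact (hcos t ht).not_ge (Real.cos_nonneg_of_neg_pi_div_two_le_of_le (by linarith) hle)

theorem eq_three_pi_div_four {x : ℝ} (hx : x ∈ Set.Ioo (Real.pi / 2) Real.pi)
    (h : Real.cos x = -Real.sin x) : x = 3 * Real.pi / 4 := by
  have h1 : Real.sin (x - 3 * Real.pi / 4) = 0 := by
    have e : x - 3 * Real.pi / 4 = x + Real.pi / 4 - Real.pi := by ring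
    rw [e, Real.sin_sub_pi, Real.sin_add, Real.cos_pi_div_four, Real.sin_pi_div_four, h]
    ring
  have hpi := Real.pi_pos
  have := (Real.sin_eq_zero_iff_of_lt_of_lt (by linarith [hx.1]) (by linarith [hx.2])).1 h1
  linarith

theorem cos_add_sin_nonneg {x : ℝ} (hx : x ∈ Set.Icc (Real.pi / 2) (3 * Real.pi / 4)) :
    0 ≤ Real.cos x + Real.sin x := by
  have hpi := Real.pi_pos
  have h : 0 ≤ Real.sin (x + Real.pi / 4) :=
    Real.sin_nonneg_of_nonneg_of_le_pi (by linarith [hx.1]) (by linarith [hx.2])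
  rw [Real.sin_add, Real.cos_pi_div_four, Real.sin_pi_div_four] at h
  have h2 : (0 : ℝ) < √2 / 2 := by positivity
  have e : Real.sin x * (√2 / 2) + Real.cos x * (√2 / 2)
      = (Real.cos x + Real.sin x) * (√2 / 2) := by ring
  rw [e] at h
  exact nonneg_of_mul_nonneg_left h h2

theorem theta_le_theta (h : IsSolution g m₁ m₂ ξ θ α)
    (hα : ∀ t ∈ Set.Icc 0 T, α t ∈ Set.Icc (Real.pi / 2) Real.pi)
    (hθ : ∀ t ∈ Set.Icc 0 T, θ t ∈ Set.Ioo 0 (Real.pi / 2))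
    {a b : ℝ} (ha : 0 ≤ a) (hab : a ≤ b) (hb : b ≤ T) : θ a ≤ θ b := by
  have hpi := Real.pi_pos
  refine le_of_hasDerivAt_nonneg hab (fun t => (h t).2.1) fun t ht => ?_
  have ht' : t ∈ Set.Icc 0 T := ⟨ha.trans ht.1.le, ht.2.le.trans hb⟩
  have h1 := hα t ht'
  have h2 := hθ t ht'
  exact mul_nonneg (Real.sin_nonneg_of_nonneg_of_le_pi (by linarith [h1.1]) h1.2)
    (Real.sin_nonneg_of_nonneg_of_le_pi (by linarith [h2.1]) (by linarith [h2.2]))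

theorem xi_le_xi (h : IsSolution g m₁ m₂ ξ θ α)
    (hα : ∀ t ∈ Set.Icc 0 T, α t ∈ Set.Icc (Real.pi / 2) Real.pi)
    (hθ : ∀ t ∈ Set.Icc 0 T, θ t ∈ Set.Ioo 0 (Real.pi / 2))
    {a b : ℝ} (ha : 0 ≤ a) (hab : a ≤ b) (hb : b ≤ T) : ξ b ≤ ξ a := by
  have hpi := Real.pi_pos
  have := le_of_hasDerivAt_nonneg hab (fun t => (h t).1.neg) fun t ht => ?_
  · simpa using this
  have ht' : t ∈ Set.Icc 0 T := ⟨ha.trans ht.1.le, ht.2.le.trans hb⟩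
  have h1 := hα t ht'
  have h2 := hθ t ht'
  rw [neg_nonneg]
  exact mul_nonpos_of_nonpos_of_nonneg
    (Real.cos_nonpos_of_pi_div_two_le_of_le h1.1 (by linarith [h1.2]))
    (Real.sin_nonneg_of_nonneg_of_le_pi (by linarith [h2.1]) (by linarith [h2.2]))

/-- As long as the slope is at least `-1`, the drop of `ξ` is at most the growth of `θ`. -/
theorem xi_sub_le (h : IsSolution g m₁ m₂ ξ θ α)
    (hα : ∀ t ∈ Set.Icc 0 T, α t ∈ Set.Icc (Real.pi / 2) (3 * Real.pi / 4))
    (hθ : ∀ t ∈ Set.Icc 0 T, θ t ∈ Set.Ioo 0 (Real.pi / 2))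
    {t : ℝ} (ht : t ∈ Set.Icc 0 T) : ξ 0 - ξ t ≤ θ t - θ 0 := by
  have := le_of_hasDerivAt_nonneg ht.1 (fun u => (h u).1.add (h u).2.1) fun u hu => ?_
  · simp only [Pi.add_apply] at this
    linarith
  have hu' : u ∈ Set.Icc 0 T := ⟨hu.1.le, hu.2.le.trans ht.2⟩
  have h2 := hθ u hu'
  have := mul_nonneg (cos_add_sin_nonneg (hα u hu'))
    (Real.sin_nonneg_of_nonneg_of_le_pi (x := 2 * θ u) (by linarith [h2.1]) (by linarith [h2.2]))
  linarith

theorem theta_sub_upper_bound (hm₁ : 0 < m₁) (hm₂ : 0 < m₂)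
    (h : IsSolution g m₁ m₂ ξ θ α) (hT : 0 ≤ T)
    (hα : ∀ t ∈ Set.Icc 0 T, α t ∈ Set.Icc (Real.pi / 2) (3 * Real.pi / 4))
    (hθ : ∀ t ∈ Set.Icc 0 T, θ t ∈ Set.Ioo 0 (Real.pi / 2))
    (hθ0 : θ 0 = thetaStar m₁ m₂) (hα0 : α 0 = Real.pi / 2) (hαT : α T = 3 * Real.pi / 4)
    {B : ℝ} (hB : ∀ t ∈ Set.Icc 0 T, B ≤ Real.exp (4 / (g : ℝ) * ξ t)) :
    (B - mconst g m₁ m₂) * (θ T - thetaStar m₁ m₂) ≤ Real.pi / 4 := by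
  have hpi := Real.pi_pos
  have hα' : ∀ t ∈ Set.Icc 0 T, α t ∈ Set.Icc (Real.pi / 2) Real.pi :=
    fun t ht => ⟨(hα t ht).1, by linarith [(hα t ht).2]⟩
  have := le_of_hasDerivAt_nonneg hT
    (fun u => (h u).2.2.sub ((h u).2.1.const_mul (B - mconst g m₁ m₂))) fun u hu => ?_
  · simp only [Pi.sub_apply, hαT, hα0, hθ0] at this
    linarith
  have hu' := Set.Ioo_subset_Icc_self hu
  have h1 := hα' u hu'
  have h2 := hθ u hu'
  have hmon := theta_le_theta h hα' hθ le_rfl hu.1.le hu.2.le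
  have hl := lfun_nonpos hm₁ hm₂ (hθ0 ▸ hmon) h2.2.le
  have hcos := Real.cos_nonpos_of_pi_div_two_le_of_le h1.1 (by linarith [h1.2])
  have hsin := mul_nonneg (Real.sin_nonneg_of_nonneg_of_le_pi (by linarith [h1.1]) h1.2)
    (Real.sin_nonneg_of_nonneg_of_le_pi (x := 2 * θ u) (by linarith [h2.1]) (by linarith [h2.2]))
  have := mul_nonneg hsin (sub_nonneg.2 (hB u hu'))
  have := mul_nonneg_of_nonpos_of_nonpos hcos hl
  linarith

theorem theta_sub_lower_bound (hm₁ : 0 < m₁) (hm₂ : 0 < m₂)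
    (h : IsSolution g m₁ m₂ ξ θ α) (hT : 0 ≤ T)
    (hα : ∀ t ∈ Set.Icc 0 T, α t ∈ Set.Icc (Real.pi / 2) (3 * Real.pi / 4))
    (hθ : ∀ t ∈ Set.Icc 0 T, θ t ∈ Set.Ioo 0 (Real.pi / 2))
    (hθ0 : θ 0 = thetaStar m₁ m₂) (hα0 : α 0 = Real.pi / 2) (hαT : α T = 3 * Real.pi / 4)
    (hδ : θ T - thetaStar m₁ m₂ ≤ Real.sin (2 * thetaStar m₁ m₂) / 4) :
    Real.pi / 4 ≤ (Real.exp (4 / (g : ℝ) * ξ 0) + 4 * m₂ / Real.sin (2 * thetaStar m₁ m₂))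
      * (θ T - thetaStar m₁ m₂) := by
  have hpi := Real.pi_pos
  set s := Real.sin (2 * thetaStar m₁ m₂) with hs
  have hs0 : 0 < s := Real.sin_pos_of_pos_of_lt_pi
    (by linarith [thetaStar_pos hm₁ hm₂]) (by linarith [thetaStar_lt m₁ m₂])
  have hα' : ∀ t ∈ Set.Icc 0 T, α t ∈ Set.Icc (Real.pi / 2) Real.pi :=
    fun t ht => ⟨(hα t ht).1, by linarith [(hα t ht).2]⟩
  have := le_of_hasDerivAt_nonneg hT
    (fun u => ((h u).2.1.const_mul (Real.exp (4 / (g : ℝ) * ξ 0) + 4 * m₂ / s)).sub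
      (h u).2.2) fun u hu => ?_
  · simp only [Pi.sub_apply, hαT, hα0, hθ0] at this
    linarith
  have hu' := Set.Ioo_subset_Icc_self hu
  have h1 := hα' u hu'
  have h2 := hθ u hu'
  have hmon : thetaStar m₁ m₂ ≤ θ u := hθ0 ▸ theta_le_theta h hα' hθ le_rfl hu.1.le hu.2.le
  have hmon2 := theta_le_theta h hα' hθ hu.1.le hu.2.le le_rfl
  have hcs := cos_add_sin_nonneg (hα u hu')
  have hcos := Real.cos_nonpos_of_pi_div_two_le_of_le h1.1 (by linarith [h1.2])
  have hsin := Real.sin_nonneg_of_nonneg_of_le_pi (by linarith [h1.1]) h1.2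
  have hlip : s / 2 ≤ Real.sin (2 * θ u) := by
    have h3 := Real.abs_sin_sub_sin_le (2 * θ u) (2 * thetaStar m₁ m₂)
    have h4 := (abs_le.1 (h3.trans_eq (abs_of_nonneg (by linarith)))).1
    rw [← hs] at h4
    linarith
  have hss := mul_nonneg hsin (show 0 ≤ Real.sin (2 * θ u) by linarith)
  have hE : Real.exp (4 / (g : ℝ) * ξ u) ≤ Real.exp (4 / (g : ℝ) * ξ 0) :=
    Real.exp_le_exp.2 (mul_le_mul_of_nonneg_left
      (xi_le_xi h hα' hθ le_rfl hu.1.le hu.2.le) (by positivity))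
  have hm : 0 ≤ mconst g m₁ m₂ := by unfold mconst; positivity
  have hl : 2 * Real.cos (α u) * lfun m₁ m₂ (θ u)
      ≤ 4 * m₂ / s * (Real.sin (α u) * Real.sin (2 * θ u)) := by
    have i1 : 2 * Real.cos (α u) * lfun m₁ m₂ (θ u) ≤ 2 * Real.sin (α u) * m₂ := by
      have j1 := mul_nonneg (neg_nonneg.2 hcos) (neg_le_iff_add_nonneg.1 (neg_le_lfun m₁ m₂ (θ u)))
      have j2 := mul_nonneg hcs (show (0 : ℝ) ≤ m₂ by positivity)
      linarith
    have i2 : 2 * Real.sin (α u) * m₂ = 4 * m₂ / s * (Real.sin (α u) * (s / 2)) := by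
      field_simp
      ring
    rw [i2] at i1
    exact i1.trans (by gcongr)
  have := mul_nonneg hss (sub_nonneg.2 hE)
  have := mul_nonneg hss hm
  linarith

/-- While `ξ` stays large and the slope stays below `-1`, the quantity
`(sin α + η) exp (-K ξ)` does not increase. -/
theorem sin_add_mul_exp_antitone (hm₁ : 0 < m₁) (hm₂ : 0 < m₂)
    (h : IsSolution g m₁ m₂ ξ θ α) {a b K : ℝ} (hab : a ≤ b) (hK : 0 < K)
    (hα : ∀ t ∈ Set.Icc a b, α t ∈ Set.Icc (3 * Real.pi / 4) Real.pi)
    (hθ : ∀ t ∈ Set.Icc a b, θ t ∈ Set.Ioo 0 (Real.pi / 2))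
    (hmon : ∀ t ∈ Set.Icc a b, θ a ≤ θ t) (hstar : thetaStar m₁ m₂ ≤ θ a)
    (hE : ∀ t ∈ Set.Icc a b, mconst g m₁ m₂ + K ≤ Real.exp (4 / (g : ℝ) * ξ t)) :
    (Real.sin (α b) + -lfun m₁ m₂ (θ a) / K) * Real.exp (-K * ξ b) ≤
      (Real.sin (α a) + -lfun m₁ m₂ (θ a) / K) * Real.exp (-K * ξ a) := by
  have hpi := Real.pi_pos
  set η := -lfun m₁ m₂ (θ a) / K with hη
  have hηK : η * K = -lfun m₁ m₂ (θ a) := by rw [hη]; field_simp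
  have hθa := hθ a ⟨le_rfl, hab⟩
  have hη0 : 0 ≤ η * K := by
    rw [hηK]; linarith [lfun_nonpos hm₁ hm₂ hstar hθa.2.le]
  have := le_of_hasDerivAt_nonneg hab (fun u =>
    (((h u).2.2.sin.add_const η).mul ((h u).1.const_mul (-K)).exp).neg) fun u hu => ?_
  · simpa using this
  have hu' := Set.Ioo_subset_Icc_self hu
  have h1 := hα u hu'
  have h2 := hθ u hu'
  have hsin := Real.sin_nonneg_of_nonneg_of_le_pi (by linarith [h1.1]) h1.2
  have hs2 := Real.sin_nonneg_of_nonneg_of_le_pi (x := 2 * θ u) (by linarith [h2.1])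
    (by linarith [h2.2])
  have hs1 : Real.sin (2 * θ u) ≤ 1 := Real.sin_le_one _
  have hcos : Real.cos (α u) ≤ -(1 / 2) := by
    have e : Real.cos (Real.pi - Real.pi / 3) = -(1 / 2) := by
      rw [Real.cos_pi_sub, Real.cos_pi_div_three]
    rw [← e]
    exact Real.cos_le_cos_of_nonneg_of_le_pi (by linarith) h1.2 (by linarith [h1.1])
  have hl0 := lfun_nonpos hm₁ hm₂ (hstar.trans (hmon u hu')) h2.2.le
  have hl : lfun m₁ m₂ (θ u) ≤ lfun m₁ m₂ (θ a) :=
    lfun_antitone hm₂ hθa.1.le (hmon u hu') h2.2.le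
  set D := Real.sin (α u) * Real.sin (2 * θ u) *
          (Real.exp (4 / (g : ℝ) * ξ u) - mconst g m₁ m₂) +
        2 * Real.cos (α u) * lfun m₁ m₂ (θ u) with hD
  have hDlow : (Real.sin (α u) + η) * K * Real.sin (2 * θ u) ≤ D := by
    have i1 := mul_nonneg (mul_nonneg hsin hs2) (sub_nonneg.2 (hE u hu'))
    have i2 := mul_nonneg (show 0 ≤ -(1 / 2) - Real.cos (α u) by linarith) (neg_nonneg.2 hl0)
    have i3 := mul_le_mul_of_nonneg_left hs1 hη0
    rw [hD]
    linarith
  have := mul_nonneg (mul_nonneg (show 0 ≤ -Real.cos (α u) by linarith) (sub_nonneg.2 hDlow))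
    (Real.exp_pos (-K * ξ u)).le
  linarith

theorem alpha_lt_alpha (hm₁ : 0 < m₁) (hm₂ : 0 < m₂)
    (h : IsSolution g m₁ m₂ ξ θ α) (hα0 : α 0 = Real.pi / 2)
    (hα : ∀ t ∈ Set.Ioc 0 T, α t ∈ Set.Ioo (Real.pi / 2) Real.pi)
    (hθ : ∀ t ∈ Set.Icc 0 T, θ t ∈ Set.Ioo 0 (Real.pi / 2))
    (hθ0 : θ 0 = thetaStar m₁ m₂) {a b : ℝ} (ha : 0 ≤ a) (hab : a < b) (hb : b ≤ T)
    (hE : mconst g m₁ m₂ < Real.exp (4 / (g : ℝ) * ξ b)) : α a < α b := by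
  have hpi := Real.pi_pos
  have hα' : ∀ t ∈ Set.Icc 0 T, α t ∈ Set.Icc (Real.pi / 2) Real.pi := by
    intro t ht
    rcases ht.1.eq_or_lt with rfl | h0
    · exact ⟨hα0.ge, by linarith⟩
    · exact Set.Ioo_subset_Icc_self (hα t ⟨h0, ht.2⟩)
  refine lt_of_hasDerivAt_pos hab (fun t => (h t).2.2) fun t ht => ?_
  have ht0 : 0 < t := ha.trans_lt ht.1
  have htT : t ≤ T := ht.2.le.trans hb
  have h1 := hα t ⟨ht0, htT⟩
  have h2 := hθ t ⟨ht0.le, htT⟩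
  have hl := lfun_nonpos hm₁ hm₂ (hθ0 ▸ theta_le_theta h hα' hθ le_rfl ht0.le htT) h2.2.le
  have hcos := Real.cos_nonpos_of_pi_div_two_le_of_le h1.1.le (by linarith [h1.2])
  have hsin := mul_pos (Real.sin_pos_of_pos_of_lt_pi (by linarith [h1.1]) h1.2)
    (Real.sin_pos_of_pos_of_lt_pi (x := 2 * θ t) (by linarith [h2.1]) (by linarith [h2.2]))
  have hEt : mconst g m₁ m₂ < Real.exp (4 / (g : ℝ) * ξ t) :=
    hE.trans_le (Real.exp_le_exp.2 (mul_le_mul_of_nonneg_left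
      (xi_le_xi h hα' hθ ht0.le ht.2.le hb) (by positivity)))
  have := mul_pos hsin (sub_pos.2 hEt)
  have := mul_nonneg_of_nonpos_of_nonpos hcos hl
  linarith

/-- The estimates on an arc along which the slope is at least `-1`, with equality at its end. -/
theorem arc_bounds (hm₁ : 0 < m₁) (hm₂ : 0 < m₂)
    (h : IsSolution g m₁ m₂ ξ θ α) (hT : 0 ≤ T)
    (hα : ∀ t ∈ Set.Icc 0 T, α t ∈ Set.Icc (Real.pi / 2) (3 * Real.pi / 4))
    (hθ : ∀ t ∈ Set.Icc 0 T, θ t ∈ Set.Ioo 0 (Real.pi / 2))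
    (hθ0 : θ 0 = thetaStar m₁ m₂) (hα0 : α 0 = Real.pi / 2) (hαT : α T = 3 * Real.pi / 4)
    {κ E₀ : ℝ} (hκ : κ = Real.exp (-(4 / (g : ℝ) * 2))) (hE₀ : E₀ = Real.exp (4 / (g : ℝ) * ξ 0))
    (hm : 2 * mconst g m₁ m₂ ≤ κ * E₀)
    (hs : Real.pi / (2 * κ) ≤ Real.sin (2 * thetaStar m₁ m₂) / 4 * E₀)
    (hs' : 4 * m₂ / Real.sin (2 * thetaStar m₁ m₂) ≤ E₀) :
    Real.pi / 8 / E₀ ≤ θ T - thetaStar m₁ m₂ ∧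
      θ T - thetaStar m₁ m₂ ≤ Real.pi / (2 * κ) / E₀ ∧
      θ T - thetaStar m₁ m₂ ≤ Real.sin (2 * thetaStar m₁ m₂) / 4 ∧
      ξ 0 - ξ T ≤ Real.pi / (2 * κ) / E₀ ∧
      κ * E₀ ≤ Real.exp (4 / (g : ℝ) * ξ T) := by
  have hpi := Real.pi_pos
  have hpi4 := Real.pi_le_four
  have hκ0 : 0 < κ := hκ ▸ Real.exp_pos _
  have hE0 : 0 < E₀ := hE₀ ▸ Real.exp_pos _
  have hTT : T ∈ Set.Icc 0 T := ⟨hT, le_rfl⟩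
  have hstar := thetaStar_pos hm₁ hm₂
  have hB : ∀ t ∈ Set.Icc 0 T, κ * E₀ ≤ Real.exp (4 / (g : ℝ) * ξ t) := by
    intro t ht
    rw [hκ, hE₀, ← Real.exp_add, Real.exp_le_exp]
    have h1 := xi_sub_le h hα hθ ht
    have h2 := (hθ t ht).2
    have := mul_le_mul_of_nonneg_left (show ξ 0 - 2 ≤ ξ t by linarith)
      (show (0 : ℝ) ≤ 4 / g by positivity)
    linarith
  have hα' : ∀ t ∈ Set.Icc 0 T, α t ∈ Set.Icc (Real.pi / 2) Real.pi :=
    fun t ht => ⟨(hα t ht).1, by linarith [(hα t ht).2]⟩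
  have hδ0 : 0 ≤ θ T - thetaStar m₁ m₂ := by
    have := theta_le_theta h hα' hθ le_rfl hT le_rfl
    linarith
  have hup : θ T - thetaStar m₁ m₂ ≤ Real.pi / (2 * κ) / E₀ := by
    have h1 := theta_sub_upper_bound hm₁ hm₂ h hT hα hθ hθ0 hα0 hαT hB
    have h2 := mul_le_mul_of_nonneg_right
      (show κ * E₀ / 2 ≤ κ * E₀ - mconst g m₁ m₂ by linarith) hδ0
    rw [div_div, le_div_iff₀ (by positivity)]
    linarith
  have hsmall : θ T - thetaStar m₁ m₂ ≤ Real.sin (2 * thetaStar m₁ m₂) / 4 :=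
    hup.trans ((div_le_iff₀ hE0).2 hs)
  refine ⟨?_, hup, hsmall, ?_, hB T hTT⟩
  · have h1 := theta_sub_lower_bound hm₁ hm₂ h hT hα hθ hθ0 hα0 hαT hsmall
    rw [← hE₀] at h1
    have h2 := mul_le_mul_of_nonneg_right hs' hδ0
    rw [div_le_iff₀ hE0]
    linarith
  · have := xi_sub_le h hα hθ hTT
    linarith

/-- For large initial `ξ`, the slope takes the value `-1` at most once while the curve keeps
moving to the upper left. -/
theorem eq_of_alpha_eq (hg : 0 < g) (hm₁ : 0 < m₁) (hm₂ : 0 < m₂)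
    (h : IsSolution g m₁ m₂ ξ θ α) (hα0 : α 0 = Real.pi / 2) (hθ0 : θ 0 = thetaStar m₁ m₂)
    {S : ℝ} (hS : 0 ≤ S) (hST : S ≤ T)
    (hα : ∀ t ∈ Set.Ioc 0 T, α t ∈ Set.Ioo (Real.pi / 2) Real.pi)
    (hθ : ∀ t ∈ Set.Icc 0 T, θ t ∈ Set.Ioo 0 (Real.pi / 2))
    (hαS : α S = 3 * Real.pi / 4) (hαT : α T = 3 * Real.pi / 4)
    {κ E₀ K M d : ℝ} (hκ0 : 0 < κ) (hE0 : 0 < E₀)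
    (hK : K = 4 / (g : ℝ) * 2) (hM : M = mconst g m₁ m₂ + K)
    (hd : d = ((m₁ : ℝ) + m₂) * Real.sin (2 * thetaStar m₁ m₂) / (8 * K))
    (hlow : Real.pi / 8 / E₀ ≤ θ S - thetaStar m₁ m₂)
    (hsmall : θ S - thetaStar m₁ m₂ ≤ Real.sin (2 * thetaStar m₁ m₂) / 4)
    (hES : κ * E₀ ≤ Real.exp (4 / (g : ℝ) * ξ S))
    (hME : 2 * M ≤ κ * E₀) (hdE : 2 * M ^ 2 < d * κ ^ 2 * E₀) : S = T := by
  by_contra hne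
  have hlt : S < T := lt_of_le_of_ne hST hne
  have hpi := Real.pi_pos
  have hgR : (0 : ℝ) < g := by exact_mod_cast hg
  have hK0 : 0 < K := by rw [hK]; positivity
  have hm0 : 0 ≤ mconst g m₁ m₂ := by unfold mconst; positivity
  have hM0 : 0 < M := by linarith
  have hα' : ∀ t ∈ Set.Icc 0 T, α t ∈ Set.Icc (Real.pi / 2) Real.pi := by
    intro t ht
    rcases ht.1.eq_or_lt with rfl | h0
    · exact ⟨hα0.ge, by linarith⟩
    · exact Set.Ioo_subset_Icc_self (hα t ⟨h0, ht.2⟩)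
  have hET : Real.exp (4 / (g : ℝ) * ξ T) ≤ M := by
    by_contra! hc
    have := alpha_lt_alpha hm₁ hm₂ h hα0 hα hθ hθ0 hS hlt le_rfl (by linarith)
    linarith
  have hcE : Continuous fun t => Real.exp (4 / (g : ℝ) * ξ t) :=
    Real.continuous_exp.comp (continuous_const.mul h.continuous_xi)
  obtain ⟨b, ⟨hSb, hbT⟩, hEb⟩ := intermediate_value_Icc' hST hcE.continuousOn
    (show M ∈ Set.Icc _ _ from ⟨hET, by linarith⟩)
  replace hEb : Real.exp (4 / (g : ℝ) * ξ b) = M := hEb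
  have hEt : ∀ t ∈ Set.Icc S b, M ≤ Real.exp (4 / (g : ℝ) * ξ t) := by
    intro t ht
    rw [← hEb, Real.exp_le_exp]
    exact mul_le_mul_of_nonneg_left (xi_le_xi h hα' hθ (hS.trans ht.1) ht.2 hbT) (by positivity)
  have hthetaS : thetaStar m₁ m₂ ≤ θ S := hθ0 ▸ theta_le_theta h hα' hθ le_rfl hS hST
  have hanti := sin_add_mul_exp_antitone hm₁ hm₂ h hSb hK0
    (fun t ht => ⟨by
      rcases ht.1.eq_or_lt with rfl | h0
      · exact hαS.ge
      · rw [← hαS]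
        exact (alpha_lt_alpha hm₁ hm₂ h hα0 hα hθ hθ0 hS h0 (ht.2.trans hbT)
          (by linarith [hEt t ht])).le,
      (hα' t ⟨hS.trans ht.1, ht.2.trans hbT⟩).2⟩)
    (fun t ht => hθ t ⟨hS.trans ht.1, ht.2.trans hbT⟩)
    (fun t ht => theta_le_theta h hα' hθ hS ht.1 (ht.2.trans hbT)) hthetaS
    (fun t ht => hM ▸ hEt t ht)
  have hη : d / E₀ ≤ -lfun m₁ m₂ (θ S) / K := by
    have h1 := lfun_le_neg_mul_sub (m₁ := m₁) hm₂ hthetaS hsmall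
    have hs0 : 0 ≤ Real.sin (2 * thetaStar m₁ m₂) := by linarith
    have h2 := mul_le_mul_of_nonneg_left hlow
      (show 0 ≤ ((m₁ : ℝ) + m₂) * Real.sin (2 * thetaStar m₁ m₂) / Real.pi by positivity)
    rw [le_div_iff₀ hK0]
    have e : d / E₀ * K = ((m₁ : ℝ) + m₂) * Real.sin (2 * thetaStar m₁ m₂) / Real.pi
        * (Real.pi / 8 / E₀) := by
      rw [hd]; field_simp
    linarith
  set η := -lfun m₁ m₂ (θ S) / K with hηdef
  have hη0 : 0 ≤ η := div_nonneg
    (by linarith [lfun_nonpos hm₁ hm₂ hthetaS (hθ S ⟨hS, hST⟩).2.le]) hK0.le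
  have hexp : ∀ x : ℝ, Real.exp (-K * x) = 1 / Real.exp (4 / (g : ℝ) * x) ^ 2 := by
    intro x
    rw [← Real.exp_nat_mul, one_div, ← Real.exp_neg, hK]
    congr 1
    push_cast
    ring
  rw [hexp, hexp, hEb, mul_one_div, mul_one_div] at hanti
  have hsinb : 0 ≤ Real.sin (α b) := by
    have := hα' b ⟨hS.trans hSb, hbT⟩
    exact Real.sin_nonneg_of_nonneg_of_le_pi (by linarith [this.1]) this.2
  have hfin : η / M ^ 2 ≤ (1 + η) / (κ * E₀) ^ 2 := by
    calc η / M ^ 2 ≤ (Real.sin (α b) + η) / M ^ 2 := by gcongr; linarith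
      _ ≤ _ := hanti
      _ ≤ (1 + η) / (κ * E₀) ^ 2 := by
        gcongr
        exact Real.sin_le_one _
  rw [div_le_div_iff₀ (by positivity) (by positivity)] at hfin
  rw [div_le_iff₀ hE0] at hη
  have h4 : (2 * M) ^ 2 ≤ (κ * E₀) ^ 2 := by gcongr
  have h5 := mul_le_mul_of_nonneg_left h4 hη0
  have h6 := mul_le_mul_of_nonneg_right hη (show 0 ≤ κ ^ 2 * E₀ by positivity)
  have h7 := mul_nonneg hη0 (sq_nonneg M)
  linarith

end Arc

/-- Lemma 4.4: quantitative bounds at the time `T₁` where the slope is `-1`. -/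
theorem stmt16 (g m₁ m₂ : ℕ) (hg : g = 1 ∨ g = 2 ∨ g = 3 ∨ g = 4 ∨ g = 6)
    (hm₁ : 0 < m₁) (hm₂ : 0 < m₂)
    (Ξ Θ A : ℝ → ℝ → ℝ) (hfam : IsShootingFamily g m₁ m₂ Ξ Θ A) :
    ∃ c₁ > (0 : ℝ), ∃ c₂ > (0 : ℝ), ∃ c₃ > (0 : ℝ), ∃ R : ℝ,
      ∀ ξ₀ > R, ∀ T₁ > (0 : ℝ),
        ((Real.cos (A ξ₀ T₁) * Real.sin (2 * Θ ξ₀ T₁)) /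
            (Real.sin (A ξ₀ T₁) * Real.sin (2 * Θ ξ₀ T₁)) = -1 ∧
          ∀ t ∈ Set.Ioc (0 : ℝ) T₁,
            0 < Real.sin (A ξ₀ t) * Real.sin (2 * Θ ξ₀ t) ∧
            Real.cos (A ξ₀ t) * Real.sin (2 * Θ ξ₀ t) < 0) →
        (c₁ * Real.exp (-(4 / (g : ℝ)) * ξ₀) ≤ Θ ξ₀ T₁ - thetaStar m₁ m₂ ∧
          Θ ξ₀ T₁ - thetaStar m₁ m₂ ≤ c₂ * Real.exp (-(4 / (g : ℝ)) * ξ₀) ∧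
          ξ₀ - Ξ ξ₀ T₁ ≤ c₃ * Real.exp (-(4 / (g : ℝ)) * ξ₀)) := by
  have hg0 : 0 < g := by omega
  have hgR : (0 : ℝ) < g := by exact_mod_cast hg0
  have hpi := Real.pi_pos
  set τ := thetaStar m₁ m₂ with hτ
  have hτ0 : 0 < τ := thetaStar_pos hm₁ hm₂
  have hτ1 : τ < Real.pi / 2 := thetaStar_lt m₁ m₂
  set s := Real.sin (2 * τ) with hs
  have hs0 : 0 < s := Real.sin_pos_of_pos_of_lt_pi (by linarith) (by linarith)
  obtain ⟨κ, hκ⟩ : ∃ κ, κ = Real.exp (-(4 / (g : ℝ) * 2)) := ⟨_, rfl⟩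
  obtain ⟨K, hK⟩ : ∃ K, K = 4 / (g : ℝ) * 2 := ⟨_, rfl⟩
  obtain ⟨M, hM⟩ : ∃ M, M = mconst g m₁ m₂ + K := ⟨_, rfl⟩
  obtain ⟨d, hd⟩ : ∃ d, d = ((m₁ : ℝ) + m₂) * s / (8 * K) := ⟨_, rfl⟩
  have hκ0 : 0 < κ := hκ ▸ Real.exp_pos _
  have hK0 : 0 < K := by rw [hK]; positivity
  have hd0 : 0 < d := by rw [hd]; positivity
  have hlarge : ∀ c > (0 : ℝ), ∀ C : ℝ,
      ∀ᶠ x : ℝ in Filter.atTop, C < c * Real.exp (4 / (g : ℝ) * x) := by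
    intro c hc C
    have : Filter.Tendsto (fun x : ℝ => c * Real.exp (4 / (g : ℝ) * x))
        Filter.atTop Filter.atTop :=
      (Real.tendsto_exp_atTop.comp
        (Filter.tendsto_id.const_mul_atTop (by positivity))).const_mul_atTop hc
    exact this.eventually_gt_atTop C
  obtain ⟨R, hR⟩ := Filter.eventually_atTop.1
    ((hlarge κ hκ0 (2 * M)).and ((hlarge (s / 4) (by positivity) (Real.pi / (2 * κ))).and
      ((hlarge 1 one_pos (4 * m₂ / s)).and (hlarge (d * κ ^ 2) (by positivity) (2 * M ^ 2)))))
  refine ⟨Real.pi / 8, by positivity, Real.pi / (2 * κ), by positivity,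
    Real.pi / (2 * κ), by positivity, R, fun ξ₀ hξ₀ T₁ hT₁ hyp => ?_⟩
  obtain ⟨hslope, hsign⟩ := hyp
  obtain ⟨r1, r2, r3, r4⟩ := hR ξ₀ hξ₀.le
  obtain ⟨hsol, hx0, hy0, ha0⟩ := hfam ξ₀
  obtain ⟨E₀, hE₀⟩ : ∃ E₀, E₀ = Real.exp (4 / (g : ℝ) * ξ₀) := ⟨_, rfl⟩
  rw [← hE₀] at r1 r2 r3 r4
  have hE0 : 0 < E₀ := hE₀ ▸ Real.exp_pos _
  have hθ := theta_mem_Ioo hsol (hy0 ▸ hτ0) (hy0 ▸ hτ1) fun t ht => (hsign t ht).1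
  have hsinθ : ∀ t ∈ Set.Ioc 0 T₁, 0 < Real.sin (2 * Θ ξ₀ t) := by
    intro t ht
    have := hθ t (Set.Ioc_subset_Icc_self ht)
    exact Real.sin_pos_of_pos_of_lt_pi (by linarith [this.1]) (by linarith [this.2])
  have hsin : ∀ t ∈ Set.Ioc 0 T₁, 0 < Real.sin (A ξ₀ t) := fun t ht =>
    pos_of_mul_pos_left (hsign t ht).1 (hsinθ t ht).le
  have hα := alpha_mem_Ioo hsol ha0 hsin fun t ht =>
    neg_of_mul_neg_left (hsign t ht).2 (hsinθ t ht).le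
  have hT₁' : T₁ ∈ Set.Ioc 0 T₁ := ⟨hT₁, le_rfl⟩
  have hαT : A ξ₀ T₁ = 3 * Real.pi / 4 := by
    refine eq_three_pi_div_four (hα T₁ hT₁') ?_
    rw [mul_div_mul_right _ _ (hsinθ T₁ hT₁').ne', div_eq_iff (hsin T₁ hT₁').ne'] at hslope
    linarith
  obtain ⟨S, ⟨⟨hS0, hST⟩, hαS⟩, hSmin⟩ :=
    (isCompact_Icc.inter_right (isClosed_eq hsol.continuous_alpha continuous_const)).exists_isLeast
      (⟨T₁, ⟨hT₁.le, le_rfl⟩, hαT⟩ :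
        (Set.Icc 0 T₁ ∩ {t | A ξ₀ t = 3 * Real.pi / 4}).Nonempty)
  replace hαS : A ξ₀ S = 3 * Real.pi / 4 := hαS
  have hαarc : ∀ t ∈ Set.Icc 0 S, A ξ₀ t ∈ Set.Icc (Real.pi / 2) (3 * Real.pi / 4) := by
    intro t ht
    constructor
    · rcases ht.1.eq_or_lt with rfl | h0
      · exact ha0.ge
      · exact (hα t ⟨h0, ht.2.trans hST⟩).1.le
    · by_contra! hc
      obtain ⟨u, hu, hAu⟩ := intermediate_value_Icc ht.1 hsol.continuous_alpha.continuousOn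
        (show 3 * Real.pi / 4 ∈ Set.Icc _ _ from ⟨by linarith, hc.le⟩)
      have hSu : S ≤ u := hSmin ⟨⟨hu.1, hu.2.trans (ht.2.trans hST)⟩, hAu⟩
      have htS : t = S := le_antisymm ht.2 (hSu.trans hu.2)
      rw [htS] at hc
      linarith
  obtain ⟨hlow, hup, hsmall, hxi, hES⟩ := arc_bounds hm₁ hm₂ hsol hS0 hαarc
    (fun t ht => hθ t ⟨ht.1, ht.2.trans hST⟩) hy0 ha0 hαS hκ (by rw [hx0, hE₀])
    (by linarith) r2.le (by linarith)
  have hSeq : S = T₁ := eq_of_alpha_eq hg0 hm₁ hm₂ hsol ha0 hy0 hS0 hST hα hθ hαS hαT hκ0 hE0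
    hK hM hd hlow hsmall hES r1.le r4
  rw [hSeq] at hlow hup hxi
  rw [hx0] at hxi
  have hinv : Real.exp (-(4 / (g : ℝ)) * ξ₀) = E₀⁻¹ := by rw [hE₀, ← Real.exp_neg, neg_mul]
  rw [hinv, ← div_eq_mul_inv, ← div_eq_mul_inv]
  exact ⟨hlow, hup, hxi⟩
end

section
/- For ξ₀ large enough there is a time T₂ > 0 such that the solution (ξ_{ξ₀}, θ_{ξ₀}, α_{ξ₀}) of (*) with initial condition (ξ₀, θ*, π/2) satisfies θ'_{ξ₀}(T₂) = 0 and ξ_{ξ₀}(T₂) > ξ₀ − 1/ξ₀, while θ_{ξ₀}(t) ∈ (θ*, θ* + 1/ξ₀) and ξ'_{ξ₀}(t) < 0 for all t ∈ (0, T₂]. -/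
open Real Set Filter Topology

lemma lfun_eq_neg_mul_sin_mul_sin {m₁ m₂ : ℕ} (hm₂ : 0 < m₂) (x : ℝ) :
    lfun m₁ m₂ x =
      -(((m₁ : ℝ) + m₂) * (sin (x - thetaStar m₁ m₂) * sin (x + thetaStar m₁ m₂))) := by
  have h2 : (0 : ℝ) < m₂ := by exact_mod_cast hm₂
  have h1 : (0 : ℝ) ≤ m₁ := by positivity
  have hc : cos (thetaStar m₁ m₂) ^ 2 * ((m₁ : ℝ) + m₂) = m₂ := by
    rw [thetaStar, cos_sq_arctan, sq_sqrt (by positivity)]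
    field_simp
    ring
  rw [sin_sub, sin_add, lfun]
  have hx := sin_sq_add_cos_sq x
  have ht := sin_sq_add_cos_sq (thetaStar m₁ m₂)
  set c := cos (thetaStar m₁ m₂)
  set s := sin (thetaStar m₁ m₂)
  have e1 : sin x ^ 2 = 1 - cos x ^ 2 := by linarith
  have e2 : s ^ 2 = 1 - c ^ 2 := by linarith
  have : (sin x * c - cos x * s) * (sin x * c + cos x * s)
      = sin x ^ 2 * c ^ 2 - cos x ^ 2 * s ^ 2 := by ring
  rw [this, e1, e2]
  linear_combination hc

lemma sin_two_mul_thetaStar_pos {m₁ m₂ : ℕ} (hm₁ : 0 < m₁) (hm₂ : 0 < m₂) :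
    0 < sin (2 * thetaStar m₁ m₂) := by
  have h0 : 0 < thetaStar m₁ m₂ := by
    rw [thetaStar, arctan_pos]
    positivity
  have h1 : thetaStar m₁ m₂ < π / 2 := arctan_lt_pi_div_two _
  exact sin_pos_of_pos_of_lt_pi (by linarith) (by linarith)

lemma abs_sub_le_of_abs_hasDerivAt_le_one {f f' : ℝ → ℝ} (hf : ∀ t, HasDerivAt f (f' t) t)
    (hb : ∀ t, |f' t| ≤ 1) {t : ℝ} (ht : 0 ≤ t) : |f t - f 0| ≤ t := by
  have := Convex.norm_image_sub_le_of_norm_hasDerivWithin_le (C := 1) (s := univ)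
    (fun x _ => (hf x).hasDerivWithinAt) (fun x _ => hb x) convex_univ (mem_univ 0) (mem_univ t)
  simpa [abs_of_nonneg ht] using this

lemma abs_mul_le_one_of_abs_le_one {x y : ℝ} (hx : |x| ≤ 1) (hy : |y| ≤ 1) : |x * y| ≤ 1 := by
  rw [abs_mul]
  exact mul_le_one₀ hx (abs_nonneg _) hy

namespace IsSolution

variable {g m₁ m₂ : ℕ} {ξ θ α : ℝ → ℝ}

lemma abs_xi_sub_le (h : IsSolution g m₁ m₂ ξ θ α) {t : ℝ} (ht : 0 ≤ t) : |ξ t - ξ 0| ≤ t :=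
  abs_sub_le_of_abs_hasDerivAt_le_one (fun t => (h t).1)
    (fun _ => abs_mul_le_one_of_abs_le_one (abs_cos_le_one _) (abs_sin_le_one _)) ht

lemma abs_theta_sub_le (h : IsSolution g m₁ m₂ ξ θ α) {t : ℝ} (ht : 0 ≤ t) : |θ t - θ 0| ≤ t :=
  abs_sub_le_of_abs_hasDerivAt_le_one (fun t => (h t).2.1)
    (fun _ => abs_mul_le_one_of_abs_le_one (abs_sin_le_one _) (abs_sin_le_one _)) ht

lemma continuous_alpha_s17 (h : IsSolution g m₁ m₂ ξ θ α) : Continuous α :=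
  continuous_iff_continuousAt.2 fun t => (h t).2.2.continuousAt

lemma continuous_theta_s17 (h : IsSolution g m₁ m₂ ξ θ α) : Continuous θ :=
  continuous_iff_continuousAt.2 fun t => (h t).2.1.continuousAt

/-- While `sin 2θ > 0` and `exp (4ξ/g) > m`, the angle `α` cannot drop below `π / 2`. -/
lemma pi_div_two_le_alpha (h : IsSolution g m₁ m₂ ξ θ α) (hα0 : α 0 = π / 2) {T : ℝ}
    (hs : ∀ t ∈ Icc 0 T, 0 < sin (2 * θ t))
    (hE : ∀ t ∈ Icc 0 T, mconst g m₁ m₂ < exp (4 / (g : ℝ) * ξ t)) {t : ℝ} (ht : t ∈ Icc 0 T) :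
    π / 2 ≤ α t := by
  have := image_le_of_deriv_right_lt_deriv_boundary (f := fun t => -α t) (a := 0) (b := T)
    (B := fun _ => -(π / 2)) (B' := fun _ => 0) h.continuous_alpha_s17.neg.continuousOn
    (fun x _ => (h x).2.2.neg.hasDerivWithinAt) (by simp [hα0])
    (fun x => hasDerivAt_const x _) (fun x hx hxe => by
      have hx' : α x = π / 2 := by linarith
      have := mul_pos (hs x (Ico_subset_Icc_self hx))
        (sub_pos.2 (hE x (Ico_subset_Icc_self hx)))
      simp only [hx', sin_pi_div_two, cos_pi_div_two]
      linarith) ht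
  linarith

lemma strictMonoOn_theta (h : IsSolution g m₁ m₂ ξ θ α) (hα0 : α 0 = π / 2) {T : ℝ}
    (hs : ∀ t ∈ Icc 0 T, 0 < sin (2 * θ t))
    (hE : ∀ t ∈ Icc 0 T, mconst g m₁ m₂ < exp (4 / (g : ℝ) * ξ t))
    (hα : ∀ t ∈ Ico 0 T, α t < π) : StrictMonoOn θ (Icc 0 T) := by
  refine strictMonoOn_of_hasDerivWithinAt_pos (convex_Icc 0 T) h.continuous_theta_s17.continuousOn
    (fun x _ => (h x).2.1.hasDerivWithinAt) fun x hx => ?_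
  rw [interior_Icc] at hx
  have := h.pi_div_two_le_alpha hα0 hs hE (Ioo_subset_Icc_self hx)
  exact mul_pos (sin_pos_of_pos_of_lt_pi (by linarith [pi_pos]) (hα x (Ioo_subset_Ico_self hx)))
    (hs x (Ioo_subset_Icc_self hx))

lemma strictMonoOn_alpha (h : IsSolution g m₁ m₂ ξ θ α) (hm₂ : 0 < m₂) (hα0 : α 0 = π / 2)
    (hθ0 : θ 0 = thetaStar m₁ m₂) {T : ℝ} (hT : T ≤ 1)
    (hs : ∀ t ∈ Icc 0 T, 0 < sin (2 * θ t))
    (hs' : ∀ t ∈ Icc 0 T, 0 < sin (θ t + thetaStar m₁ m₂))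
    (hE : ∀ t ∈ Icc 0 T, mconst g m₁ m₂ < exp (4 / (g : ℝ) * ξ t))
    (hα : ∀ t ∈ Ico 0 T, α t < π) : StrictMonoOn α (Icc 0 T) := by
  refine strictMonoOn_of_hasDerivWithinAt_pos (convex_Icc 0 T) h.continuous_alpha_s17.continuousOn
    (fun x _ => (h x).2.2.hasDerivWithinAt) fun x hx => ?_
  rw [interior_Icc] at hx
  have hxI := Ioo_subset_Icc_self hx
  have hax := h.pi_div_two_le_alpha hα0 hs hE hxI
  have hax' := hα x (Ioo_subset_Ico_self hx)
  have hpos := mul_pos (mul_pos (sin_pos_of_pos_of_lt_pi (by linarith [pi_pos]) hax')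
    (hs x hxI)) (sub_pos.2 (hE x hxI))
  have hc : cos (α x) ≤ 0 := cos_nonpos_of_pi_div_two_le_of_le hax (by linarith [pi_pos])
  have hth := h.strictMonoOn_theta hα0 hs hE hα (left_mem_Icc.2 (hx.1.trans hx.2).le) hxI hx.1
  have hle := (abs_le.1 (h.abs_theta_sub_le hx.1.le)).2
  rw [hθ0] at hth hle
  have hsin : 0 < sin (θ x - thetaStar m₁ m₂) :=
    sin_pos_of_pos_of_lt_pi (by linarith) (by linarith [pi_gt_three, hx.2])
  have hl : lfun m₁ m₂ (θ x) ≤ 0 := by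
    rw [lfun_eq_neg_mul_sin_mul_sin hm₂]
    have := hs' x hxI
    have : 0 ≤ ((m₁ : ℝ) + m₂) * (sin (θ x - thetaStar m₁ m₂) * sin (θ x + thetaStar m₁ m₂)) := by
      positivity
    linarith
  nlinarith [mul_nonneg_of_nonpos_of_nonpos hc hl]

/-- Quantitative form: if `exp (4ξ/g)` is of size `E` on `[0, 2 τ]`, with `E` large compared to
`1 / τ`, then `α` reaches `π` by time `2 τ`. -/
lemma exists_pi_le_alpha (h : IsSolution g m₁ m₂ ξ θ α) (hm₂ : 0 < m₂)
    (hα0 : α 0 = π / 2) (hθ0 : θ 0 = thetaStar m₁ m₂) {τ σ E K : ℝ} (hτ0 : 0 < τ) (hτ : 2 * τ ≤ 1)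
    (hσ : 0 < σ) (hE0 : 0 < E) (hK : 0 < K)
    (hs : ∀ t ∈ Icc 0 (2 * τ), σ ≤ sin (2 * θ t))
    (hs' : ∀ t ∈ Icc 0 (2 * τ), σ ≤ sin (θ t + thetaStar m₁ m₂))
    (hEl : ∀ t ∈ Icc 0 (2 * τ), E / (2 * K) ≤ exp (4 / (g : ℝ) * ξ t) - mconst g m₁ m₂)
    (hEu : ∀ t ∈ Icc 0 (2 * τ), exp (4 / (g : ℝ) * ξ t) - mconst g m₁ m₂ ≤ K * E)
    (h1 : 2 * ((m₁ : ℝ) + m₂) * τ ≤ K * E)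
    (h2 : π / 2 * exp (-(σ / (π * K) * E * τ)) ≤ π / 3)
    (h3 : π / 2 * exp (-(σ / (π * K) * E * τ)) ≤ σ * π / (24 * K) * τ / E) :
    ∃ t ∈ Icc 0 (2 * τ), π ≤ α t := by
  by_contra! hlt
  have hs0 : ∀ t ∈ Icc 0 (2 * τ), 0 < sin (2 * θ t) := fun t ht => hσ.trans_le (hs t ht)
  have hs0' : ∀ t ∈ Icc 0 (2 * τ), 0 < sin (θ t + thetaStar m₁ m₂) :=
    fun t ht => hσ.trans_le (hs' t ht)
  have hE : ∀ t ∈ Icc 0 (2 * τ), mconst g m₁ m₂ < exp (4 / (g : ℝ) * ξ t) := fun t ht => by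
    have : 0 < E / (2 * K) := by positivity
    linarith [hEl t ht]
  have hα : ∀ t ∈ Ico 0 (2 * τ), α t < π := fun t ht => hlt t (Ico_subset_Icc_self ht)
  have hmθ := h.strictMonoOn_theta hα0 hs0 hE hα
  have hmα := h.strictMonoOn_alpha hm₂ hα0 hθ0 hτ hs0 hs0' hE hα
  have hge := fun {t} (ht : t ∈ Icc 0 (2 * τ)) => h.pi_div_two_le_alpha hα0 hs0 hE ht
  have m0 : (0 : ℝ) ∈ Icc 0 (2 * τ) := ⟨le_rfl, by linarith⟩
  have mτ : τ ∈ Icc 0 (2 * τ) := ⟨hτ0.le, by linarith⟩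
  have hN : (1 : ℝ) ≤ (m₁ : ℝ) + m₂ := by
    have : (1 : ℝ) ≤ m₂ := by exact_mod_cast hm₂
    have : (0 : ℝ) ≤ m₁ := by positivity
    linarith
  set N : ℝ := (m₁ : ℝ) + m₂ with hNdef
  have hθge : ∀ t ∈ Icc 0 (2 * τ), 0 ≤ θ t - thetaStar m₁ m₂ := fun t ht => by
    have := hmθ.monotoneOn m0 ht ht.1
    linarith
  have hθle : ∀ t ∈ Icc 0 (2 * τ), θ t - thetaStar m₁ m₂ ≤ 1 := fun t ht => by
    have := (abs_le.1 (h.abs_theta_sub_le ht.1)).2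
    linarith [ht.2]
  have hsinθ : ∀ t ∈ Icc 0 (2 * τ), 0 ≤ sin (θ t - thetaStar m₁ m₂) := fun t ht =>
    sin_nonneg_of_nonneg_of_le_pi (hθge t ht) (by linarith [hθle t ht, pi_gt_three])
  have hcos : ∀ t ∈ Icc 0 (2 * τ), cos (α t) ≤ 0 := fun t ht =>
    cos_nonpos_of_pi_div_two_le_of_le (hge ht) (by linarith [hlt t ht, pi_pos])
  have hsin : ∀ t ∈ Icc 0 (2 * τ), 0 ≤ sin (α t) := fun t ht =>
    sin_nonneg_of_nonneg_of_le_pi (by linarith [hge ht, pi_pos]) (hlt t ht).le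
  -- exponential approach of `α` to `π`
  set k : ℝ := σ / (π * K) * E with hk
  have hdecay : π - α τ ≤ π / 2 * exp (-(k * τ)) := by
    have hanti : AntitoneOn (fun t => (π - α t) * exp (k * t)) (Icc 0 (2 * τ)) := by
      refine antitoneOn_of_hasDerivWithinAt_nonpos (convex_Icc _ _)
        (f' := fun t => -(sin (α t) * sin (2 * θ t) *
          (exp (4 / (g : ℝ) * ξ t) - mconst g m₁ m₂) +
        2 * cos (α t) * lfun m₁ m₂ (θ t)) * exp (k * t) + (π - α t) * (exp (k * t) * k))
        ?_ ?_ ?_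
      · have := h.continuous_alpha_s17
        fun_prop
      · intro t _
        refine HasDerivAt.hasDerivWithinAt ?_
        refine ((h t).2.2.const_sub π).mul ?_
        simpa using ((hasDerivAt_id t).const_mul k).exp
      · intro t ht
        rw [interior_Icc] at ht
        have ht := Ioo_subset_Icc_self ht
        have hl : 0 ≤ 2 * cos (α t) * lfun m₁ m₂ (θ t) := by
          rw [lfun_eq_neg_mul_sin_mul_sin hm₂]
          have := mul_nonneg (mul_nonneg (by linarith : 0 ≤ N) (neg_nonneg.2 (hcos t ht)))
            (mul_nonneg (hsinθ t ht) (hs0' t ht).le)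
          linarith
        have hj : 2 / π * (π - α t) ≤ sin (α t) := by
          rw [← sin_pi_sub]
          exact mul_le_sin (by linarith [hlt t ht]) (by linarith [hge ht])
        have hmain : k * (π - α t) ≤ sin (α t) * sin (2 * θ t) *
            (exp (4 / (g : ℝ) * ξ t) - mconst g m₁ m₂) := by
          have hφ : 0 ≤ π - α t := by linarith [hlt t ht]
          calc k * (π - α t) = 2 / π * (π - α t) * σ * (E / (2 * K)) := by
                rw [hk]; field_simp
            _ ≤ _ := by
                have := hs t ht
                have := hEl t ht
                have := hsin t ht
                have := hs0 t ht
                gcongr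
        have := mul_le_mul_of_nonneg_right (hmain.trans (le_add_of_nonneg_right hl))
          (exp_pos (k * t)).le
        linarith
    have := hanti m0 mτ hτ0.le
    simp only [mul_zero, exp_zero, hα0] at this
    rw [exp_neg, ← div_eq_mul_inv, le_div_iff₀ (exp_pos _)]
    linarith
  have hτα : π - α τ ≤ π / 3 := hdecay.trans h2
  -- `θ` has moved by at least a multiple of `1 / E`
  set δ : ℝ := θ τ - thetaStar m₁ m₂ with hδ
  have hδ0 : 0 ≤ δ := hθge τ mτ
  have hδlow : π / (12 * K * E) ≤ δ := by
    have hanti : AntitoneOn (fun t => α t - K * E * θ t - 2 * N * δ * t) (Icc 0 τ) := by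
      refine antitoneOn_of_hasDerivWithinAt_nonpos (convex_Icc _ _)
        (f' := fun t => (sin (α t) * sin (2 * θ t) *
          (exp (4 / (g : ℝ) * ξ t) - mconst g m₁ m₂) +
        2 * cos (α t) * lfun m₁ m₂ (θ t)) - K * E * (sin (α t) * sin (2 * θ t)) - 2 * N * δ)
        ?_ ?_ ?_
      · have := h.continuous_alpha_s17
        have := h.continuous_theta_s17
        fun_prop
      · intro t _
        refine HasDerivAt.hasDerivWithinAt ?_
        refine ((h t).2.2.sub ((h t).2.1.const_mul _)).sub ?_
        simpa using (hasDerivAt_id t).const_mul (2 * N * δ)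
      · intro t ht
        rw [interior_Icc] at ht
        have htI : t ∈ Icc 0 (2 * τ) := ⟨ht.1.le, by linarith [ht.2]⟩
        have hA := mul_le_mul_of_nonneg_left (hEu t htI)
          (mul_nonneg (hsin t htI) (hs0 t htI).le)
        have hδt : θ t - thetaStar m₁ m₂ ≤ δ := by
          have := hmθ.monotoneOn htI mτ ht.2.le
          linarith
        have hB : -cos (α t) * (sin (θ t - thetaStar m₁ m₂) * sin (θ t + thetaStar m₁ m₂)) ≤
            1 * (δ * 1) := by
          have := hsinθ t htI
          have := hs0' t htI
          gcongr
          · linarith [neg_one_le_cos (α t)]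
          · exact (sin_le (hθge t htI)).trans hδt
          · exact sin_le_one _
        rw [lfun_eq_neg_mul_sin_mul_sin hm₂]
        have := mul_le_mul_of_nonneg_left hB (by linarith : 0 ≤ 2 * N)
        linarith
    have := hanti (left_mem_Icc.2 hτ0.le) (right_mem_Icc.2 hτ0.le) hτ0.le
    simp only [hα0, hθ0, mul_zero, sub_zero] at this
    have hb : 2 * N * δ * τ ≤ K * E * δ := by
      have := mul_le_mul_of_nonneg_right h1 hδ0
      linarith
    rw [div_le_iff₀ (by positivity)]
    have : K * E * θ τ = K * E * δ + K * E * thetaStar m₁ m₂ := by rw [hδ]; ring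
    linarith
  -- on `[τ, 2 τ]` the angle `α` grows at least at a rate proportional to `1 / E`
  have hmono : MonotoneOn (fun t => α t - σ * π / (24 * K) / E * t) (Icc τ (2 * τ)) := by
    refine monotoneOn_of_hasDerivWithinAt_nonneg (convex_Icc _ _)
      (f' := fun t => (sin (α t) * sin (2 * θ t) *
        (exp (4 / (g : ℝ) * ξ t) - mconst g m₁ m₂) +
      2 * cos (α t) * lfun m₁ m₂ (θ t)) - σ * π / (24 * K) / E) ?_ ?_ ?_
    · have := h.continuous_alpha_s17
      fun_prop
    · intro t _
      refine HasDerivAt.hasDerivWithinAt ((h t).2.2.sub ?_)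
      simpa using (hasDerivAt_id t).const_mul (σ * π / (24 * K) / E)
    · intro t ht
      rw [interior_Icc] at ht
      have htI : t ∈ Icc 0 (2 * τ) := ⟨by linarith [ht.1], ht.2.le⟩
      have hA := mul_nonneg (mul_nonneg (hsin t htI) (hs0 t htI).le) (sub_pos.2 (hE t htI)).le
      have hδt : δ ≤ θ t - thetaStar m₁ m₂ := by
        have := hmθ.monotoneOn mτ htI ht.1.le
        linarith
      have hαt : 1 / 2 ≤ -cos (α t) := by
        rw [← cos_pi_sub, ← cos_pi_div_three]
        have := hmα.monotoneOn mτ htI ht.1.le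
        exact cos_le_cos_of_nonneg_of_le_pi (by linarith [hlt t htI]) (by linarith [pi_pos])
          (by linarith)
      have hsl : δ / 2 ≤ sin (θ t - thetaStar m₁ m₂) := by
        have h0 := hθge t htI
        have := mul_le_sin h0 (by linarith [hθle t htI, pi_gt_three])
        have hp : 1 / 2 ≤ 2 / π := by
          rw [div_le_div_iff₀ two_pos pi_pos]
          linarith [pi_le_four]
        nlinarith
      have hB : 1 * (1 / 2) * (π / (12 * K * E) / 2 * σ) ≤
          N * (-cos (α t)) * (sin (θ t - thetaStar m₁ m₂) * sin (θ t + thetaStar m₁ m₂)) := by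
        have := hs' t htI
        gcongr
        · exact hsinθ t htI
        exact (div_le_div_of_nonneg_right hδlow two_pos.le).trans hsl
      have he : 1 * (1 / 2) * (π / (12 * K * E) / 2 * σ) = σ * π / (24 * K) / E / 2 := by
        field_simp; norm_num
      rw [lfun_eq_neg_mul_sin_mul_sin hm₂]
      linarith
  have hfin := hmono (left_mem_Icc.2 mτ.2) (right_mem_Icc.2 mτ.2) mτ.2
  simp only at hfin
  have hl := hlt (2 * τ) (right_mem_Icc.2 (by linarith))
  have : σ * π / (24 * K) * τ / E = σ * π / (24 * K) / E * (2 * τ) - σ * π / (24 * K) / E * τ := by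
    ring
  linarith

end IsSolution

lemma tendsto_id_mul_exp_mul_exp_neg_mul_exp_div {b c : ℝ} (hb : 0 < b) (hc : 0 < c) :
    Tendsto (fun x : ℝ => x * exp (b * x) * exp (-(c * (exp (b * x) / x)))) atTop (𝓝 0) := by
  have hlim : Tendsto (fun x : ℝ => 6 / c ^ 3 * (x ^ 4 * exp (-(2 * b) * x))) atTop (𝓝 0) := by
    have h4 := (isLittleO_pow_exp_pos_mul_atTop 4 (by positivity : 0 < 2 * b)).tendsto_div_nhds_zero
    have := h4.const_mul (6 / c ^ 3)
    rw [mul_zero] at this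
    refine this.congr fun x => ?_
    rw [neg_mul, exp_neg, ← div_eq_mul_inv]
  refine squeeze_zero' ?_ ?_ hlim
  · filter_upwards [eventually_gt_atTop 0] with x hx
    positivity
  · filter_upwards [eventually_gt_atTop 0] with x hx
    have hy : 0 < c * (exp (b * x) / x) := by positivity
    have h3 := pow_div_factorial_le_exp _ hy.le 3
    have h6 : ((Nat.factorial 3 : ℕ) : ℝ) = 6 := by norm_num [Nat.factorial]
    rw [h6] at h3
    rw [exp_neg]
    calc x * exp (b * x) * (exp (c * (exp (b * x) / x)))⁻¹
        ≤ x * exp (b * x) * ((c * (exp (b * x) / x)) ^ 3 / 6)⁻¹ := by gcongr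
      _ = 6 / c ^ 3 * (x ^ 4 * exp (-(2 * b) * x)) := by
        have : exp (-(2 * b) * x) = (exp (b * x) ^ 2)⁻¹ := by
          rw [← exp_nat_mul, ← exp_neg]
          congr 1
          push_cast
          ring
        rw [this]
        have := exp_pos (b * x)
        field_simp

/-- Lemma 4.5: for `ξ₀` large enough there is a time `T₂ > 0` with
`θ'(T₂) = 0`, `ξ(T₂) > ξ₀ - 1/ξ₀`, while `θ(t) ∈ (θ*, θ* + 1/ξ₀)` and
`ξ'(t) < 0` for all `t ∈ (0, T₂]`. -/
theorem stmt17 (g m₁ m₂ : ℕ) (hg : g = 1 ∨ g = 2 ∨ g = 3 ∨ g = 4 ∨ g = 6)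
    (hm₁ : 0 < m₁) (hm₂ : 0 < m₂)
    (Ξ Θ A : ℝ → ℝ → ℝ) (hfam : IsShootingFamily g m₁ m₂ Ξ Θ A) :
    ∃ R : ℝ, ∀ ξ₀ > R, ∃ T₂ > (0 : ℝ),
      Real.sin (A ξ₀ T₂) * Real.sin (2 * Θ ξ₀ T₂) = 0 ∧
      Ξ ξ₀ T₂ > ξ₀ - 1 / ξ₀ ∧
      ∀ t ∈ Set.Ioc (0 : ℝ) T₂,
        Θ ξ₀ t ∈ Set.Ioo (thetaStar m₁ m₂) (thetaStar m₁ m₂ + 1 / ξ₀) ∧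
        Real.cos (A ξ₀ t) * Real.sin (2 * Θ ξ₀ t) < 0 := by
  have hg0 : (0 : ℝ) < g := by
    have : 0 < g := by omega
    exact_mod_cast this
  set b : ℝ := 4 / (g : ℝ) with hb
  have hb0 : 0 < b := by positivity
  set K : ℝ := exp b with hK
  have hK0 : 0 < K := exp_pos b
  set σ : ℝ := sin (2 * thetaStar m₁ m₂) / 2 with hσ
  have hσ0 : 0 < σ := half_pos (sin_two_mul_thetaStar_pos hm₁ hm₂)
  have hm : 0 ≤ mconst g m₁ m₂ := by
    unfold mconst
    positivity
  have hexp : Tendsto (fun x : ℝ => exp (b * x)) atTop atTop :=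
    tendsto_exp_atTop.comp (tendsto_id.const_mul_atTop hb0)
  have hkey := tendsto_id_mul_exp_mul_exp_neg_mul_exp_div hb0
    (by positivity : 0 < σ / (4 * π * K))
  have hev1 := hkey.eventually_le_const (by positivity : 0 < σ / (48 * K))
  have hev2 := hkey.eventually_le_const (by positivity : (0 : ℝ) < 2 / 3)
  have hev3 := hexp.eventually_ge_atTop (2 * K * mconst g m₁ m₂)
  have hev4 := hexp.eventually_ge_atTop (2 * ((m₁ : ℝ) + m₂) / K)
  obtain ⟨R, hR⟩ := eventually_atTop.1 (hev1.and (hev2.and (hev3.and (hev4.and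
    ((eventually_ge_atTop (1 / σ)).and (eventually_ge_atTop 1))))))
  refine ⟨R, fun x hx => ?_⟩
  obtain ⟨e1, e2, e3, e4, e5, e6⟩ := hR x hx.le
  have hx0 : 0 < x := by linarith
  obtain ⟨h, hΞ0, hΘ0, hA0⟩ := hfam x
  set ξ := Ξ x
  set θ := Θ x
  set α := A x
  set E := exp (b * x) with hE
  have hE0 : 0 < E := exp_pos _
  have hE1 : 1 ≤ E := one_le_exp (by positivity)
  set τ : ℝ := 1 / (4 * x) with hτ
  have hτ0 : 0 < τ := by positivity
  have hτx : 2 * τ < 1 / x := by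
    rw [hτ, mul_one_div, div_lt_div_iff₀ (by positivity) hx0]
    linarith
  have hτσ : 4 * τ ≤ σ := by
    have : 4 * τ = 1 / x := by rw [hτ]; field_simp
    rw [this, one_div_le hx0 hσ0]
    exact e5
  have hτ1 : 4 * τ ≤ 1 := by
    have : 4 * τ = 1 / x := by rw [hτ]; field_simp
    rw [this, div_le_one hx0]
    exact e6
  have hθt : ∀ t ∈ Icc 0 (2 * τ), |θ t - thetaStar m₁ m₂| ≤ 2 * τ := fun t ht =>
    hΘ0 ▸ (h.abs_theta_sub_le ht.1).trans ht.2
  have hξt : ∀ t ∈ Icc 0 (2 * τ), |ξ t - x| ≤ 2 * τ := fun t ht => by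
    have := (h.abs_xi_sub_le ht.1).trans ht.2
    rwa [hΞ0] at this
  have hs : ∀ t ∈ Icc 0 (2 * τ), σ ≤ sin (2 * θ t) := fun t ht => by
    have h1 := abs_sin_sub_sin_le (2 * θ t) (2 * thetaStar m₁ m₂)
    rw [← mul_sub, abs_mul, abs_two] at h1
    linarith [hθt t ht, (abs_le.1 h1).1]
  have hs' : ∀ t ∈ Icc 0 (2 * τ), σ ≤ sin (θ t + thetaStar m₁ m₂) := fun t ht => by
    have h1 := abs_sin_sub_sin_le (θ t + thetaStar m₁ m₂) (2 * thetaStar m₁ m₂)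
    rw [two_mul, add_sub_add_right_eq_sub, ← two_mul] at h1
    linarith [hθt t ht, (abs_le.1 h1).1]
  have hEl : ∀ t ∈ Icc 0 (2 * τ), E / (2 * K) ≤ exp (4 / (g : ℝ) * ξ t) - mconst g m₁ m₂ := by
    intro t ht
    have h1 : E / K ≤ exp (4 / (g : ℝ) * ξ t) := by
      rw [hE, hK, ← exp_sub, exp_le_exp]
      nlinarith [(abs_le.1 (hξt t ht)).1]
    have h2 : mconst g m₁ m₂ ≤ E / (2 * K) := by
      rw [le_div_iff₀ (by positivity)]
      linarith
    have h3 : E / K = E / (2 * K) + E / (2 * K) := by field_simp; norm_num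
    linarith
  have hEu : ∀ t ∈ Icc 0 (2 * τ), exp (4 / (g : ℝ) * ξ t) - mconst g m₁ m₂ ≤ K * E := by
    intro t ht
    have h1 : exp (4 / (g : ℝ) * ξ t) ≤ K * E := by
      rw [hE, hK, ← exp_add, exp_le_exp]
      nlinarith [(abs_le.1 (hξt t ht)).2]
    linarith
  have hexparg : σ / (π * K) * E * τ = σ / (4 * π * K) * (E / x) := by
    rw [hτ]; field_simp
  have hreach : ∃ t ∈ Icc 0 (2 * τ), π ≤ α t := by
    refine h.exists_pi_le_alpha hm₂ hA0 hΘ0 hτ0 (by linarith) hσ0 hE0 hK0 hs hs' hEl hEu ?_ ?_ ?_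
    · rw [div_le_iff₀ hK0] at e4
      have hN : (0 : ℝ) ≤ 2 * ((m₁ : ℝ) + m₂) := by positivity
      nlinarith
    · rw [hexparg]
      have h1 : exp (-(σ / (4 * π * K) * (E / x))) ≤ 2 / 3 := by
        refine le_trans ?_ e2
        exact le_mul_of_one_le_left (exp_pos _).le (one_le_mul_of_one_le_of_one_le e6 hE1)
      nlinarith [pi_pos]
    · rw [hexparg]
      have h1 := mul_le_mul_of_nonneg_left e1 (by positivity : 0 ≤ π / 2 / (x * E))
      have h2 : π / 2 / (x * E) * (x * E * exp (-(σ / (4 * π * K) * (E / x)))) =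
          π / 2 * exp (-(σ / (4 * π * K) * (E / x))) := by field_simp
      have h3 : π / 2 / (x * E) * (σ / (48 * K)) = σ * π / (24 * K) * τ / E := by
        rw [hτ]; field_simp; norm_num
      linarith
  obtain ⟨t₁, ht₁, hαt₁⟩ := hreach
  obtain ⟨T, ⟨hTmem, hTπ⟩, hTmin⟩ : ∃ T, IsLeast {t | t ∈ Icc 0 (2 * τ) ∧ π ≤ α t} T := by
    refine IsCompact.exists_isLeast ?_ ⟨t₁, ht₁, hαt₁⟩
    exact isCompact_Icc.inter_right (isClosed_le continuous_const h.continuous_alpha_s17)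
  have hT0 : 0 < T := by
    refine lt_of_le_of_ne hTmem.1 fun h0 => ?_
    rw [← h0, hA0] at hTπ
    linarith [pi_pos]
  have hlt : ∀ t ∈ Ico 0 T, α t < π := fun t ht => by
    by_contra! hc
    exact absurd (hTmin ⟨⟨ht.1, ht.2.le.trans hTmem.2⟩, hc⟩) (not_le.2 ht.2)
  have hTeq : α T = π := by
    refine le_antisymm ?_ hTπ
    refine ContinuousWithinAt.closure_le (s := Ico 0 T) (g := fun _ => π) ?_
      h.continuous_alpha_s17.continuousWithinAt continuousWithinAt_const fun t ht => (hlt t ht).le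
    rw [closure_Ico hT0.ne]
    exact right_mem_Icc.2 hT0.le
  have hsub : Icc 0 T ⊆ Icc 0 (2 * τ) := Icc_subset_Icc_right hTmem.2
  have hs0 : ∀ t ∈ Icc 0 T, 0 < sin (2 * θ t) := fun t ht => hσ0.trans_le (hs t (hsub ht))
  have hs0' : ∀ t ∈ Icc 0 T, 0 < sin (θ t + thetaStar m₁ m₂) :=
    fun t ht => hσ0.trans_le (hs' t (hsub ht))
  have hEm : ∀ t ∈ Icc 0 T, mconst g m₁ m₂ < exp (4 / (g : ℝ) * ξ t) := fun t ht => by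
    have : 0 < E / (2 * K) := by positivity
    linarith [hEl t (hsub ht)]
  have hmθ := h.strictMonoOn_theta hA0 hs0 hEm hlt
  have hmα := h.strictMonoOn_alpha hm₂ hA0 hΘ0 (by linarith [hTmem.2]) hs0 hs0' hEm hlt
  refine ⟨T, hT0, by rw [hTeq, sin_pi, zero_mul], ?_, fun t ht => ⟨⟨?_, ?_⟩, ?_⟩⟩
  · linarith [(abs_le.1 (hξt T hTmem)).1]
  · exact hΘ0 ▸ hmθ (left_mem_Icc.2 hT0.le) (Ioc_subset_Icc_self ht) ht.1
  · linarith [(abs_le.1 (hθt t (hsub (Ioc_subset_Icc_self ht)))).2]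
  · have h1 := hmα (left_mem_Icc.2 hT0.le) (Ioc_subset_Icc_self ht) ht.1
    have h2 := hmα.monotoneOn (Ioc_subset_Icc_self ht) (right_mem_Icc.2 hT0.le) ht.2
    exact mul_neg_of_neg_of_pos
      (cos_neg_of_pi_div_two_lt_of_lt (by linarith) (by linarith [pi_pos]))
      (hs0 t (Ioc_subset_Icc_self ht))
end
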